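/- Define e(x,ξ) := (2π)^{−1/2} T(ξ) f₊(x,ξ) for ξ > 0. Then the smooth functions a, b with e(x,ξ) = e^{ixξ} a(x,ξ) + e^{−ixξ} b(x,ξ) (extended to ξ < 0 by a(x,−ξ) := a(−x,ξ), b(x,−ξ) := b(−x,ξ)) can be chosen to satisfy, in addition: for 0 < |ξ| ≤ 1, |∂ₓa(x,ξ)| + |∂ₓb(x,ξ)| ≤ C ⟨x⟩^{−1} ⟨xξ⟩^{−1}, |∂_ξ a(x,ξ)| + |∂_ξ b(x,ξ)| ≤ C (1 + |ξ|^{−1} ⟨xξ⟩^{−1}), and also |∂ₓa(x,ξ)| + |∂ₓb(x,ξ)| ≤ C (ξ² ⟨x⟩ if |xξ| ≤ 1, and x^{−2}|ξ|^{−1} if |xξ| ≥ 1); for |ξ| ≥ 1, |∂ₓa(x,ξ)| + |∂ₓb(x,ξ)| ≤ C |ξ|^{−1} ⟨x⟩^{−2} and |∂_ξ a(x,ξ)| + |∂_ξ b(x,ξ)| ≤ C ξ^{−2}; and all of these bounds are stable under arbitrary applications of ⟨x⟩∂ₓ and ξ∂_ξ (with constants C_{k,l}). -/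

import Mathlib

noncomputable section

open MeasureTheory Complex Filter

/-- Japanese bracket `⟨x⟩ = (1+x²)^{1/2}`. -/
def jap (x : ℝ) : ℝ := Real.sqrt (1 + x ^ 2)

/-- The operator `g ↦ ⟨x⟩ ∂ₓ g` acting in the first variable. -/
def DX (F : ℝ → ℝ → ℂ) : ℝ → ℝ → ℂ := fun x ξ => (jap x : ℂ) * deriv (fun y => F y ξ) x

/-- The operator `g ↦ ξ ∂_ξ g` acting in the second variable. -/
def DXI (F : ℝ → ℝ → ℂ) : ℝ → ℝ → ℂ := fun x ξ => (ξ : ℂ) * deriv (fun η => F x η) ξ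

/-- `∂ₓ` in the first variable. -/
def PDX (F : ℝ → ℝ → ℂ) : ℝ → ℝ → ℂ := fun x ξ => deriv (fun y => F y ξ) x

/-- `∂_ξ` in the second variable. -/
def PDXI (F : ℝ → ℝ → ℂ) : ℝ → ℝ → ℂ := fun x ξ => deriv (fun η => F x η) ξ

/-- The Wronskian `W[f,g](ξ) = f g' − f' g`, evaluated at `x = 0`. -/
def Wr (f g : ℝ → ℝ → ℂ) (ξ : ℝ) : ℂ :=
  f 0 ξ * deriv (fun x => g x ξ) 0 - deriv (fun x => f x ξ) 0 * g 0 ξ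

/-- `f₋(x,ξ) := f₊(−x,ξ)`. -/
def fminus (f : ℝ → ℝ → ℂ) : ℝ → ℝ → ℂ := fun x ξ => f (-x) ξ

/-- Transmission coefficient `T(ξ) = −2iξ / W[f₊,f₋](ξ)`. -/
def Tcoef (f : ℝ → ℝ → ℂ) (ξ : ℝ) : ℂ :=
  (-2 * Complex.I * ξ) / Wr f (fminus f) ξ

/-- The distorted Fourier basis element `e(x,ξ) = (2π)^{−1/2} T(ξ) f₊(x,ξ)` for `ξ > 0`. -/
def eBasis (f : ℝ → ℝ → ℂ) (x ξ : ℝ) : ℂ :=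
  ((Real.sqrt (2 * Real.pi))⁻¹ : ℝ) * Tcoef f ξ * f x ξ

/-- Pointwise bound of `F` by a multiple of the weight `w` on `U`. -/
def WBdd (U : Set (ℝ × ℝ)) (w : ℝ → ℝ → ℝ) (F : ℝ → ℝ → ℂ) : Prop :=
  ∃ C : ℝ, 0 ≤ C ∧ ∀ x ξ, (x, ξ) ∈ U → ‖F x ξ‖ ≤ C * w x ξ

/-- Symbol estimates of order `n` with weight `w`: each `∂ₓ` gains `⟨x⟩⁻¹`, each `∂_ξ` gains
`|ξ|⁻¹`. -/
def SymN (U : Set (ℝ × ℝ)) : ℕ → (ℝ → ℝ → ℝ) → (ℝ → ℝ → ℂ) → Prop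
  | 0, w, F => WBdd U w F
  | n + 1, w, F => WBdd U w F ∧ SymN U n (fun x ξ => w x ξ / jap x) (PDX F) ∧
      SymN U n (fun x ξ => w x ξ / |ξ|) (PDXI F)

/-- Joint smoothness on `U`. -/
def Smooth2 (U : Set (ℝ × ℝ)) (F : ℝ → ℝ → ℂ) : Prop :=
  ContDiffOn ℝ (⊤ : ℕ∞) (fun p : ℝ × ℝ => F p.1 p.2) U

/-- Smooth symbols of weight `w` on `U`. -/
def Symb (U : Set (ℝ × ℝ)) (w : ℝ → ℝ → ℝ) (F : ℝ → ℝ → ℂ) : Prop :=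
  Smooth2 U F ∧ ∀ n, SymN U n w F

lemma jap_sq (x : ℝ) : jap x ^ 2 = 1 + x ^ 2 := by
  unfold jap; rw [Real.sq_sqrt]; positivity

lemma one_le_jap (x : ℝ) : 1 ≤ jap x := by
  unfold jap; rw [Real.one_le_sqrt]; nlinarith [sq_nonneg x]

lemma jap_pos (x : ℝ) : 0 < jap x := lt_of_lt_of_le one_pos (one_le_jap x)

lemma abs_le_jap (x : ℝ) : |x| ≤ jap x := by
  unfold jap; apply Real.abs_le_sqrt; linarith

lemma jap_le (x : ℝ) : jap x ≤ 1 + |x| := by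
  unfold jap; apply Real.sqrt_le_iff.2; constructor
  · positivity
  · nlinarith [abs_nonneg x, sq_abs x]

lemma jap_neg (x : ℝ) : jap (-x) = jap x := by simp [jap]

section basic
variable {U : Set (ℝ × ℝ)} {w w' w₁ w₂ : ℝ → ℝ → ℝ} {F G : ℝ → ℝ → ℂ} {n : ℕ}

lemma SymN.bdd (h : SymN U n w F) : WBdd U w F := by
  cases n with
  | zero => exact h
  | succ n => exact h.1

lemma SymN.pred (h : SymN U (n + 1) w F) : SymN U n w F := by
  induction n generalizing w F with
  | zero => exact h.1
  | succ n ih => exact ⟨h.1, ih h.2.1, ih h.2.2⟩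

lemma WBdd.mono {K : ℝ} (h : WBdd U w F) (hK : 0 ≤ K)
    (hw : ∀ x ξ, (x, ξ) ∈ U → w x ξ ≤ K * w' x ξ) : WBdd U w' F := by
  obtain ⟨C, hC, h⟩ := h
  refine ⟨C * K, mul_nonneg hC hK, fun x ξ hx => (h x ξ hx).trans ?_⟩
  rw [mul_assoc]
  exact mul_le_mul_of_nonneg_left (hw x ξ hx) hC

lemma SymN.mono {K : ℝ} (h : SymN U n w F) (hK : 0 ≤ K)
    (hw : ∀ x ξ, (x, ξ) ∈ U → w x ξ ≤ K * w' x ξ) : SymN U n w' F := by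
  induction n generalizing w w' F with
  | zero => exact WBdd.mono h hK hw
  | succ n ih =>
    refine ⟨h.1.mono hK hw, ih h.2.1 fun x ξ hx => ?_, ih h.2.2 fun x ξ hx => ?_⟩
    · rw [← mul_div_assoc]
      exact div_le_div_of_nonneg_right (hw x ξ hx) (jap_pos x).le
    · rw [← mul_div_assoc]
      exact div_le_div_of_nonneg_right (hw x ξ hx) (abs_nonneg ξ)

lemma SymN.weight_eq (h : SymN U n w F)
    (hw : ∀ x ξ, (x, ξ) ∈ U → w x ξ = w' x ξ) : SymN U n w' F :=
  h.mono zero_le_one fun x ξ hx => by rw [hw x ξ hx, one_mul]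

lemma SymN.restrict {V : Set (ℝ × ℝ)} (h : SymN U n w F) (hV : V ⊆ U) : SymN V n w F := by
  induction n generalizing w F with
  | zero => obtain ⟨C, hC, h⟩ := h; exact ⟨C, hC, fun x ξ hx => h x ξ (hV hx)⟩
  | succ n ih =>
    refine ⟨?_, ih h.2.1, ih h.2.2⟩
    obtain ⟨C, hC, h⟩ := h.1; exact ⟨C, hC, fun x ξ hx => h x ξ (hV hx)⟩

lemma eventually_slice_left (hU : IsOpen U) {x ξ : ℝ} (hx : (x, ξ) ∈ U) :
    ∀ᶠ y in nhds x, (y, ξ) ∈ U :=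
  (hU.preimage (Continuous.prodMk_left ξ)).mem_nhds hx

lemma eventually_slice_right (hU : IsOpen U) {x ξ : ℝ} (hx : (x, ξ) ∈ U) :
    ∀ᶠ η in nhds ξ, (x, η) ∈ U :=
  (hU.preimage (Continuous.prodMk_right x)).mem_nhds hx

lemma PDX_congr (hU : IsOpen U) (h : ∀ x ξ, (x, ξ) ∈ U → F x ξ = G x ξ) {x ξ : ℝ}
    (hx : (x, ξ) ∈ U) : PDX F x ξ = PDX G x ξ :=
  Filter.EventuallyEq.deriv_eq ((eventually_slice_left hU hx).mono fun y hy => h y ξ hy)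

lemma PDXI_congr (hU : IsOpen U) (h : ∀ x ξ, (x, ξ) ∈ U → F x ξ = G x ξ) {x ξ : ℝ}
    (hx : (x, ξ) ∈ U) : PDXI F x ξ = PDXI G x ξ :=
  Filter.EventuallyEq.deriv_eq ((eventually_slice_right hU hx).mono fun y hy => h x y hy)

lemma SymN.congr (hU : IsOpen U) (hF : SymN U n w F)
    (h : ∀ x ξ, (x, ξ) ∈ U → F x ξ = G x ξ) : SymN U n w G := by
  have hb : ∀ {w F G}, WBdd U w F → (∀ x ξ, (x, ξ) ∈ U → F x ξ = G x ξ) → WBdd U w G := by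
    rintro w F G ⟨C, hC, hF⟩ h
    exact ⟨C, hC, fun x ξ hx => h x ξ hx ▸ hF x ξ hx⟩
  induction n generalizing w F G with
  | zero => exact hb hF h
  | succ n ih =>
    exact ⟨hb hF.1 h, ih hF.2.1 fun x ξ hx => PDX_congr hU h hx,
      ih hF.2.2 fun x ξ hx => PDXI_congr hU h hx⟩

lemma Smooth2.congr (hF : Smooth2 U F) (h : ∀ x ξ, (x, ξ) ∈ U → F x ξ = G x ξ) :
    Smooth2 U G :=
  ContDiffOn.congr hF fun p hp => (h p.1 p.2 hp).symm

lemma Smooth2.restrict {V : Set (ℝ × ℝ)} (h : Smooth2 U F) (hV : V ⊆ U) : Smooth2 V F :=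
  ContDiffOn.mono h hV

lemma Smooth2.hasFDerivAt (hU : IsOpen U) (hF : Smooth2 U F) {p : ℝ × ℝ} (hp : p ∈ U) :
    HasFDerivAt (fun p : ℝ × ℝ => F p.1 p.2) (fderiv ℝ (fun p : ℝ × ℝ => F p.1 p.2) p) p :=
  (((hF p hp).contDiffAt (hU.mem_nhds hp)).differentiableAt (by simp)).hasFDerivAt

lemma Smooth2.hasDerivAt_left' (hU : IsOpen U) (hF : Smooth2 U F) {x ξ : ℝ} (hx : (x, ξ) ∈ U) :
    HasDerivAt (fun y => F y ξ) (fderiv ℝ (fun p : ℝ × ℝ => F p.1 p.2) (x, ξ) (1, 0)) x := by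
  have h1 : HasDerivAt (fun y : ℝ => (y, ξ)) ((1 : ℝ), (0 : ℝ)) x :=
    (hasDerivAt_id x).prodMk (hasDerivAt_const x ξ)
  exact (hF.hasFDerivAt hU hx).comp_hasDerivAt x h1

lemma Smooth2.hasDerivAt_right' (hU : IsOpen U) (hF : Smooth2 U F) {x ξ : ℝ} (hx : (x, ξ) ∈ U) :
    HasDerivAt (fun y => F x y) (fderiv ℝ (fun p : ℝ × ℝ => F p.1 p.2) (x, ξ) (0, 1)) ξ := by
  have h1 : HasDerivAt (fun y : ℝ => (x, y)) ((0 : ℝ), (1 : ℝ)) ξ :=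
    (hasDerivAt_const ξ x).prodMk (hasDerivAt_id ξ)
  exact (hF.hasFDerivAt hU hx).comp_hasDerivAt ξ h1

lemma Smooth2.hasDerivAt_left (hU : IsOpen U) (hF : Smooth2 U F) {x ξ : ℝ} (hx : (x, ξ) ∈ U) :
    HasDerivAt (fun y => F y ξ) (PDX F x ξ) x :=
  (hF.hasDerivAt_left' hU hx).differentiableAt.hasDerivAt

lemma Smooth2.hasDerivAt_right (hU : IsOpen U) (hF : Smooth2 U F) {x ξ : ℝ} (hx : (x, ξ) ∈ U) :
    HasDerivAt (fun y => F x y) (PDXI F x ξ) ξ :=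
  (hF.hasDerivAt_right' hU hx).differentiableAt.hasDerivAt

lemma Smooth2.pdx (hU : IsOpen U) (hF : Smooth2 U F) : Smooth2 U (PDX F) := by
  have h := ContDiffOn.fderiv_of_isOpen (m := ((⊤ : ℕ∞) : WithTop ℕ∞)) hF hU (by simp)
  have h2 : ContDiffOn ℝ (⊤ : ℕ∞)
      (fun p => fderiv ℝ (fun p : ℝ × ℝ => F p.1 p.2) p (1, 0)) U :=
    h.clm_apply contDiffOn_const
  exact h2.congr fun p hp => (hF.hasDerivAt_left' hU hp).deriv

lemma Smooth2.pdxi (hU : IsOpen U) (hF : Smooth2 U F) : Smooth2 U (PDXI F) := by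
  have h := ContDiffOn.fderiv_of_isOpen (m := ((⊤ : ℕ∞) : WithTop ℕ∞)) hF hU (by simp)
  have h2 : ContDiffOn ℝ (⊤ : ℕ∞)
      (fun p => fderiv ℝ (fun p : ℝ × ℝ => F p.1 p.2) p (0, 1)) U :=
    h.clm_apply contDiffOn_const
  exact h2.congr fun p hp => (hF.hasDerivAt_right' hU hp).deriv

lemma Smooth2.comm (hU : IsOpen U) (hF : Smooth2 U F) {x ξ : ℝ} (hx : (x, ξ) ∈ U) :
    PDX (PDXI F) x ξ = PDXI (PDX F) x ξ := by
  set f : ℝ × ℝ → ℂ := fun p => F p.1 p.2 with hf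
  have h := ContDiffOn.fderiv_of_isOpen (m := ((⊤ : ℕ∞) : WithTop ℕ∞)) hF hU (by simp)
  have hd : HasFDerivAt (fderiv ℝ f) (fderiv ℝ (fderiv ℝ f) (x, ξ)) (x, ξ) :=
    (((h _ hx).contDiffAt (hU.mem_nhds hx)).differentiableAt (by simp)).hasFDerivAt
  have hs : IsSymmSndFDerivAt ℝ f (x, ξ) := by
    apply ((hF _ hx).contDiffAt (hU.mem_nhds hx)).isSymmSndFDerivAt
    simp only [minSmoothness_of_isRCLikeNormedField]
    exact WithTop.coe_le_coe.2 le_top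
  have e1 : PDX (PDXI F) x ξ = fderiv ℝ (fderiv ℝ f) (x, ξ) (1, 0) (0, 1) := by
    rw [PDX_congr hU (F := PDXI F) (G := fun x ξ => fderiv ℝ f (x, ξ) (0, 1))
      (fun a b hab => (hF.hasDerivAt_right' hU hab).deriv) hx]
    have h1 : HasDerivAt (fun y : ℝ => (y, ξ)) ((1 : ℝ), (0 : ℝ)) x :=
      (hasDerivAt_id x).prodMk (hasDerivAt_const x ξ)
    have h2 : HasDerivAt (fun y : ℝ => fderiv ℝ f (y, ξ)) (fderiv ℝ (fderiv ℝ f) (x, ξ) (1, 0)) x :=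
      hd.comp_hasDerivAt x h1
    have h3 := ((ContinuousLinearMap.apply ℝ ℂ (((0, 1) : ℝ × ℝ))).hasFDerivAt).comp_hasDerivAt x h2
    exact h3.deriv
  have e2 : PDXI (PDX F) x ξ = fderiv ℝ (fderiv ℝ f) (x, ξ) (0, 1) (1, 0) := by
    rw [PDXI_congr hU (F := PDX F) (G := fun x ξ => fderiv ℝ f (x, ξ) (1, 0))
      (fun a b hab => (hF.hasDerivAt_left' hU hab).deriv) hx]
    have h1 : HasDerivAt (fun y : ℝ => (x, y)) ((0 : ℝ), (1 : ℝ)) ξ :=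
      (hasDerivAt_const ξ x).prodMk (hasDerivAt_id ξ)
    have h2 : HasDerivAt (fun y : ℝ => fderiv ℝ f (x, y)) (fderiv ℝ (fderiv ℝ f) (x, ξ) (0, 1)) ξ :=
      hd.comp_hasDerivAt ξ h1
    have h3 := ((ContinuousLinearMap.apply ℝ ℂ (((1, 0) : ℝ × ℝ))).hasFDerivAt).comp_hasDerivAt ξ h2
    exact h3.deriv
  rw [e1, e2, hs.eq]

end basic

section algebra
variable {U : Set (ℝ × ℝ)} {w w' w₁ w₂ : ℝ → ℝ → ℝ} {F G : ℝ → ℝ → ℂ} {n : ℕ}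

lemma SymN.zero : SymN U n w (fun _ _ => 0) := by
  induction n generalizing w with
  | zero => exact ⟨0, le_rfl, fun x ξ _ => by simp⟩
  | succ n ih =>
    refine ⟨⟨0, le_rfl, fun x ξ _ => by simp⟩, ?_, ?_⟩
    · have : PDX (fun _ _ => (0 : ℂ)) = fun _ _ => 0 := by funext x ξ; simp [PDX]
      rw [this]; exact ih
    · have : PDXI (fun _ _ => (0 : ℂ)) = fun _ _ => 0 := by funext x ξ; simp [PDXI]
      rw [this]; exact ih

lemma SymN.const (c : ℂ) : SymN U n (fun _ _ => 1) (fun _ _ => c) := by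
  have hb : WBdd U (fun _ _ => 1) (fun _ _ => c) := ⟨‖c‖, norm_nonneg c, fun x ξ _ => by simp⟩
  cases n with
  | zero => exact hb
  | succ n =>
    refine ⟨hb, ?_, ?_⟩
    · have : PDX (fun _ _ => c) = fun _ _ => 0 := by funext x ξ; simp [PDX]
      rw [this]; exact SymN.zero
    · have : PDXI (fun _ _ => c) = fun _ _ => 0 := by funext x ξ; simp [PDXI]
      rw [this]; exact SymN.zero

lemma Smooth2.const (c : ℂ) : Smooth2 U (fun _ _ => c) := contDiffOn_const

lemma Symb.const (c : ℂ) : Symb U (fun _ _ => 1) (fun _ _ => c) :=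
  ⟨Smooth2.const c, fun _ => SymN.const c⟩

lemma Smooth2.add (hF : Smooth2 U F) (hG : Smooth2 U G) :
    Smooth2 U (fun x ξ => F x ξ + G x ξ) := ContDiffOn.add hF hG

lemma Smooth2.mul (hF : Smooth2 U F) (hG : Smooth2 U G) :
    Smooth2 U (fun x ξ => F x ξ * G x ξ) := ContDiffOn.mul hF hG

lemma WBdd.add (hF : WBdd U w F) (hG : WBdd U w G) :
    WBdd U w (fun x ξ => F x ξ + G x ξ) := by
  obtain ⟨C, hC, hF⟩ := hF
  obtain ⟨D, hD, hG⟩ := hG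
  refine ⟨C + D, add_nonneg hC hD, fun x ξ hx => (norm_add_le _ _).trans ?_⟩
  rw [add_mul]; exact add_le_add (hF x ξ hx) (hG x ξ hx)

lemma WBdd.mul (hF : WBdd U w₁ F) (hG : WBdd U w₂ G) :
    WBdd U (fun x ξ => w₁ x ξ * w₂ x ξ) (fun x ξ => F x ξ * G x ξ) := by
  obtain ⟨C, hC, hF⟩ := hF
  obtain ⟨D, hD, hG⟩ := hG
  refine ⟨C * D, mul_nonneg hC hD, fun x ξ hx => (norm_mul_le _ _).trans ?_⟩
  have h := mul_le_mul (hF x ξ hx) (hG x ξ hx) (norm_nonneg _) ((norm_nonneg _).trans (hF x ξ hx))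
  exact h.trans (le_of_eq (by ring))

lemma SymN.add (hU : IsOpen U) (sF : Smooth2 U F) (sG : Smooth2 U G)
    (hF : SymN U n w F) (hG : SymN U n w G) : SymN U n w (fun x ξ => F x ξ + G x ξ) := by
  induction n generalizing w F G with
  | zero => exact WBdd.add hF hG
  | succ n ih =>
    refine ⟨hF.1.add hG.1, ?_, ?_⟩
    · refine (ih (sF.pdx hU) (sG.pdx hU) hF.2.1 hG.2.1).congr hU fun x ξ hx => ?_
      exact ((sF.hasDerivAt_left hU hx).add (sG.hasDerivAt_left hU hx)).deriv.symm
    · refine (ih (sF.pdxi hU) (sG.pdxi hU) hF.2.2 hG.2.2).congr hU fun x ξ hx => ?_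
      exact ((sF.hasDerivAt_right hU hx).add (sG.hasDerivAt_right hU hx)).deriv.symm

lemma SymN.mul (hU : IsOpen U) (sF : Smooth2 U F) (sG : Smooth2 U G)
    (hF : SymN U n w₁ F) (hG : SymN U n w₂ G) :
    SymN U n (fun x ξ => w₁ x ξ * w₂ x ξ) (fun x ξ => F x ξ * G x ξ) := by
  induction n generalizing w₁ w₂ F G with
  | zero => exact WBdd.mul hF hG
  | succ n ih =>
    refine ⟨hF.1.mul hG.1, ?_, ?_⟩
    · have h1 := (ih (sF.pdx hU) sG hF.2.1 hG.pred).weight_eq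
        (w' := fun x ξ => w₁ x ξ * w₂ x ξ / jap x) fun x ξ _ => by ring
      have h2 := (ih sF (sG.pdx hU) hF.pred hG.2.1).weight_eq
        (w' := fun x ξ => w₁ x ξ * w₂ x ξ / jap x) fun x ξ _ => by ring
      refine (h1.add hU ((sF.pdx hU).mul sG) (sF.mul (sG.pdx hU)) h2).congr hU fun x ξ hx => ?_
      exact ((sF.hasDerivAt_left hU hx).mul (sG.hasDerivAt_left hU hx)).deriv.symm
    · have h1 := (ih (sF.pdxi hU) sG hF.2.2 hG.pred).weight_eq
        (w' := fun x ξ => w₁ x ξ * w₂ x ξ / |ξ|) fun x ξ _ => by ring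
      have h2 := (ih sF (sG.pdxi hU) hF.pred hG.2.2).weight_eq
        (w' := fun x ξ => w₁ x ξ * w₂ x ξ / |ξ|) fun x ξ _ => by ring
      refine (h1.add hU ((sF.pdxi hU).mul sG) (sF.mul (sG.pdxi hU)) h2).congr hU fun x ξ hx => ?_
      exact ((sF.hasDerivAt_right hU hx).mul (sG.hasDerivAt_right hU hx)).deriv.symm

lemma SymN.const_mul (hU : IsOpen U) (c : ℂ) (sF : Smooth2 U F) (hF : SymN U n w F) :
    SymN U n w (fun x ξ => c * F x ξ) :=
  ((SymN.const c).mul hU (Smooth2.const c) sF hF).weight_eq fun _ _ _ => one_mul _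

lemma Symb.add (hU : IsOpen U) (hF : Symb U w F) (hG : Symb U w G) :
    Symb U w (fun x ξ => F x ξ + G x ξ) :=
  ⟨hF.1.add hG.1, fun n => (hF.2 n).add hU hF.1 hG.1 (hG.2 n)⟩

lemma Symb.mul (hU : IsOpen U) (hF : Symb U w₁ F) (hG : Symb U w₂ G) :
    Symb U (fun x ξ => w₁ x ξ * w₂ x ξ) (fun x ξ => F x ξ * G x ξ) :=
  ⟨hF.1.mul hG.1, fun n => (hF.2 n).mul hU hF.1 hG.1 (hG.2 n)⟩

lemma Symb.const_mul (hU : IsOpen U) (c : ℂ) (hF : Symb U w F) :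
    Symb U w (fun x ξ => c * F x ξ) :=
  ⟨(Smooth2.const c).mul hF.1, fun n => (hF.2 n).const_mul hU c hF.1⟩

lemma Symb.congr (hU : IsOpen U) (hF : Symb U w F)
    (h : ∀ x ξ, (x, ξ) ∈ U → F x ξ = G x ξ) : Symb U w G :=
  ⟨hF.1.congr h, fun n => (hF.2 n).congr hU h⟩

lemma Symb.neg (hU : IsOpen U) (hF : Symb U w F) : Symb U w (fun x ξ => - F x ξ) :=
  (hF.const_mul hU (-1)).congr hU fun x ξ _ => by ring

lemma Symb.sub (hU : IsOpen U) (hF : Symb U w F) (hG : Symb U w G) :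
    Symb U w (fun x ξ => F x ξ - G x ξ) :=
  (hF.add hU (hG.neg hU)).congr hU fun x ξ _ => by ring

lemma Symb.mono {K : ℝ} (h : Symb U w F) (hK : 0 ≤ K)
    (hw : ∀ x ξ, (x, ξ) ∈ U → w x ξ ≤ K * w' x ξ) : Symb U w' F :=
  ⟨h.1, fun n => (h.2 n).mono hK hw⟩

lemma Symb.mono_le (h : Symb U w F)
    (hw : ∀ x ξ, (x, ξ) ∈ U → w x ξ ≤ w' x ξ) : Symb U w' F :=
  h.mono zero_le_one fun x ξ hx => by rw [one_mul]; exact hw x ξ hx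

lemma Symb.weight_eq (h : Symb U w F)
    (hw : ∀ x ξ, (x, ξ) ∈ U → w x ξ = w' x ξ) : Symb U w' F :=
  ⟨h.1, fun n => (h.2 n).weight_eq hw⟩

lemma Symb.restrict {V : Set (ℝ × ℝ)} (h : Symb U w F) (hV : V ⊆ U) : Symb V w F :=
  ⟨h.1.restrict hV, fun n => (h.2 n).restrict hV⟩

lemma Symb.pdx (hU : IsOpen U) (h : Symb U w F) : Symb U (fun x ξ => w x ξ / jap x) (PDX F) :=
  ⟨h.1.pdx hU, fun n => (h.2 (n + 1)).2.1⟩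

lemma Symb.pdxi (hU : IsOpen U) (h : Symb U w F) : Symb U (fun x ξ => w x ξ / |ξ|) (PDXI F) :=
  ⟨h.1.pdxi hU, fun n => (h.2 (n + 1)).2.2⟩

lemma Symb.of_derivs (hs : Smooth2 U F) (hb : WBdd U w F)
    (hx : ∀ n, SymN U n (fun x ξ => w x ξ / jap x) (PDX F))
    (hξ : ∀ n, SymN U n (fun x ξ => w x ξ / |ξ|) (PDXI F)) : Symb U w F := by
  refine ⟨hs, fun n => ?_⟩
  cases n with
  | zero => exact hb
  | succ n => exact ⟨hb, hx n, hξ n⟩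

lemma SymN.union {V₁ V₂ : Set (ℝ × ℝ)} (h₁ : SymN V₁ n w F) (h₂ : SymN V₂ n w F)
    (hU : ∀ p ∈ U, p ∈ V₁ ∨ p ∈ V₂) (hw : ∀ x ξ, (x, ξ) ∈ U → 0 ≤ w x ξ) : SymN U n w F := by
  have hb : ∀ {w F}, WBdd V₁ w F → WBdd V₂ w F → (∀ x ξ, (x, ξ) ∈ U → 0 ≤ w x ξ) →
      WBdd U w F := by
    rintro w F ⟨C, hC, hF⟩ ⟨D, hD, hG⟩ hw
    refine ⟨C + D, add_nonneg hC hD, fun x ξ hx => ?_⟩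
    rw [add_mul]
    rcases hU _ hx with h | h
    · exact (hF x ξ h).trans (le_add_of_nonneg_right (mul_nonneg hD (hw x ξ hx)))
    · exact (hG x ξ h).trans (le_add_of_nonneg_left (mul_nonneg hC (hw x ξ hx)))
  induction n generalizing w F with
  | zero => exact hb h₁ h₂ hw
  | succ n ih =>
    exact ⟨hb h₁.1 h₂.1 hw, ih h₁.2.1 h₂.2.1 fun x ξ hx => div_nonneg (hw x ξ hx) (jap_pos x).le,
      ih h₁.2.2 h₂.2.2 fun x ξ hx => div_nonneg (hw x ξ hx) (abs_nonneg ξ)⟩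

lemma Symb.union {V₁ V₂ : Set (ℝ × ℝ)} (o₁ : IsOpen V₁) (o₂ : IsOpen V₂) (h₁ : Symb V₁ w F)
    (h₂ : Symb V₂ w F) (hU : ∀ p ∈ U, p ∈ V₁ ∨ p ∈ V₂)
    (hw : ∀ x ξ, (x, ξ) ∈ U → 0 ≤ w x ξ) : Symb U w F := by
  refine ⟨fun p hp => ?_, fun n => (h₁.2 n).union (h₂.2 n) hU hw⟩
  rcases hU p hp with h | h
  · exact ((h₁.1 p h).contDiffAt (o₁.mem_nhds h)).contDiffWithinAt
  · exact ((h₂.1 p h).contDiffAt (o₂.mem_nhds h)).contDiffWithinAt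

lemma Symb.conj (hU : IsOpen U) (hF : Symb U w F) :
    Symb U w (fun x ξ => (starRingEnd ℂ) (F x ξ)) := by
  have hs : ∀ {F : ℝ → ℝ → ℂ}, Smooth2 U F → Smooth2 U (fun x ξ => (starRingEnd ℂ) (F x ξ)) :=
    fun hF => Complex.conjCLE.contDiff.comp_contDiffOn hF
  refine ⟨hs hF.1, fun n => ?_⟩
  have hb : ∀ {w} {F : ℝ → ℝ → ℂ}, WBdd U w F → WBdd U w (fun x ξ => (starRingEnd ℂ) (F x ξ)) := by
    rintro w F ⟨C, hC, h⟩
    exact ⟨C, hC, fun x ξ hx => by rw [RCLike.norm_conj]; exact h x ξ hx⟩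
  have key := hF.2 n
  have sF := hF.1
  clear hF
  induction n generalizing w F with
  | zero => exact hb key
  | succ n ih =>
    refine ⟨hb key.1, (ih key.2.1 (sF.pdx hU)).congr hU fun x ξ hx => ?_,
      (ih key.2.2 (sF.pdxi hU)).congr hU fun x ξ hx => ?_⟩
    · exact (Complex.conjCLE.hasFDerivAt.comp_hasDerivAt x (sF.hasDerivAt_left hU hx)).deriv.symm
    · exact (Complex.conjCLE.hasFDerivAt.comp_hasDerivAt ξ (sF.hasDerivAt_right hU hx)).deriv.symm

lemma Smooth2.inv (hF : Smooth2 U F) (h0 : ∀ x ξ, (x, ξ) ∈ U → F x ξ ≠ 0) :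
    Smooth2 U (fun x ξ => (F x ξ)⁻¹) :=
  ContDiffOn.inv hF fun p hp => h0 p.1 p.2 hp

lemma Symb.inv (hU : IsOpen U) (hF : Symb U w F) {c : ℝ} (hc : 0 < c)
    (hw : ∀ x ξ, (x, ξ) ∈ U → 0 < w x ξ) (h : ∀ x ξ, (x, ξ) ∈ U → c * w x ξ ≤ ‖F x ξ‖) :
    Symb U (fun x ξ => (w x ξ)⁻¹) (fun x ξ => (F x ξ)⁻¹) := by
  have h0 : ∀ x ξ, (x, ξ) ∈ U → F x ξ ≠ 0 := fun x ξ hx =>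
    norm_pos_iff.1 ((mul_pos hc (hw x ξ hx)).trans_le (h x ξ hx))
  have sI := hF.1.inv h0
  have hb : WBdd U (fun x ξ => (w x ξ)⁻¹) (fun x ξ => (F x ξ)⁻¹) := by
    refine ⟨c⁻¹, by positivity, fun x ξ hx => ?_⟩
    rw [norm_inv, ← mul_inv]
    exact inv_anti₀ (mul_pos hc (hw x ξ hx)) (h x ξ hx)
  refine ⟨sI, fun n => ?_⟩
  induction n with
  | zero => exact hb
  | succ n ih =>
    have s2 := sI.mul sI
    have i2 := ih.mul hU sI sI ih
    have alg : ∀ a b : ℝ, b ≠ 0 → b / a * (b⁻¹ * b⁻¹) = b⁻¹ / a := fun a b hb => by field_simp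
    refine ⟨hb, ?_, ?_⟩
    · have h1 := ((((hF.pdx hU).2 n).mul hU (hF.1.pdx hU) s2 i2).const_mul hU (-1)
        ((hF.1.pdx hU).mul s2))
      refine (h1.congr hU fun x ξ hx => ?_).weight_eq fun x ξ hx => alg _ _ (hw x ξ hx).ne'
      refine Eq.symm (((hF.1.hasDerivAt_left hU hx).inv (h0 x ξ hx)).deriv.trans ?_)
      have := h0 x ξ hx
      field_simp
    · have h1 := ((((hF.pdxi hU).2 n).mul hU (hF.1.pdxi hU) s2 i2).const_mul hU (-1)
        ((hF.1.pdxi hU).mul s2))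
      refine (h1.congr hU fun x ξ hx => ?_).weight_eq fun x ξ hx => alg _ _ (hw x ξ hx).ne'
      refine Eq.symm (((hF.1.hasDerivAt_right hU hx).inv (h0 x ξ hx)).deriv.trans ?_)
      have := h0 x ξ hx
      field_simp

lemma Symb.comp (hU : IsOpen U) {g : ℝ → ℝ → ℝ} (hg : Symb U (fun _ _ => 1) (fun x ξ => (g x ξ : ℂ)))
    {φ : ℝ → ℂ} (hφ : ContDiff ℝ (⊤ : ℕ∞) φ) :
    Symb U (fun _ _ => 1) (fun x ξ => φ (g x ξ)) := by
  have hgr : ContDiffOn ℝ (⊤ : ℕ∞) (fun p : ℝ × ℝ => g p.1 p.2) U := by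
    have := Complex.reCLM.contDiff.comp_contDiffOn hg.1
    exact this.congr fun p hp => by simp
  have hs : ∀ {φ : ℝ → ℂ}, ContDiff ℝ (⊤ : ℕ∞) φ → Smooth2 U (fun x ξ => φ (g x ξ)) :=
    fun hφ => hφ.comp_contDiffOn hgr
  obtain ⟨R, hR, hgb⟩ := (hg.2 0).bdd
  have hb : ∀ {φ : ℝ → ℂ}, ContDiff ℝ (⊤ : ℕ∞) φ →
      WBdd U (fun _ _ => 1) (fun x ξ => φ (g x ξ)) := by
    intro φ hφ
    obtain ⟨C, hC⟩ := (isCompact_Icc (a := -R) (b := R)).exists_bound_of_continuousOn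
      hφ.continuous.continuousOn
    refine ⟨max C 0, le_max_right _ _, fun x ξ hx => ?_⟩
    rw [mul_one]
    refine (hC _ ?_).trans (le_max_left _ _)
    have := hgb x ξ hx
    rw [Complex.norm_real, Real.norm_eq_abs, mul_one] at this
    exact abs_le.1 this
  refine ⟨hs hφ, fun n => ?_⟩
  induction n generalizing φ with
  | zero => exact hb hφ
  | succ n ih =>
    have hφ' : ContDiff ℝ (⊤ : ℕ∞) (deriv φ) := (contDiff_infty_iff_deriv.1 hφ).2
    have hd : ∀ t, HasDerivAt φ (deriv φ t) t :=
      fun t => ((contDiff_infty_iff_deriv.1 hφ).1 t).hasDerivAt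
    refine ⟨hb hφ, ?_, ?_⟩
    · refine (((ih hφ').mul hU (hs hφ') (hg.1.pdx hU) ((hg.pdx hU).2 n)).congr hU
        fun x ξ hx => ?_).weight_eq fun x ξ hx => by simp
      have h1 : HasDerivAt (fun y => g y ξ) (PDX (fun x ξ => (g x ξ : ℂ)) x ξ).re x := by
        exact Complex.reCLM.hasFDerivAt.comp_hasDerivAt x (hg.1.hasDerivAt_left hU hx)
      have h2 : PDX (fun x ξ => (g x ξ : ℂ)) x ξ = ((PDX (fun x ξ => (g x ξ : ℂ)) x ξ).re : ℂ) :=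
        h1.ofReal_comp.deriv
      rw [h2, mul_comm]
      exact ((hd _).scomp x h1).deriv.symm
    · refine (((ih hφ').mul hU (hs hφ') (hg.1.pdxi hU) ((hg.pdxi hU).2 n)).congr hU
        fun x ξ hx => ?_).weight_eq fun x ξ hx => by simp
      have h1 : HasDerivAt (fun y => g x y) (PDXI (fun x ξ => (g x ξ : ℂ)) x ξ).re ξ := by
        exact Complex.reCLM.hasFDerivAt.comp_hasDerivAt ξ (hg.1.hasDerivAt_right hU hx)
      have h2 : PDXI (fun x ξ => (g x ξ : ℂ)) x ξ = ((PDXI (fun x ξ => (g x ξ : ℂ)) x ξ).re : ℂ) :=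
        h1.ofReal_comp.deriv
      rw [h2, mul_comm]
      exact ((hd _).scomp ξ h1).deriv.symm

lemma SymN.reflect (σ τ : ℝ) (hσ : σ = 1 ∨ σ = -1) (hτ : τ = 1 ∨ τ = -1) (hF : SymN U n w F) :
    SymN {p | (σ * p.1, τ * p.2) ∈ U} n (fun x ξ => w (σ * x) (τ * ξ))
      (fun x ξ => F (σ * x) (τ * ξ)) := by
  have hb : ∀ {w} {F : ℝ → ℝ → ℂ} (c : ℂ), WBdd U w F →
      WBdd {p | (σ * p.1, τ * p.2) ∈ U} (fun x ξ => w (σ * x) (τ * ξ))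
      (fun x ξ => c * F (σ * x) (τ * ξ)) := by
    rintro w F c ⟨C, hC, h⟩
    refine ⟨‖c‖ * C, by positivity, fun x ξ hx => ?_⟩
    rw [norm_mul, mul_assoc]
    exact mul_le_mul_of_nonneg_left (h _ _ hx) (norm_nonneg c)
  suffices H : ∀ c : ℂ, SymN {p | (σ * p.1, τ * p.2) ∈ U} n (fun x ξ => w (σ * x) (τ * ξ))
      (fun x ξ => c * F (σ * x) (τ * ξ)) by simpa using H 1
  induction n generalizing w F with
  | zero => exact fun c => hb c hF
  | succ n ih =>
    intro c
    refine ⟨hb c hF.1, ?_, ?_⟩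
    · have e : PDX (fun x ξ => c * F (σ * x) (τ * ξ)) =
          fun x ξ => (c * σ) * PDX F (σ * x) (τ * ξ) := by
        funext x ξ
        simp only [PDX]
        rw [deriv_const_mul_field]
        rw [deriv_comp_mul_left σ (fun y => F y (τ * ξ)) x]
        simp [mul_assoc]
      rw [e]
      refine (ih hF.2.1 (c * σ)).weight_eq fun x ξ _ => ?_
      rcases hσ with rfl | rfl <;> simp [jap]
    · have e : PDXI (fun x ξ => c * F (σ * x) (τ * ξ)) =
          fun x ξ => (c * τ) * PDXI F (σ * x) (τ * ξ) := by
        funext x ξ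
        simp only [PDXI]
        rw [deriv_const_mul_field]
        rw [deriv_comp_mul_left τ (fun y => F (σ * x) y) ξ]
        simp [mul_assoc]
      rw [e]
      refine (ih hF.2.2 (c * τ)).weight_eq fun x ξ _ => ?_
      rcases hτ with rfl | rfl <;> simp

lemma Symb.reflect (σ τ : ℝ) (hσ : σ = 1 ∨ σ = -1) (hτ : τ = 1 ∨ τ = -1) (hF : Symb U w F) :
    Symb {p | (σ * p.1, τ * p.2) ∈ U} (fun x ξ => w (σ * x) (τ * ξ))
      (fun x ξ => F (σ * x) (τ * ξ)) := by
  refine ⟨?_, fun n => (hF.2 n).reflect σ τ hσ hτ⟩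
  have h1 : ContDiff ℝ (⊤ : ℕ∞) (fun p : ℝ × ℝ => (σ * p.1, τ * p.2)) := by fun_prop
  exact ContDiffOn.comp (g := fun p : ℝ × ℝ => F p.1 p.2) hF.1 h1.contDiffOn fun p hp => hp

lemma Symb.reflect_left (hF : Symb U w F) :
    Symb {p | (-p.1, p.2) ∈ U} (fun x ξ => w (-x) ξ) (fun x ξ => F (-x) ξ) := by
  simpa using hF.reflect (-1) 1 (by simp) (by simp)

lemma SymN.at_zero {I : Set ℝ} (hI : ∀ ξ ∈ I, ((0 : ℝ), ξ) ∈ U) (hF : SymN U n w F) :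
    SymN {p | p.2 ∈ I} n (fun _ ξ => w 0 ξ) (fun _ ξ => F 0 ξ) := by
  have hb : ∀ {w} {F : ℝ → ℝ → ℂ}, WBdd U w F →
      WBdd {p | p.2 ∈ I} (fun _ ξ => w 0 ξ) (fun _ ξ => F 0 ξ) := by
    rintro w F ⟨C, hC, h⟩
    exact ⟨C, hC, fun x ξ hx => h 0 ξ (hI ξ hx)⟩
  induction n generalizing w F with
  | zero => exact hb hF
  | succ n ih =>
    refine ⟨hb hF.1, ?_, ih hF.2.2⟩
    have : PDX (fun _ ξ => F 0 ξ) = fun _ _ => 0 := by funext x ξ; simp [PDX]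
    rw [this]; exact SymN.zero

lemma Symb.at_zero {I : Set ℝ} (hI : ∀ ξ ∈ I, ((0 : ℝ), ξ) ∈ U) (hF : Symb U w F) :
    Symb {p | p.2 ∈ I} (fun _ ξ => w 0 ξ) (fun _ ξ => F 0 ξ) := by
  refine ⟨?_, fun n => (hF.2 n).at_zero hI⟩
  have h1 : ContDiff ℝ (⊤ : ℕ∞) (fun p : ℝ × ℝ => ((0 : ℝ), p.2)) := by fun_prop
  exact ContDiffOn.comp (g := fun p : ℝ × ℝ => F p.1 p.2) hF.1 h1.contDiffOn
    fun p hp => hI _ hp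

lemma SymN.lift {I : Set ℝ} {v : ℝ → ℝ} {φ : ℝ → ℂ} (hI : ∀ ξ ∈ I, ∃ x, (x, ξ) ∈ U)
    (hF : SymN U n (fun _ ξ => v ξ) (fun _ ξ => φ ξ)) :
    SymN {p | p.2 ∈ I} n (fun _ ξ => v ξ) (fun _ ξ => φ ξ) := by
  have hb : ∀ {v : ℝ → ℝ} {φ : ℝ → ℂ}, WBdd U (fun _ ξ => v ξ) (fun _ ξ => φ ξ) →
      WBdd {p | p.2 ∈ I} (fun _ ξ => v ξ) (fun _ ξ => φ ξ) := by
    rintro w F ⟨C, hC, h⟩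
    refine ⟨C, hC, fun x ξ hx => ?_⟩
    obtain ⟨y, hy⟩ := hI ξ hx
    exact h y ξ hy
  induction n generalizing v φ with
  | zero => exact hb hF
  | succ n ih =>
    refine ⟨hb hF.1, ?_, ih (v := fun ξ => v ξ / |ξ|) (φ := fun ξ => deriv φ ξ) hF.2.2⟩
    have : PDX (fun _ ξ => φ ξ) = fun _ _ => 0 := by funext x ξ; simp [PDX]
    rw [this]; exact SymN.zero

end algebra

section base
variable {U : Set (ℝ × ℝ)} {w : ℝ → ℝ → ℝ} {F : ℝ → ℝ → ℂ}

lemma Symb.zero : Symb U w (fun _ _ => 0) := ⟨Smooth2.const 0, fun _ => SymN.zero⟩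

lemma symb_left : Symb U (fun x _ => jap x) (fun x _ => (x : ℂ)) := by
  have hs : Smooth2 U (fun x _ => (x : ℂ)) :=
    (Complex.ofRealCLM.contDiff.comp contDiff_fst).contDiffOn
  refine Symb.of_derivs hs ⟨1, zero_le_one, fun x ξ _ => ?_⟩ (fun n => ?_) (fun n => ?_)
  · rw [Complex.norm_real, one_mul]; exact abs_le_jap x
  · have : PDX (fun x _ => (x : ℂ)) = fun _ _ => 1 := by
      funext x ξ; exact (Complex.ofRealCLM.hasDerivAt (x := x)).deriv.trans (by simp)
    rw [this]
    exact (SymN.const 1).weight_eq fun x ξ _ => (div_self (jap_pos x).ne').symm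
  · have : PDXI (fun x _ => (x : ℂ)) = fun _ _ => 0 := by funext x ξ; simp [PDXI]
    rw [this]; exact SymN.zero

lemma symb_right (h0 : ∀ p ∈ U, p.2 ≠ 0) : Symb U (fun _ ξ => |ξ|) (fun _ ξ => (ξ : ℂ)) := by
  have hs : Smooth2 U (fun _ ξ => (ξ : ℂ)) :=
    (Complex.ofRealCLM.contDiff.comp contDiff_snd).contDiffOn
  refine Symb.of_derivs hs ⟨1, zero_le_one, fun x ξ _ => ?_⟩ (fun n => ?_) (fun n => ?_)
  · rw [Complex.norm_real, one_mul, Real.norm_eq_abs]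
  · have : PDX (fun _ ξ => (ξ : ℂ)) = fun _ _ => 0 := by funext x ξ; simp [PDX]
    rw [this]; exact SymN.zero
  · have : PDXI (fun _ ξ => (ξ : ℂ)) = fun _ _ => 1 := by
      funext x ξ; exact (Complex.ofRealCLM.hasDerivAt (x := ξ)).deriv.trans (by simp)
    rw [this]
    exact (SymN.const 1).weight_eq fun x ξ hx => (div_self (abs_pos.2 (h0 _ hx)).ne').symm

lemma symb_one_add_sq (hU : IsOpen U) :
    Symb U (fun x _ => jap x ^ 2) (fun x _ => ((1 + x ^ 2 : ℝ) : ℂ)) := by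
  have h1 : Symb U (fun x _ => jap x ^ 2) (fun _ _ => 1) :=
    (Symb.const 1).mono_le fun x ξ _ => one_le_pow₀ (one_le_jap x)
  have h2 := (symb_left.mul hU (symb_left (U := U))).weight_eq
    (w' := fun x _ => jap x ^ 2) fun x ξ _ => (sq _).symm
  exact (h1.add hU h2).congr hU fun x ξ _ => by push_cast; ring

lemma symb_inv_one_add_sq (hU : IsOpen U) :
    Symb U (fun x _ => (jap x ^ 2)⁻¹) (fun x _ => ((1 + x ^ 2 : ℝ) : ℂ)⁻¹) := by
  refine (symb_one_add_sq hU).inv hU one_pos (fun x _ _ => pow_pos (jap_pos x) 2) fun x ξ _ => ?_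
  rw [Complex.norm_real, Real.norm_of_nonneg (by positivity), one_mul, jap_sq]

lemma hasDerivAt_jap (x : ℝ) : HasDerivAt jap (x * jap x * (1 + x ^ 2)⁻¹) x := by
  have h1 : HasDerivAt (fun x : ℝ => 1 + x ^ 2) (2 * x) x := by
    simpa using (hasDerivAt_pow 2 x).const_add 1
  have h2 := h1.sqrt (by positivity)
  refine HasDerivAt.congr_deriv (f := jap) h2 ?_
  have e : Real.sqrt (1 + x ^ 2) = jap x := rfl
  rw [e, ← jap_sq]
  have := (jap_pos x).ne'
  field_simp

lemma contDiff_jap : ContDiff ℝ (⊤ : ℕ∞) jap :=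
  ContDiff.sqrt (by fun_prop) fun x => by positivity

lemma symb_jap (hU : IsOpen U) : Symb U (fun x _ => jap x) (fun x _ => (jap x : ℂ)) := by
  have hs : Smooth2 U (fun x _ => (jap x : ℂ)) :=
    (Complex.ofRealCLM.contDiff.comp (contDiff_jap.comp contDiff_fst)).contDiffOn
  have hb : WBdd U (fun x _ => jap x) (fun x _ => (jap x : ℂ)) :=
    ⟨1, zero_le_one, fun x ξ _ => by
      rw [Complex.norm_real, one_mul, Real.norm_of_nonneg (jap_pos x).le]⟩
  refine ⟨hs, fun n => ?_⟩
  induction n with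
  | zero => exact hb
  | succ n ih =>
    refine ⟨hb, ?_, ?_⟩
    · have : PDX (fun x _ => (jap x : ℂ)) =
          fun (x : ℝ) (_ : ℝ) => (x : ℂ) * (jap x : ℂ) * ((1 + x ^ 2 : ℝ) : ℂ)⁻¹ := by
        funext x ξ
        refine (hasDerivAt_jap x).ofReal_comp.deriv.trans ?_
        push_cast; ring
      rw [this]
      have h1 := ((symb_left (U := U)).2 n).mul hU symb_left.1 hs ih
      have h2 := h1.mul hU (symb_left.1.mul hs) (symb_inv_one_add_sq hU).1
        ((symb_inv_one_add_sq hU).2 n)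
      refine h2.weight_eq fun x ξ _ => ?_
      have := (jap_pos x).ne'
      field_simp
    · have : PDXI (fun x _ => (jap x : ℂ)) = fun _ _ => 0 := by funext x ξ; simp [PDXI]
      rw [this]; exact SymN.zero

lemma symb_inv_one_add_sq_right (hU : IsOpen U) (h0 : ∀ p ∈ U, p.2 ≠ 0) :
    Symb U (fun _ ξ => (jap ξ ^ 2)⁻¹) (fun _ ξ => ((1 + ξ ^ 2 : ℝ) : ℂ)⁻¹) := by
  have h1 : Symb U (fun _ ξ => jap ξ ^ 2) (fun _ _ => 1) :=
    (Symb.const 1).mono_le fun _ ξ _ => one_le_pow₀ (one_le_jap ξ)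
  have h2 := ((symb_right h0).mul hU (symb_right h0)).mono_le
    (w' := fun _ ξ => jap ξ ^ 2) fun x ξ _ => by rw [jap_sq, abs_mul_abs_self]; nlinarith
  have h3 := (h1.add hU h2).congr (G := fun _ ξ => ((1 + ξ ^ 2 : ℝ) : ℂ)) hU
    fun x ξ _ => by push_cast; ring
  refine h3.inv hU one_pos (fun _ ξ _ => pow_pos (jap_pos ξ) 2) fun x ξ _ => ?_
  rw [Complex.norm_real, Real.norm_of_nonneg (by positivity), one_mul, jap_sq]

lemma symb_jap_right (hU : IsOpen U) (h0 : ∀ p ∈ U, p.2 ≠ 0) :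
    Symb U (fun _ ξ => jap ξ) (fun _ ξ => (jap ξ : ℂ)) := by
  have hs : Smooth2 U (fun _ ξ => (jap ξ : ℂ)) :=
    (Complex.ofRealCLM.contDiff.comp (contDiff_jap.comp contDiff_snd)).contDiffOn
  have hb : WBdd U (fun _ ξ => jap ξ) (fun _ ξ => (jap ξ : ℂ)) :=
    ⟨1, zero_le_one, fun x ξ _ => by
      rw [Complex.norm_real, one_mul, Real.norm_of_nonneg (jap_pos ξ).le]⟩
  have hi := symb_inv_one_add_sq_right hU h0
  refine ⟨hs, fun n => ?_⟩
  induction n with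
  | zero => exact hb
  | succ n ih =>
    refine ⟨hb, ?_, ?_⟩
    · have : PDX (fun _ ξ => (jap ξ : ℂ)) = fun _ _ => 0 := by funext x ξ; simp [PDX]
      rw [this]; exact SymN.zero
    · have : PDXI (fun _ ξ => (jap ξ : ℂ)) =
          fun (_ : ℝ) (ξ : ℝ) => (ξ : ℂ) * (jap ξ : ℂ) * ((1 + ξ ^ 2 : ℝ) : ℂ)⁻¹ := by
        funext x ξ
        refine (hasDerivAt_jap ξ).ofReal_comp.deriv.trans ?_
        push_cast; ring
      rw [this]
      have h1 := ((symb_right h0).2 n).mul hU (symb_right h0).1 hs ih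
      have h2 := h1.mul hU ((symb_right h0).1.mul hs) hi.1 (hi.2 n)
      refine h2.mono zero_le_one fun x ξ hx => ?_
      have h3 := jap_pos ξ
      have h4 := abs_pos.2 (h0 _ hx)
      have h5 := abs_le_jap ξ
      rw [one_mul, le_div_iff₀ h4]
      have : |ξ| * jap ξ * (jap ξ ^ 2)⁻¹ * |ξ| = |ξ| * |ξ| / jap ξ := by field_simp
      rw [this, div_le_iff₀ h3]
      exact mul_le_mul h5 h5 h4.le h3.le

/-- The bounded frequency `ξ / ⟨ξ⟩`. -/
def lam (ξ : ℝ) : ℝ := ξ / jap ξ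

lemma contDiff_lam : ContDiff ℝ (⊤ : ℕ∞) lam :=
  contDiff_id.div contDiff_jap fun x => (jap_pos x).ne'

lemma symb_lam (hU : IsOpen U) (h0 : ∀ p ∈ U, p.2 ≠ 0) :
    Symb U (fun _ ξ => |ξ| / jap ξ) (fun _ ξ => (lam ξ : ℂ)) := by
  have h1 := (symb_jap_right hU h0).inv hU one_pos (fun _ ξ _ => jap_pos ξ) fun x ξ _ => by
    rw [Complex.norm_real, Real.norm_of_nonneg (jap_pos ξ).le, one_mul]
  exact (((symb_right h0).mul hU h1).weight_eq fun _ _ _ => (div_eq_mul_inv _ _).symm).congr hU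
    fun x ξ _ => by simp [lam, div_eq_mul_inv]

lemma Symb.dx (hU : IsOpen U) (h : Symb U w F) : Symb U w (DX F) :=
  ((symb_jap hU).mul hU (h.pdx hU)).weight_eq fun x _ _ => mul_div_cancel₀ _ (jap_pos x).ne'

lemma Symb.dxi (hU : IsOpen U) (h0 : ∀ p ∈ U, p.2 ≠ 0) (h : Symb U w F) : Symb U w (DXI F) :=
  ((symb_right h0).mul hU (h.pdxi hU)).weight_eq fun _ _ hx =>
    mul_div_cancel₀ _ (abs_pos.2 (h0 _ hx)).ne'

lemma Symb.iterate (hU : IsOpen U) (h0 : ∀ p ∈ U, p.2 ≠ 0) (h : Symb U w F) (k l : ℕ) :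
    Symb U w (DX^[k] (DXI^[l] F)) := by
  induction k with
  | zero =>
    induction l with
    | zero => exact h
    | succ l ih =>
      simp only [Function.iterate_zero, id_eq] at ih
      simp only [Function.iterate_zero, id_eq, Function.iterate_succ_apply']
      exact ih.dxi hU h0
  | succ k ih => rw [Function.iterate_succ_apply']; exact ih.dx hU

end base

/-- Bounded continuous complex functions on the line, used as even functions of `t`. -/
abbrev BA := BoundedContinuousFunction ℝ ℂ

/-- The Volterra kernel `(e^{2is} - 1) / (2i)`. -/
def Dker (s : ℝ) : ℂ := (Complex.exp (2 * Complex.I * s) - 1) / (2 * Complex.I)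

lemma norm_Dker_le (s : ℝ) : ‖Dker s‖ ≤ 1 := by
  unfold Dker
  rw [norm_div]
  have h1 : ‖Complex.exp (2 * Complex.I * s)‖ = 1 := by
    rw [show 2 * Complex.I * (s : ℂ) = ((2 * s : ℝ) : ℂ) * Complex.I by push_cast; ring]
    exact Complex.norm_exp_ofReal_mul_I _
  have h2 : ‖Complex.exp (2 * Complex.I * s) - 1‖ ≤ 2 := by
    refine (norm_sub_le _ _).trans ?_
    rw [h1, norm_one]; norm_num
  have h3 : ‖(2 * Complex.I : ℂ)‖ = 2 := by simp
  rw [h3]; linarith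

lemma hasDerivAt_Dker (s : ℝ) : HasDerivAt Dker (Complex.exp (2 * Complex.I * s)) s := by
  have h1 : HasDerivAt (fun s : ℝ => 2 * Complex.I * (s : ℂ)) (2 * Complex.I) s := by
    simpa using (Complex.ofRealCLM.hasDerivAt (x := s)).const_mul (2 * Complex.I)
  have h2 := (h1.cexp.sub_const 1).div_const (2 * Complex.I)
  refine h2.congr_deriv ?_
  have : (2 * Complex.I : ℂ) ≠ 0 := by simp
  field_simp

lemma continuous_Dker : Continuous Dker :=
  continuous_iff_continuousAt.2 fun s => (hasDerivAt_Dker s).continuousAt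

lemma inv_pow_integral {a : ℝ} (ha : 0 < a) (k : ℕ) :
    IntegrableOn (fun s : ℝ => ((a + s) ^ (k + 2))⁻¹) (Set.Ioi 0) ∧
      ∫ s in Set.Ioi (0 : ℝ), ((a + s) ^ (k + 2))⁻¹ = ((k + 1) * a ^ (k + 1))⁻¹ := by
  have hd : ∀ s ∈ Set.Ici (0 : ℝ), HasDerivAt (fun s : ℝ => -((k + 1 : ℝ) * (a + s) ^ (k + 1))⁻¹)
      (((a + s) ^ (k + 2))⁻¹) s := by
    intro s hs
    have hs' : 0 < a + s := add_pos_of_pos_of_nonneg ha hs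
    have h1 : HasDerivAt (fun s : ℝ => a + s) 1 s := (hasDerivAt_id s).const_add a
    have h2 : HasDerivAt (fun s : ℝ => (a + s) ^ (k + 1)) ((k + 1) * (a + s) ^ k) s := by
      exact (h1.fun_pow (k + 1)).congr_deriv (by simp)
    have h3 := ((h2.const_mul (k + 1 : ℝ)).inv (by positivity)).neg
    refine h3.congr_deriv ?_
    field_simp
    ring
  have hp : ∀ s ∈ Set.Ioi (0 : ℝ), 0 ≤ ((a + s) ^ (k + 2))⁻¹ := fun s hs => by
    have : 0 < a + s := add_pos ha hs
    positivity
  have ht : Tendsto (fun s : ℝ => -((k + 1 : ℝ) * (a + s) ^ (k + 1))⁻¹) atTop (nhds 0) := by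
    have h1 : Tendsto (fun s : ℝ => (k + 1 : ℝ) * (a + s) ^ (k + 1)) atTop atTop :=
      ((tendsto_pow_atTop (Nat.succ_ne_zero k)).comp
        (tendsto_atTop_add_const_left _ a tendsto_id)).const_mul_atTop (by positivity)
    simpa using h1.inv_tendsto_atTop.neg
  refine ⟨integrableOn_Ioi_deriv_of_nonneg' hd hp ht, ?_⟩
  rw [integral_Ioi_of_hasDerivAt_of_nonneg' hd hp ht]
  simp

/-- The integrand of the Volterra operator. -/
def kInt (P : BA) (u s : ℝ) : ℂ := Dker s * ((((1 + |u| + s) ^ 2)⁻¹ : ℝ) : ℂ) * P (|u| + s)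

lemma kInt_continuous_right (P : BA) (u : ℝ) : ContinuousOn (kInt P u) (Set.Ioi 0) := by
  unfold kInt
  have h1 : ContinuousOn (fun s : ℝ => ((1 + |u| + s) ^ 2)⁻¹) (Set.Ioi 0) := by
    refine ContinuousOn.inv₀ (by fun_prop) fun s hs => ?_
    have : 0 < 1 + |u| + s := add_pos_of_nonneg_of_pos (by positivity) hs
    positivity
  have h2 : Continuous (fun s : ℝ => P (|u| + s)) := P.continuous.comp (by fun_prop)
  exact (continuous_Dker.continuousOn.mul (Complex.continuous_ofReal.comp_continuousOn h1)).mul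
    h2.continuousOn

lemma kInt_norm_le (P : BA) (u : ℝ) {s : ℝ} (hs : 0 < s) {k : ℕ} {a p : ℝ}
    (hP : ∀ t, |u| ≤ t → ‖P t‖ ≤ p * (1 + t) ^ 2 * ((a + t) ^ (k + 2))⁻¹) :
    ‖kInt P u s‖ ≤ p * ((a + |u| + s) ^ (k + 2))⁻¹ := by
  unfold kInt
  have h0 : 0 < 1 + |u| + s := add_pos_of_nonneg_of_pos (by positivity) hs
  have h1 := hP (|u| + s) (by linarith)
  have hi : 0 < ((1 + |u| + s) ^ 2)⁻¹ := by positivity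
  rw [norm_mul, norm_mul, Complex.norm_real, Real.norm_of_nonneg hi.le]
  calc ‖Dker s‖ * ((1 + |u| + s) ^ 2)⁻¹ * ‖P (|u| + s)‖
      ≤ 1 * ((1 + |u| + s) ^ 2)⁻¹ * (p * (1 + (|u| + s)) ^ 2 * ((a + (|u| + s)) ^ (k + 2))⁻¹) := by
        have := norm_Dker_le s
        gcongr
    _ = p * ((a + |u| + s) ^ (k + 2))⁻¹ := by
        rw [← add_assoc, ← add_assoc]
        field_simp

lemma kInt_norm_le' (P : BA) (u : ℝ) {s : ℝ} (hs : 0 < s) :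
    ‖kInt P u s‖ ≤ ‖P‖ * ((1 + |u| + s) ^ (0 + 2))⁻¹ := by
  refine kInt_norm_le P u hs fun t ht => (P.norm_coe_le_norm t).trans (le_of_eq ?_)
  have : 0 < 1 + t := by linarith [abs_nonneg u]
  field_simp

lemma kInt_integrable (P : BA) (u : ℝ) : IntegrableOn (kInt P u) (Set.Ioi 0) := by
  have h1 := ((inv_pow_integral (a := 1 + |u|) (by positivity) 0).1).const_mul ‖P‖
  refine h1.mono' ((kInt_continuous_right P u).aestronglyMeasurable measurableSet_Ioi) ?_
  exact (ae_restrict_iff' measurableSet_Ioi).2 (ae_of_all _ fun s hs => kInt_norm_le' P u hs)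

lemma kInt_integral_norm_le (P : BA) (u : ℝ) {k : ℕ} {a p : ℝ} (ha : 0 < a)
    (hP : ∀ t, |u| ≤ t → ‖P t‖ ≤ p * (1 + t) ^ 2 * ((a + t) ^ (k + 2))⁻¹) :
    ‖∫ s in Set.Ioi 0, kInt P u s‖ ≤ p * ((k + 1) * (a + |u|) ^ (k + 1))⁻¹ := by
  have h1 := inv_pow_integral (a := a + |u|) (by positivity) k
  rw [← h1.2, ← integral_const_mul]
  refine norm_integral_le_of_norm_le (h1.1.const_mul p) ?_
  exact (ae_restrict_iff' measurableSet_Ioi).2 (ae_of_all _ fun s hs => kInt_norm_le P u hs hP)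

lemma kInt_integral_continuous (P : BA) :
    Continuous (fun u => ∫ s in Set.Ioi 0, kInt P u s) := by
  have h1 := ((inv_pow_integral (a := 1) one_pos 0).1).const_mul ‖P‖
  refine continuous_of_dominated (bound := fun s => ‖P‖ * ((1 + s) ^ (0 + 2))⁻¹)
    (fun u => (kInt_continuous_right P u).aestronglyMeasurable measurableSet_Ioi)
    (fun u => (ae_restrict_iff' measurableSet_Ioi).2 (ae_of_all _ fun s hs => ?_)) h1
    ((ae_restrict_iff' measurableSet_Ioi).2 (ae_of_all _ fun s hs => ?_))
  · refine (kInt_norm_le' P u hs).trans ?_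
    have hs' : (0 : ℝ) < s := hs
    have := abs_nonneg u
    gcongr
    linarith
  · unfold kInt
    have h2 : Continuous (fun u : ℝ => ((1 + |u| + s) ^ 2)⁻¹) := by
      refine Continuous.inv₀ (by fun_prop) fun u => ?_
      have : 0 < 1 + |u| + s := add_pos_of_nonneg_of_pos (by positivity) hs
      positivity
    exact (continuous_const.mul (Complex.continuous_ofReal.comp h2)).mul
      (P.continuous.comp (by fun_prop))

lemma kInt_sup_le (P : BA) (u : ℝ) : ‖∫ s in Set.Ioi 0, kInt P u s‖ ≤ ‖P‖ := by
  have h := kInt_integral_norm_le P u (k := 0) (a := 1) (p := ‖P‖) one_pos fun t ht =>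
    (P.norm_coe_le_norm t).trans (le_of_eq (by
      have : 0 < 1 + t := by linarith [abs_nonneg u]
      field_simp))
  refine h.trans (mul_le_of_le_one_right (norm_nonneg P) (inv_le_one_of_one_le₀ ?_))
  have := abs_nonneg u
  simp only [CharP.cast_eq_zero, zero_add, pow_one, one_mul]
  linarith

/-- The Volterra operator as a bounded operator. -/
def Kop : BA →L[ℂ] BA :=
  LinearMap.mkContinuous
    { toFun := fun P => BoundedContinuousFunction.ofNormedAddCommGroup
        (fun u => ∫ s in Set.Ioi 0, kInt P u s) (kInt_integral_continuous P) ‖P‖ (kInt_sup_le P)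
      map_add' := fun P Q => by
        ext u
        simp only [BoundedContinuousFunction.coe_ofNormedAddCommGroup,
          BoundedContinuousFunction.coe_add, Pi.add_apply]
        rw [← integral_add (kInt_integrable P u) (kInt_integrable Q u)]
        congr 1; funext s
        simp only [kInt, BoundedContinuousFunction.coe_add, Pi.add_apply]; ring
      map_smul' := fun c P => by
        ext u
        simp only [BoundedContinuousFunction.coe_ofNormedAddCommGroup,
          BoundedContinuousFunction.coe_smul, RingHom.id_apply, smul_eq_mul]
        rw [← integral_const_mul]
        congr 1; funext s
        simp only [kInt, BoundedContinuousFunction.coe_smul, smul_eq_mul]; ring }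
    1 (fun P => by
      rw [one_mul]
      exact BoundedContinuousFunction.norm_ofNormedAddCommGroup_le _ (norm_nonneg P) (kInt_sup_le P))

lemma Kop_apply (P : BA) (u : ℝ) : Kop P u = ∫ s in Set.Ioi 0, kInt P u s := rfl

/-- `W ↦ (N ↦ K (W N))`. -/
def Tmap : BA →L[ℂ] (BA →L[ℂ] BA) :=
  (ContinuousLinearMap.compL ℂ BA BA BA Kop).comp (ContinuousLinearMap.mul ℂ BA)

lemma Tmap_apply (W N : BA) : Tmap W N = Kop (W * N) := rfl

lemma Tmap_pow_bound {W : BA} {B : ℝ} (hW : ‖W‖ ≤ B) (N : BA) (k : ℕ) (u : ℝ) :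
    ‖((Tmap W) ^ k) N u‖ ≤ B ^ k / k.factorial * ‖N‖ * ((1 + |u|) ^ k)⁻¹ := by
  have hB : 0 ≤ B := (norm_nonneg W).trans hW
  induction k generalizing u with
  | zero => simpa using N.norm_coe_le_norm u
  | succ k ih =>
    rw [pow_succ']
    change ‖Kop (W * ((Tmap W) ^ k) N) u‖ ≤ _
    rw [Kop_apply]
    refine (kInt_integral_norm_le _ u (k := k) (a := 1)
      (p := B * (B ^ k / k.factorial * ‖N‖)) one_pos fun t ht => ?_).trans (le_of_eq ?_)
    · have ht0 : 0 ≤ t := (abs_nonneg u).trans ht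
      rw [BoundedContinuousFunction.mul_apply, norm_mul]
      have h1 := ih t
      rw [abs_of_nonneg ht0] at h1
      have h2 := (W.norm_coe_le_norm t).trans hW
      calc _ ≤ B * (B ^ k / k.factorial * ‖N‖ * ((1 + t) ^ k)⁻¹) := by gcongr
        _ = _ := by
          have : 0 < 1 + t := by linarith
          field_simp
          ring
    · rw [Nat.factorial_succ]
      have : 0 < 1 + |u| := by positivity
      push_cast
      field_simp
      ring

lemma Tmap_pow_norm {W : BA} {B : ℝ} (hW : ‖W‖ ≤ B) (k : ℕ) :
    ‖(Tmap W) ^ k‖ ≤ B ^ k / k.factorial := by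
  have hB : 0 ≤ B := (norm_nonneg W).trans hW
  refine ContinuousLinearMap.opNorm_le_bound _ (by positivity) fun N => ?_
  refine (BoundedContinuousFunction.norm_le (by positivity)).2 fun u => ?_
  refine (Tmap_pow_bound hW N k u).trans (mul_le_of_le_one_right (by positivity) ?_)
  exact inv_le_one_of_one_le₀ (one_le_pow₀ (by linarith [abs_nonneg u]))

lemma exists_pow_div_factorial_lt (B : ℝ) : ∃ k : ℕ, B ^ k / k.factorial < 1 / 2 :=
  ((FloorSemiring.tendsto_pow_div_factorial_atTop B).eventually
    (gt_mem_nhds (by norm_num : (0 : ℝ) < 1 / 2))).exists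

lemma Tmap_isUnit (W : BA) : IsUnit (1 - Tmap W) := by
  obtain ⟨k, hk⟩ := exists_pow_div_factorial_lt ‖W‖
  have h1 : ‖(Tmap W) ^ k‖ < 1 := ((Tmap_pow_norm le_rfl k).trans_lt hk).trans (by norm_num)
  have h2 : IsUnit (1 - (Tmap W) ^ k) :=
    isUnit_one_sub_of_norm_lt_one (R := BA →L[ℂ] BA) h1
  rw [← mul_neg_geom_sum] at h2
  refine ((Commute.isUnit_mul_iff ?_).1 h2).1
  exact (mul_neg_geom_sum _ _).trans (geom_sum_mul_neg _ _).symm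

lemma Tmap_bound (B : ℝ) : ∃ K : ℝ, 0 ≤ K ∧ ∀ W N S : BA, ‖W‖ ≤ B → N = S + Tmap W N →
    ‖N‖ ≤ K * ‖S‖ := by
  obtain ⟨k, hk⟩ := exists_pow_div_factorial_lt B
  refine ⟨2 * ∑ j ∈ Finset.range k, |B ^ j / j.factorial|, by positivity, fun W N S hW hN => ?_⟩
  have h1 : (1 - Tmap W) N = S := by
    change N - Tmap W N = S
    exact sub_eq_of_eq_add hN
  have h2 : N = (∑ j ∈ Finset.range k, (Tmap W) ^ j) S + ((Tmap W) ^ k) N := by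
    rw [← h1]
    change N = ((∑ j ∈ Finset.range k, (Tmap W) ^ j) * (1 - Tmap W)) N + ((Tmap W) ^ k) N
    rw [geom_sum_mul_neg]
    change N = N - ((Tmap W) ^ k) N + ((Tmap W) ^ k) N
    rw [sub_add_cancel]
  have h3 : ‖(∑ j ∈ Finset.range k, (Tmap W) ^ j) S‖ ≤
      (∑ j ∈ Finset.range k, |B ^ j / j.factorial|) * ‖S‖ := by
    refine (ContinuousLinearMap.le_opNorm _ _).trans (mul_le_mul_of_nonneg_right ?_ (norm_nonneg _))
    exact norm_sum_le_of_le _ fun j _ => (Tmap_pow_norm hW j).trans (le_abs_self _)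
  have h4 : ‖((Tmap W) ^ k) N‖ ≤ 1 / 2 * ‖N‖ :=
    (ContinuousLinearMap.le_opNorm _ _).trans
      (mul_le_mul_of_nonneg_right ((Tmap_pow_norm hW k).trans hk.le) (norm_nonneg _))
  have h5 := norm_add_le ((∑ j ∈ Finset.range k, (Tmap W) ^ j) S) (((Tmap W) ^ k) N)
  rw [← h2] at h5
  linarith

lemma volterra_of_ode {n n' w : ℝ → ℂ} {u : ℝ}
    (hn : ∀ t, u ≤ t → HasDerivAt n (n' t) t)
    (hn' : ∀ t, u ≤ t → HasDerivAt n' (w t * n t - 2 * Complex.I * n' t) t)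
    (hl : Tendsto n atTop (nhds 1)) (hl' : Tendsto n' atTop (nhds 0))
    (hi : IntegrableOn (fun s => Dker s * (w (u + s) * n (u + s))) (Set.Ioi 0)) :
    n u = 1 + ∫ s in Set.Ioi 0, Dker s * (w (u + s) * n (u + s)) := by
  have ht : Tendsto (fun s : ℝ => u + s) atTop atTop :=
    tendsto_atTop_add_const_left _ u tendsto_id
  have hd : ∀ s ∈ Set.Ici (0 : ℝ), HasDerivAt (fun s => Dker s * n' (u + s) - n (u + s))
      (Dker s * (w (u + s) * n (u + s))) s := by
    intro s hs
    have hs' : u ≤ u + s := le_add_of_nonneg_right hs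
    have h1 := (hn _ hs').comp_const_add u s
    have h2 := (hn' _ hs').comp_const_add u s
    refine (((hasDerivAt_Dker s).mul h2).sub h1).congr_deriv ?_
    have e : Complex.exp (2 * Complex.I * s) = 2 * Complex.I * Dker s + 1 := by
      unfold Dker
      have : (2 * Complex.I : ℂ) ≠ 0 := by simp
      field_simp
      ring
    rw [e]; ring
  have hl2 : Tendsto (fun s => Dker s * n' (u + s) - n (u + s)) atTop (nhds (0 - 1)) := by
    refine Tendsto.sub ?_ (hl.comp ht)
    refine squeeze_zero_norm (a := fun s => ‖n' (u + s)‖) (fun s => ?_) ?_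
    · rw [norm_mul]
      exact mul_le_of_le_one_left (norm_nonneg _) (norm_Dker_le s)
    · simpa using (hl'.comp ht).norm
  rw [integral_Ioi_of_hasDerivAt_of_tendsto' hd hi hl2]
  simp [Dker]

/-- `t ↦ 1 / (1 + |t|)`. -/
def tauBA : BA :=
  BoundedContinuousFunction.ofNormedAddCommGroup (fun t : ℝ => (((1 + |t|)⁻¹ : ℝ) : ℂ))
    (Complex.continuous_ofReal.comp
      (Continuous.inv₀ (by fun_prop) fun t => by positivity)) 1 (fun t => by
    rw [Complex.norm_real, Real.norm_of_nonneg (by positivity)]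
    exact inv_le_one_of_one_le₀ (by linarith [abs_nonneg t]))

lemma tauBA_apply (t : ℝ) : tauBA t = (((1 + |t|)⁻¹ : ℝ) : ℂ) := rfl

/-- The resolvent-type element `(1 + |t|) / (z + |t|)`. -/
def resBA (z : ℂ) : BA := Ring.inverse (1 + (z - 1) • tauBA)

/-- `z` stays away from the negative half-line. -/
def OffNeg (z : ℂ) : Prop := ∃ b : ℝ, 0 < b ∧ ∀ t : ℝ, 0 ≤ t → b ≤ ‖z + t‖

lemma OffNeg.ne {z : ℂ} (hz : OffNeg z) {t : ℝ} (ht : 0 ≤ t) : z + t ≠ 0 := by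
  obtain ⟨b, hb, h⟩ := hz
  exact norm_pos_iff.1 (hb.trans_le (h t ht))

lemma OffNeg.bound {z : ℂ} (hz : OffNeg z) :
    ∃ C : ℝ, 0 ≤ C ∧ ∀ t : ℝ, 0 ≤ t → (1 + t) / ‖z + t‖ ≤ C := by
  obtain ⟨b, hb, h⟩ := hz
  refine ⟨(1 + ‖z‖) / b + 1, by positivity, fun t ht => ?_⟩
  have h1 := h t ht
  have h2 : 0 < ‖z + t‖ := hb.trans_le h1
  rw [div_le_iff₀ h2]
  have h3 : t ≤ ‖z‖ + ‖z + t‖ := by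
    have := norm_sub_le (z + t) z
    rw [add_sub_cancel_left, Complex.norm_real, Real.norm_of_nonneg ht] at this
    linarith
  have h4 : (1 + ‖z‖) ≤ (1 + ‖z‖) / b * ‖z + t‖ := by
    rw [div_mul_eq_mul_div, le_div_iff₀ hb]
    gcongr
  linarith

lemma OffNeg.exists_inverse {z : ℂ} (hz : OffNeg z) :
    ∃ Q : BA, (1 + (z - 1) • tauBA) * Q = 1 ∧ ∀ t : ℝ, Q t = (1 + |t| : ℝ) / (z + |t|) := by
  obtain ⟨C, hC, hb⟩ := hz.bound
  refine ⟨BoundedContinuousFunction.ofNormedAddCommGroup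
    (fun t : ℝ => ((1 + |t| : ℝ) : ℂ) / (z + ((|t| : ℝ) : ℂ)))
    (Continuous.div (by fun_prop) (by fun_prop) fun t => hz.ne (abs_nonneg t)) C (fun t => ?_),
    ?_, fun t => rfl⟩
  · rw [norm_div, Complex.norm_real, Real.norm_of_nonneg (by positivity)]
    exact hb _ (abs_nonneg t)
  · ext t
    have h1 := hz.ne (abs_nonneg t)
    have h2 : ((1 + |t| : ℝ) : ℂ) ≠ 0 := by
      exact_mod_cast (by positivity : (1 + |t| : ℝ) ≠ 0)
    simp only [BoundedContinuousFunction.coe_mul, BoundedContinuousFunction.coe_add,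
      BoundedContinuousFunction.coe_one, BoundedContinuousFunction.coe_smul, Pi.mul_apply,
      Pi.add_apply, Pi.one_apply, tauBA_apply,
      BoundedContinuousFunction.coe_ofNormedAddCommGroup, smul_eq_mul]
    push_cast at h2 ⊢
    field_simp
    ring

lemma OffNeg.isUnit {z : ℂ} (hz : OffNeg z) : IsUnit (1 + (z - 1) • tauBA) := by
  obtain ⟨Q, hQ, _⟩ := hz.exists_inverse
  exact IsUnit.of_mul_eq_one _ hQ

lemma resBA_apply {z : ℂ} (hz : OffNeg z) (t : ℝ) :
    resBA z t = (1 + |t| : ℝ) / (z + |t|) := by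
  obtain ⟨Q, hQ, h⟩ := hz.exists_inverse
  have : resBA z = Q := by
    have h1 := Ring.inverse_mul_cancel _ hz.isUnit
    calc resBA z = resBA z * ((1 + (z - 1) • tauBA) * Q) := by rw [hQ, mul_one]
      _ = Q := by rw [← mul_assoc]; unfold resBA; rw [h1, one_mul]
  rw [this, h]

lemma resBA_analyticAt {z : ℂ} (hz : OffNeg z) : AnalyticAt ℂ resBA z := by
  have h1 : AnalyticAt ℂ (fun z : ℂ => (1 : BA) + (z - 1) • tauBA) z := by fun_prop
  obtain ⟨v, hv⟩ := hz.isUnit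
  have h2 : AnalyticAt ℂ Ring.inverse ((1 : BA) + (z - 1) • tauBA) := by
    rw [← hv]; exact analyticAt_inverse v
  exact h2.comp_of_eq h1 rfl

/-- The rescaled potential, as an element of the algebra. -/
def potBA (p : ℂ × ℂ) : BA :=
  (2 : ℂ) • (resBA (p.2 * (p.1 + Complex.I)) * resBA (p.2 * (p.1 - Complex.I)))

/-- Admissible complex parameters. -/
def Adm (p : ℂ × ℂ) : Prop :=
  OffNeg (p.2 * (p.1 + Complex.I)) ∧ OffNeg (p.2 * (p.1 - Complex.I))

lemma potBA_apply {p : ℂ × ℂ} (hp : Adm p) (t : ℝ) :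
    potBA p t = 2 * (1 + |t| : ℝ) ^ 2 /
      ((p.2 * (p.1 + Complex.I) + |t|) * (p.2 * (p.1 - Complex.I) + |t|)) := by
  simp only [potBA, BoundedContinuousFunction.coe_smul, BoundedContinuousFunction.coe_mul,
    Pi.mul_apply, smul_eq_mul, resBA_apply hp.1, resBA_apply hp.2]
  rw [div_mul_div_comm, mul_div_assoc', sq]

/-- The solution of the Volterra equation. -/
def solBA (W : BA) : BA := Ring.inverse (1 - Tmap W) (1 : BA)

lemma solBA_eq (W : BA) : solBA W = 1 + Tmap W (solBA W) := by
  have h : ((1 - Tmap W) * Ring.inverse (1 - Tmap W)) (1 : BA) = 1 := by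
    rw [Ring.mul_inverse_cancel _ (Tmap_isUnit W)]; rfl
  have h2 : solBA W - Tmap W (solBA W) = 1 := h
  exact eq_add_of_sub_eq h2

lemma solBA_unique {W N : BA} (h : N = 1 + Tmap W N) : N = solBA W := by
  have h2 : (1 - Tmap W) N = 1 := by
    change N - Tmap W N = 1
    exact sub_eq_of_eq_add h
  unfold solBA
  rw [← h2]
  change N = (Ring.inverse (1 - Tmap W) * (1 - Tmap W)) N
  rw [Ring.inverse_mul_cancel _ (Tmap_isUnit W)]; rfl

lemma analyticAt_inverse_of_isUnit {A : Type*} [NormedRing A] [NormedAlgebra ℂ A]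
    [HasSummableGeomSeries A] {a : A} (h : IsUnit a) : AnalyticAt ℂ Ring.inverse a := by
  obtain ⟨v, rfl⟩ := h
  exact analyticAt_inverse v

lemma solBA_analyticAt (W : BA) : AnalyticAt ℂ solBA W := by
  have h1 : AnalyticAt ℂ (fun W : BA => (1 : BA →L[ℂ] BA) - Tmap W) W :=
    analyticAt_const.fun_sub (ContinuousLinearMap.analyticAt (𝕜 := ℂ) (E := BA) (F := BA →L[ℂ] BA) Tmap W)
  have h2 : AnalyticAt ℂ Ring.inverse ((1 : BA →L[ℂ] BA) - Tmap W) :=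
    analyticAt_inverse_of_isUnit (A := BA →L[ℂ] BA) (Tmap_isUnit W)
  have h3 : AnalyticAt ℂ (fun W : BA => Ring.inverse ((1 : BA →L[ℂ] BA) - Tmap W)) W :=
    h2.comp_of_eq h1 rfl
  exact ((ContinuousLinearMap.apply ℂ BA (1 : BA)).analyticAt _).comp_of_eq h3 rfl

/-- Complexified modified Jost function. -/
def jostC (p : ℂ × ℂ) : ℂ := solBA (potBA p) 0

lemma jostC_analyticAt {p : ℂ × ℂ} (hp : Adm p) : AnalyticAt ℂ jostC p := by
  have h1 : AnalyticAt ℂ (fun p : ℂ × ℂ => resBA (p.2 * (p.1 + Complex.I))) p :=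
    (resBA_analyticAt hp.1).comp_of_eq (f := fun p : ℂ × ℂ => p.2 * (p.1 + Complex.I))
      (analyticAt_snd.mul (analyticAt_fst.add analyticAt_const)) rfl
  have h2 : AnalyticAt ℂ (fun p : ℂ × ℂ => resBA (p.2 * (p.1 - Complex.I))) p :=
    (resBA_analyticAt hp.2).comp_of_eq (f := fun p : ℂ × ℂ => p.2 * (p.1 - Complex.I))
      (analyticAt_snd.mul (analyticAt_fst.sub analyticAt_const)) rfl
  have h3 : AnalyticAt ℂ potBA p := (analyticAt_const (v := (2 : ℂ))).fun_smul (h1.fun_mul h2)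
  have h4 := (solBA_analyticAt (potBA p)).comp_of_eq h3 rfl
  exact ((BoundedContinuousFunction.evalCLM ℂ (0 : ℝ)).analyticAt _).comp_of_eq h4 rfl

/-- Package of the properties of the Jost solution. -/
structure IsJost (f : ℝ → ℝ → ℂ) : Prop where
  smooth : Smooth2 {p : ℝ × ℝ | 0 < p.2} f
  ode : ∀ ξ : ℝ, 0 < ξ → ∀ x : ℝ,
    PDX (PDX f) x ξ = (((2 / (1 + x ^ 2) : ℝ) : ℂ) - (ξ : ℂ) ^ 2) * f x ξ
  asym : ∀ ξ : ℝ, 0 < ξ →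
    Tendsto (fun x : ℝ => Complex.exp (-(Complex.I) * x * ξ) * f x ξ) atTop (nhds 1)
  asym' : ∀ ξ : ℝ, 0 < ξ →
    Tendsto (fun x : ℝ => Complex.exp (-(Complex.I) * x * ξ) * PDX f x ξ)
      atTop (nhds (Complex.I * ξ))

lemma isOpen_upper : IsOpen {p : ℝ × ℝ | 0 < p.2} := isOpen_lt continuous_const continuous_snd

lemma IsJost.hasDerivAt {f : ℝ → ℝ → ℂ} (hf : IsJost f) {ξ : ℝ} (hξ : 0 < ξ) (x : ℝ) :
    HasDerivAt (fun y => f y ξ) (PDX f x ξ) x :=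
  hf.smooth.hasDerivAt_left isOpen_upper hξ

lemma IsJost.hasDerivAt' {f : ℝ → ℝ → ℂ} (hf : IsJost f) {ξ : ℝ} (hξ : 0 < ξ) (x : ℝ) :
    HasDerivAt (fun y => PDX f y ξ)
      ((((2 / (1 + x ^ 2) : ℝ) : ℂ) - (ξ : ℂ) ^ 2) * f x ξ) x := by
  rw [← hf.ode ξ hξ x]
  exact (hf.smooth.pdx isOpen_upper).hasDerivAt_left isOpen_upper hξ

lemma bounded_of_tendsto {n : ℝ → ℂ} (hc : Continuous n) {l : ℂ} (hl : Tendsto n atTop (nhds l)) :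
    ∃ C : ℝ, ∀ t : ℝ, 0 ≤ t → ‖n t‖ ≤ C := by
  have h1 : ∀ᶠ t in atTop, ‖n t‖ < ‖l‖ + 1 :=
    hl.norm.eventually (gt_mem_nhds (lt_add_one _))
  obtain ⟨T, hT⟩ := eventually_atTop.1 h1
  obtain ⟨C, hC⟩ := (isCompact_Icc (a := (0 : ℝ)) (b := T)).exists_bound_of_continuousOn
    hc.continuousOn
  refine ⟨max C (‖l‖ + 1), fun t ht => ?_⟩
  rcases le_total t T with h | h
  · exact (hC t ⟨ht, h⟩).trans (le_max_left _ _)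
  · exact (hT t h).le.trans (le_max_right _ _)

/-- Uniqueness for the Volterra equation, in terms of the differential equation. -/
lemma solBA_of_ode {n n' w : ℝ → ℂ} {W : BA}
    (hn : ∀ t, 0 ≤ t → HasDerivAt n (n' t) t)
    (hn' : ∀ t, 0 ≤ t → HasDerivAt n' (w t * n t - 2 * Complex.I * n' t) t)
    (hl : Tendsto n atTop (nhds 1)) (hl' : Tendsto n' atTop (nhds 0))
    (hW : ∀ t : ℝ, 0 ≤ t → ((((1 + t) ^ 2)⁻¹ : ℝ) : ℂ) * W t = w t) :
    ∀ u, 0 ≤ u → solBA W u = n u := by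
  have hcn : Continuous (fun t => n |t|) := by
    refine continuous_iff_continuousAt.2 fun t => ?_
    exact ContinuousAt.comp (f := fun t : ℝ => |t|) (hn |t| (abs_nonneg t)).continuousAt
      continuous_abs.continuousAt
  obtain ⟨C, hC⟩ := bounded_of_tendsto hcn (l := 1)
    (hl.congr' ((eventually_ge_atTop 0).mono fun t ht => by
      change n t = n |t|
      rw [abs_of_nonneg ht]))
  let N : BA := BoundedContinuousFunction.ofNormedAddCommGroup (fun t => n |t|) hcn C
    (fun t => by simpa using hC |t| (abs_nonneg t))
  have hN : ∀ t, N t = n |t| := fun t => rfl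
  have key : N = 1 + Tmap W N := by
    ext u
    have e : ∀ s ∈ Set.Ioi (0 : ℝ), kInt (W * N) u s =
        Dker s * (w (|u| + s) * n (|u| + s)) := by
      intro s hs
      have hs' : 0 ≤ |u| + s := add_nonneg (abs_nonneg u) (le_of_lt hs)
      rw [← hW _ hs']
      unfold kInt
      rw [BoundedContinuousFunction.mul_apply, hN, abs_of_nonneg hs', add_assoc]
      ring
    have hi := (kInt_integrable (W * N) u).congr_fun e measurableSet_Ioi
    change n |u| = 1 + Kop (W * N) u
    rw [Kop_apply, setIntegral_congr_fun measurableSet_Ioi e]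
    exact volterra_of_ode (fun t ht => hn t ((abs_nonneg u).trans ht))
      (fun t ht => hn' t ((abs_nonneg u).trans ht)) hl hl' hi
  intro u hu
  rw [← solBA_unique key, hN, abs_of_nonneg hu]

lemma adm_real (x : ℝ) {ξ : ℝ} (hξ : 0 < ξ) : Adm ((x : ℂ), (ξ : ℂ)) := by
  constructor
  · refine ⟨ξ, hξ, fun t _ => ?_⟩
    refine le_trans (le_of_eq ?_) (Complex.abs_im_le_norm _)
    simp [abs_of_pos hξ]
  · refine ⟨ξ, hξ, fun t _ => ?_⟩
    refine le_trans (le_of_eq ?_) (Complex.abs_im_le_norm _)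
    simp [abs_of_pos hξ]

lemma IsJost.eq_jostC {f : ℝ → ℝ → ℂ} (hf : IsJost f) {ξ : ℝ} (hξ : 0 < ξ) (x : ℝ) :
    Complex.exp (-(Complex.I) * x * ξ) * f x ξ = jostC ((x : ℂ), (ξ : ℂ)) := by
  have hξc : (ξ : ℂ) ≠ 0 := by exact_mod_cast hξ.ne'
  have hlin : ∀ t : ℝ, HasDerivAt (fun t : ℝ => x + t / ξ) (1 / ξ) t := fun t =>
    ((hasDerivAt_id t).div_const ξ).const_add x
  have hexp : ∀ t : ℝ, HasDerivAt (fun t : ℝ => Complex.exp (-(Complex.I) * (x * ξ + t)))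
      (-(Complex.I) * Complex.exp (-(Complex.I) * (x * ξ + t))) t := fun t => by
    have h1 : HasDerivAt (fun t : ℝ => -(Complex.I) * (x * ξ + (t : ℂ))) (-(Complex.I)) t := by
      simpa using ((Complex.ofRealCLM.hasDerivAt (x := t)).const_add ((x : ℂ) * ξ)).const_mul
        (-(Complex.I))
    exact h1.cexp.congr_deriv (by ring)
  have hf1 : ∀ t : ℝ, HasDerivAt (fun t : ℝ => f (x + t / ξ) ξ)
      ((1 / ξ : ℝ) • PDX f (x + t / ξ) ξ) t := fun t =>
    HasDerivAt.scomp (g₁ := fun y => f y ξ) t (hf.hasDerivAt hξ (x + t / ξ)) (hlin t)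
  have hf2 : ∀ t : ℝ, HasDerivAt (fun t : ℝ => PDX f (x + t / ξ) ξ)
      ((1 / ξ : ℝ) • ((((2 / (1 + (x + t / ξ) ^ 2) : ℝ) : ℂ) - (ξ : ℂ) ^ 2) *
        f (x + t / ξ) ξ)) t := fun t =>
    HasDerivAt.scomp (g₁ := fun y => PDX f y ξ) t (hf.hasDerivAt' hξ (x + t / ξ)) (hlin t)
  have htop : Tendsto (fun t : ℝ => x + t / ξ) atTop atTop :=
    tendsto_atTop_add_const_left _ x (tendsto_id.atTop_div_const hξ)
  have hee : ∀ t : ℝ, Complex.exp (-(Complex.I) * ((x + t / ξ : ℝ) : ℂ) * ξ) =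
      Complex.exp (-(Complex.I) * (x * ξ + t)) := fun t => by
    congr 1
    push_cast
    field_simp
  have h := solBA_of_ode (n := fun t => Complex.exp (-(Complex.I) * (x * ξ + t)) * f (x + t / ξ) ξ)
    (n' := fun t => Complex.exp (-(Complex.I) * (x * ξ + t)) *
      ((ξ : ℂ)⁻¹ * PDX f (x + t / ξ) ξ - Complex.I * f (x + t / ξ) ξ))
    (w := fun t => ((2 / (1 + (x + t / ξ) ^ 2) : ℝ) : ℂ) / (ξ : ℂ) ^ 2)
    (W := potBA ((x : ℂ), (ξ : ℂ))) (fun t _ => ?_) (fun t _ => ?_) ?_ ?_ (fun t ht => ?_) 0 le_rfl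
  · unfold jostC
    rw [h]
    simp [mul_assoc]
  · refine ((hexp t).mul (hf1 t)).congr_deriv ?_
    simp only [Complex.real_smul]
    push_cast
    field_simp
    ring
  · refine ((hexp t).fun_mul (((hf2 t).const_mul ((ξ : ℂ)⁻¹)).fun_sub
      ((hf1 t).const_mul Complex.I))).congr_deriv ?_
    simp only [Complex.real_smul]
    generalize ((2 / (1 + (x + t / ξ) ^ 2) : ℝ) : ℂ) = V
    push_cast
    field_simp
    ring_nf
    simp only [Complex.I_sq]
    ring
  · refine ((hf.asym ξ hξ).comp htop).congr fun t => ?_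
    simp only [Function.comp]
    rw [hee]
  · have h1 := ((((hf.asym' ξ hξ).comp htop).const_mul ((ξ : ℂ)⁻¹)).sub
      (((hf.asym ξ hξ).comp htop).const_mul Complex.I))
    have e : (ξ : ℂ)⁻¹ * (Complex.I * ξ) - Complex.I * 1 = 0 := by field_simp; ring
    rw [e] at h1
    refine h1.congr fun t => ?_
    simp only [Function.comp]
    rw [hee]; ring
  · rw [potBA_apply (adm_real x hξ), abs_of_nonneg ht]
    have h1 : (1 + (t : ℂ)) ≠ 0 := by exact_mod_cast (by positivity : (1 + t : ℝ) ≠ 0)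
    have h2 : (1 + ((x : ℂ) + t / ξ) ^ 2) ≠ 0 := by
      exact_mod_cast (by positivity : (1 + (x + t / ξ) ^ 2 : ℝ) ≠ 0)
    have e1 : ((ξ : ℂ) * (x + Complex.I) + t) * (ξ * (x - Complex.I) + t) =
        (1 + ((x : ℂ) + t / ξ) ^ 2) * ξ ^ 2 := by
      field_simp
      ring_nf
      simp only [Complex.I_sq]
      ring
    simp only
    rw [e1]
    push_cast
    field_simp

/-- A holomorphic extension to polydiscs of radii comparable to `⟨x₀⟩` and `ξ₀` gives symbol
estimates, by Cauchy's inequality. -/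
lemma SymN.of_cauchy {U : Set (ℝ × ℝ)} (hU : IsOpen U) (hpos : ∀ p ∈ U, 0 < p.2) (n : ℕ)
    {G : ℂ × ℂ → ℂ} {w : ℝ → ℝ → ℝ} {F : ℝ → ℝ → ℂ} {δ C : ℝ} (hδ : 0 < δ) (hC : 0 ≤ C)
    (hG : ∀ x₀ ξ₀ : ℝ, (x₀, ξ₀) ∈ U → ∀ p : ℂ × ℂ, ‖p.1 - x₀‖ < δ * jap x₀ →
      ‖p.2 - ξ₀‖ < δ * ξ₀ → AnalyticAt ℂ G p ∧ ‖G p‖ ≤ C * w x₀ ξ₀)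
    (hF : ∀ x ξ : ℝ, (x, ξ) ∈ U → F x ξ = G ((x : ℂ), (ξ : ℂ))) : SymN U n w F := by
  have hself : ∀ x ξ : ℝ, (x, ξ) ∈ U →
      AnalyticAt ℂ G ((x : ℂ), (ξ : ℂ)) ∧ ‖G ((x : ℂ), (ξ : ℂ))‖ ≤ C * w x ξ := fun x ξ h =>
    hG x ξ h _ (by simpa using mul_pos hδ (jap_pos x)) (by simpa using mul_pos hδ (hpos _ h))
  induction n generalizing G w F δ C with
  | zero => exact ⟨C, hC, fun x ξ h => hF x ξ h ▸ (hself x ξ h).2⟩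
  | succ n ih =>
    have hd1 : ∀ p : ℂ × ℂ, AnalyticAt ℂ G p →
        HasDerivAt (fun z => G (z, p.2)) (fderiv ℂ G p (1, 0)) p.1 := fun p hp => by
      have h1 : HasDerivAt (fun z : ℂ => (z, p.2)) ((1 : ℂ), (0 : ℂ)) p.1 :=
        (hasDerivAt_id p.1).prodMk (hasDerivAt_const p.1 p.2)
      exact HasFDerivAt.comp_hasDerivAt (l := G) (f := fun z : ℂ => (z, p.2)) p.1
        hp.differentiableAt.hasFDerivAt h1
    have hd2 : ∀ p : ℂ × ℂ, AnalyticAt ℂ G p →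
        HasDerivAt (fun z => G (p.1, z)) (fderiv ℂ G p (0, 1)) p.2 := fun p hp => by
      have h1 : HasDerivAt (fun z : ℂ => (p.1, z)) ((0 : ℂ), (1 : ℂ)) p.2 :=
        (hasDerivAt_const p.2 p.1).prodMk (hasDerivAt_id p.2)
      exact HasFDerivAt.comp_hasDerivAt (l := G) (f := fun z : ℂ => (p.1, z)) p.2
        hp.differentiableAt.hasFDerivAt h1
    have han : ∀ (v : ℂ × ℂ) (p : ℂ × ℂ), AnalyticAt ℂ G p →
        AnalyticAt ℂ (fun p => fderiv ℂ G p v) p := fun v p hp =>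
      ((ContinuousLinearMap.apply ℂ ℂ v).analyticAt _).comp_of_eq hp.fderiv rfl
    refine ⟨⟨C, hC, fun x ξ h => hF x ξ h ▸ (hself x ξ h).2⟩, ?_, ?_⟩
    · have hG' : ∀ x₀ ξ₀ : ℝ, (x₀, ξ₀) ∈ U → ∀ p : ℂ × ℂ, ‖p.1 - x₀‖ < δ / 2 * jap x₀ →
          ‖p.2 - ξ₀‖ < δ / 2 * ξ₀ → AnalyticAt ℂ (fun p => fderiv ℂ G p (1, 0)) p ∧
            ‖fderiv ℂ G p (1, 0)‖ ≤ C / (δ / 2) * (w x₀ ξ₀ / jap x₀) := by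
        intro x₀ ξ₀ h p h1 h2
        have hj := jap_pos x₀
        have hξ := hpos _ h
        have hR : 0 < δ / 2 * jap x₀ := by positivity
        have h2' : ‖p.2 - ξ₀‖ < δ * ξ₀ := by nlinarith
        have hz : ∀ z ∈ Metric.closedBall p.1 (δ / 2 * jap x₀), ‖z - x₀‖ < δ * jap x₀ := by
          intro z hz
          rw [mem_closedBall_iff_norm] at hz
          have := norm_add_le (z - p.1) (p.1 - x₀)
          rw [sub_add_sub_cancel] at this
          linarith
        have hp := (hG x₀ ξ₀ h p (hz p.1 (Metric.mem_closedBall_self hR.le)) h2').1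
        refine ⟨han _ p hp, ?_⟩
        have hdc : DiffContOnCl ℂ (fun z => G (z, p.2)) (Metric.ball p.1 (δ / 2 * jap x₀)) := by
          apply DifferentiableOn.diffContOnCl_ball (U := Metric.closedBall p.1 (δ / 2 * jap x₀)) _
            subset_rfl
          intro z hz'
          exact (hd1 (z, p.2) (hG x₀ ξ₀ h (z, p.2) (hz z hz') h2').1).differentiableAt.differentiableWithinAt
        have := Complex.norm_deriv_le_of_forall_mem_sphere_norm_le hR hdc
          fun z hz' => (hG x₀ ξ₀ h (z, p.2) (hz z (Metric.sphere_subset_closedBall hz')) h2').2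
        rw [(hd1 p hp).deriv] at this
        refine this.trans (le_of_eq ?_)
        field_simp
      refine ih (δ := δ / 2) (C := C / (δ / 2)) (by positivity) (by positivity) hG'
        (fun x ξ h => ?_) (fun x ξ h => ?_)
      · rw [PDX_congr hU hF h]
        exact ((hd1 ((x : ℂ), (ξ : ℂ)) (hself x ξ h).1).comp_ofReal).deriv
      · exact hG' x ξ h _ (by simpa using mul_pos (half_pos hδ) (jap_pos x))
          (by simpa using mul_pos (half_pos hδ) (hpos _ h))
    · have hG' : ∀ x₀ ξ₀ : ℝ, (x₀, ξ₀) ∈ U → ∀ p : ℂ × ℂ, ‖p.1 - x₀‖ < δ / 2 * jap x₀ →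
          ‖p.2 - ξ₀‖ < δ / 2 * ξ₀ → AnalyticAt ℂ (fun p => fderiv ℂ G p (0, 1)) p ∧
            ‖fderiv ℂ G p (0, 1)‖ ≤ C / (δ / 2) * (w x₀ ξ₀ / |ξ₀|) := by
        intro x₀ ξ₀ h p h1 h2
        have hj := jap_pos x₀
        have hξ : 0 < ξ₀ := hpos _ h
        have hR : 0 < δ / 2 * ξ₀ := by positivity
        have h1' : ‖p.1 - x₀‖ < δ * jap x₀ := by nlinarith
        have hz : ∀ z ∈ Metric.closedBall p.2 (δ / 2 * ξ₀), ‖z - ξ₀‖ < δ * ξ₀ := by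
          intro z hz
          rw [mem_closedBall_iff_norm] at hz
          have := norm_add_le (z - p.2) (p.2 - ξ₀)
          rw [sub_add_sub_cancel] at this
          linarith
        have hp := (hG x₀ ξ₀ h p h1' (hz p.2 (Metric.mem_closedBall_self hR.le))).1
        refine ⟨han _ p hp, ?_⟩
        have hdc : DiffContOnCl ℂ (fun z => G (p.1, z)) (Metric.ball p.2 (δ / 2 * ξ₀)) := by
          apply DifferentiableOn.diffContOnCl_ball (U := Metric.closedBall p.2 (δ / 2 * ξ₀)) _
            subset_rfl
          intro z hz'
          exact (hd2 (p.1, z) (hG x₀ ξ₀ h (p.1, z) h1' (hz z hz')).1).differentiableAt.differentiableWithinAt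
        have := Complex.norm_deriv_le_of_forall_mem_sphere_norm_le hR hdc
          fun z hz' => (hG x₀ ξ₀ h (p.1, z) h1' (hz z (Metric.sphere_subset_closedBall hz'))).2
        rw [(hd2 p hp).deriv] at this
        refine this.trans (le_of_eq ?_)
        rw [abs_of_pos hξ]
        field_simp
      refine ih (δ := δ / 2) (C := C / (δ / 2)) (by positivity) (by positivity) hG'
        (fun x ξ h => ?_) (fun x ξ h => ?_)
      · rw [PDXI_congr hU hF h]
        exact ((hd2 ((x : ℂ), (ξ : ℂ)) (hself x ξ h).1).comp_ofReal).deriv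
      · exact hG' x ξ h _ (by simpa using mul_pos (half_pos hδ) (jap_pos x))
          (by simpa using mul_pos (half_pos hδ) (hpos _ h))

/-- Lower bound for the distance to the poles of the potential. -/
lemma norm_pole_ge {x₀ ξ₀ σ t : ℝ} (hx : -1 ≤ x₀) (hξ : 0 < ξ₀) (hσ : σ ^ 2 = 1) (ht : 0 ≤ t)
    {p : ℂ × ℂ} (h1 : ‖p.1 - x₀‖ < 1 / 24 * jap x₀) (h2 : ‖p.2 - ξ₀‖ < 1 / 24 * ξ₀) :
    1 / 8 * (jap x₀ * ξ₀ + t) ≤ ‖p.2 * (p.1 + σ * Complex.I) + t‖ := by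
  have hj := jap_pos x₀
  have hnorm : ∀ a : ℝ, ‖(a : ℂ) + σ * Complex.I‖ = jap a := fun a => by
    rw [Complex.norm_add_mul_I, jap, hσ, add_comm]
  have hA : 1 / 4 * (jap x₀ * ξ₀ + t) ≤ ‖(ξ₀ : ℂ) * (x₀ + σ * Complex.I) + t‖ := by
    have e : (ξ₀ : ℂ) * (x₀ + σ * Complex.I) + t =
        ξ₀ * (((x₀ + t / ξ₀ : ℝ) : ℂ) + σ * Complex.I) := by
      have : (ξ₀ : ℂ) ≠ 0 := by exact_mod_cast hξ.ne'
      push_cast; field_simp; ring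
    rw [e, norm_mul, hnorm, Complex.norm_real, Real.norm_of_nonneg hξ.le]
    have hτ : 0 ≤ t / ξ₀ := by positivity
    have e2 : jap x₀ * ξ₀ + t = ξ₀ * (jap x₀ + t / ξ₀) := by field_simp
    rw [e2, mul_left_comm]
    refine mul_le_mul_of_nonneg_left ?_ hξ.le
    set τ := t / ξ₀
    refine abs_le_of_sq_le_sq' ?_ (jap_pos _).le |>.2
    rw [mul_pow, jap_sq]
    have h3 := jap_sq x₀
    rcases le_total 0 x₀ with h0 | h0
    · have := jap_le x₀
      rw [abs_of_nonneg h0] at this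
      nlinarith [sq_nonneg (x₀ + τ - 1), one_le_jap x₀]
    · have : jap x₀ ≤ 3 / 2 := by nlinarith [one_le_jap x₀]
      have h4 : τ ≤ (x₀ + τ) + 1 := by linarith
      nlinarith [sq_nonneg (x₀ + τ - 1), one_le_jap x₀]
  have hB : ‖p.2 * (p.1 + σ * Complex.I) + t - ((ξ₀ : ℂ) * (x₀ + σ * Complex.I) + t)‖ ≤
      1 / 8 * (jap x₀ * ξ₀) := by
    have e : p.2 * (p.1 + σ * Complex.I) + t - ((ξ₀ : ℂ) * (x₀ + σ * Complex.I) + t) =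
        (p.2 - ξ₀) * ((p.1 - x₀) + (x₀ + σ * Complex.I)) + ξ₀ * (p.1 - x₀) := by ring
    rw [e]
    have e3 := norm_add_le (p.1 - (x₀ : ℂ)) (x₀ + σ * Complex.I)
    rw [hnorm] at e3
    calc _ ≤ ‖p.2 - ξ₀‖ * ‖(p.1 - x₀) + (x₀ + σ * Complex.I)‖ + ξ₀ * ‖p.1 - x₀‖ := by
          refine (norm_add_le _ _).trans (le_of_eq ?_)
          rw [norm_mul, norm_mul, Complex.norm_real, Real.norm_of_nonneg hξ.le]
      _ ≤ 1 / 24 * ξ₀ * (2 * jap x₀) + ξ₀ * (1 / 24 * jap x₀) := by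
          gcongr
          linarith
      _ = _ := by ring
  have := norm_sub_norm_le ((ξ₀ : ℂ) * (x₀ + σ * Complex.I) + t) (p.2 * (p.1 + σ * Complex.I) + t)
  rw [norm_sub_rev] at this
  linarith

section polydisc
variable {x₀ ξ₀ : ℝ} {p : ℂ × ℂ}

lemma adm_polydisc (hx : -1 ≤ x₀) (hξ : 0 < ξ₀)
    (h1 : ‖p.1 - x₀‖ < 1 / 24 * jap x₀) (h2 : ‖p.2 - ξ₀‖ < 1 / 24 * ξ₀) : Adm p := by
  have hL := mul_pos (jap_pos x₀) hξ
  refine ⟨⟨1 / 8 * (jap x₀ * ξ₀), by positivity, fun t ht => ?_⟩,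
    ⟨1 / 8 * (jap x₀ * ξ₀), by positivity, fun t ht => ?_⟩⟩
  · have := norm_pole_ge (σ := 1) hx hξ (by norm_num) ht h1 h2
    simp only [Complex.ofReal_one, one_mul] at this
    linarith
  · have := norm_pole_ge (σ := -1) hx hξ (by norm_num) ht h1 h2
    simp only [Complex.ofReal_neg, Complex.ofReal_one, neg_mul, one_mul, ← sub_eq_add_neg] at this
    linarith

lemma norm_potBA_apply_le (hx : -1 ≤ x₀) (hξ : 0 < ξ₀)
    (h1 : ‖p.1 - x₀‖ < 1 / 24 * jap x₀) (h2 : ‖p.2 - ξ₀‖ < 1 / 24 * ξ₀) (t : ℝ) :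
    ‖potBA p t‖ ≤ 128 * (1 + |t|) ^ 2 * ((jap x₀ * ξ₀ + |t|) ^ 2)⁻¹ := by
  have hL := mul_pos (jap_pos x₀) hξ
  rw [potBA_apply (adm_polydisc hx hξ h1 h2)]
  have a1 := norm_pole_ge (σ := 1) hx hξ (by norm_num) (abs_nonneg t) h1 h2
  have a2 := norm_pole_ge (σ := -1) hx hξ (by norm_num) (abs_nonneg t) h1 h2
  simp only [Complex.ofReal_one, one_mul] at a1
  simp only [Complex.ofReal_neg, Complex.ofReal_one, neg_mul, one_mul, ← sub_eq_add_neg] at a2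
  rw [norm_div, norm_mul, norm_mul, norm_pow, Complex.norm_real, Real.norm_of_nonneg (by positivity),
    div_eq_mul_inv]
  have hp : 0 < jap x₀ * ξ₀ + |t| := by positivity
  have h3 : (1 / 8 * (jap x₀ * ξ₀ + |t|)) * (1 / 8 * (jap x₀ * ξ₀ + |t|)) ≤
      ‖p.2 * (p.1 + Complex.I) + |t|‖ * ‖p.2 * (p.1 - Complex.I) + |t|‖ := by gcongr
  calc _ ≤ ‖(2 : ℂ)‖ * (1 + |t|) ^ 2 *
        ((1 / 8 * (jap x₀ * ξ₀ + |t|)) * (1 / 8 * (jap x₀ * ξ₀ + |t|)))⁻¹ := by gcongr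
    _ = _ := by
      rw [Complex.norm_two]
      field_simp
      norm_num

lemma norm_potBA_le (hx : -1 ≤ x₀) (hξ : 0 < ξ₀)
    (h1 : ‖p.1 - x₀‖ < 1 / 24 * jap x₀) (h2 : ‖p.2 - ξ₀‖ < 1 / 24 * ξ₀) {c : ℝ} (hc : 0 < c)
    (hc1 : c ≤ 1) (hL : c ≤ jap x₀ * ξ₀) : ‖potBA p‖ ≤ 128 * (c ^ 2)⁻¹ := by
  refine (BoundedContinuousFunction.norm_le (by positivity)).2 fun t => ?_
  refine (norm_potBA_apply_le hx hξ h1 h2 t).trans ?_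
  have h3 : c * (1 + |t|) ≤ jap x₀ * ξ₀ + |t| := by nlinarith [abs_nonneg t]
  have h4 : 0 < c * (1 + |t|) := by positivity
  calc _ ≤ 128 * (1 + |t|) ^ 2 * ((c * (1 + |t|)) ^ 2)⁻¹ := by gcongr
    _ = _ := by field_simp

end polydisc

lemma exists_solBA_bound (B : ℝ) : ∃ K : ℝ, 0 ≤ K ∧ ∀ W : BA, ‖W‖ ≤ B → ‖solBA W‖ ≤ K := by
  obtain ⟨K, hK, h⟩ := Tmap_bound B
  refine ⟨K, hK, fun W hW => ?_⟩
  simpa using h W _ 1 hW (solBA_eq W)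

/-- `m - 1` is `O(1/(⟨x⟩ξ))` on polydiscs. -/
lemma exists_jostC_sub_one_bound {c : ℝ} (hc : 0 < c) (hc1 : c ≤ 1) : ∃ C : ℝ, 0 ≤ C ∧
    ∀ x₀ ξ₀ : ℝ, -1 ≤ x₀ → 0 < ξ₀ → c ≤ jap x₀ * ξ₀ → ∀ p : ℂ × ℂ,
      ‖p.1 - x₀‖ < 1 / 24 * jap x₀ → ‖p.2 - ξ₀‖ < 1 / 24 * ξ₀ →
      ‖jostC p - 1‖ ≤ C * (jap x₀ * ξ₀)⁻¹ := by
  obtain ⟨K, hK, h⟩ := exists_solBA_bound (128 * (c ^ 2)⁻¹)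
  refine ⟨128 * K, by positivity, fun x₀ ξ₀ hx hξ hL p h1 h2 => ?_⟩
  have hN := h _ (norm_potBA_le hx hξ h1 h2 hc hc1 hL)
  have e : jostC p - 1 = Kop (potBA p * solBA (potBA p)) 0 := by
    have e1 := congrArg (fun N : BA => N 0) (solBA_eq (potBA p))
    rw [Tmap_apply] at e1
    exact sub_eq_of_eq_add' e1
  rw [e, Kop_apply]
  have hLp : 0 < jap x₀ * ξ₀ := mul_pos (jap_pos x₀) hξ
  have := kInt_integral_norm_le (potBA p * solBA (potBA p)) 0 (k := 0) (a := jap x₀ * ξ₀)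
    (p := 128 * K) hLp (fun t ht => ?_)
  · simpa using this
  · have ht0 : |t| = t := abs_of_nonneg (by simpa using ht)
    rw [BoundedContinuousFunction.mul_apply, norm_mul]
    have a1 := norm_potBA_apply_le hx hξ h1 h2 t
    rw [ht0] at a1
    have a2 := (BoundedContinuousFunction.norm_coe_le_norm (solBA (potBA p)) t).trans hN
    have ht1 : 0 ≤ t := ht0 ▸ abs_nonneg t
    calc _ ≤ 128 * (1 + t) ^ 2 * ((jap x₀ * ξ₀ + t) ^ 2)⁻¹ * K := by gcongr
      _ = _ := by ring

/-- The modified Jost function. -/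
def mJost (f : ℝ → ℝ → ℂ) (x ξ : ℝ) : ℂ := Complex.exp (-(Complex.I) * x * ξ) * f x ξ

lemma contDiff_phase (c : ℂ) :
    ContDiff ℝ (⊤ : ℕ∞) (fun p : ℝ × ℝ => Complex.exp (c * p.1 * p.2)) := by
  have h1 : ContDiff ℝ (⊤ : ℕ∞) (fun p : ℝ × ℝ => (p.1 : ℂ)) :=
    Complex.ofRealCLM.contDiff.comp contDiff_fst
  have h2 : ContDiff ℝ (⊤ : ℕ∞) (fun p : ℝ × ℝ => (p.2 : ℂ)) :=
    Complex.ofRealCLM.contDiff.comp contDiff_snd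
  exact ((contDiff_const.mul h1).mul h2).cexp

lemma IsJost.smooth_m {f : ℝ → ℝ → ℂ} (hf : IsJost f) :
    Smooth2 {p : ℝ × ℝ | 0 < p.2} (mJost f) :=
  ContDiffOn.mul (contDiff_phase (-(Complex.I))).contDiffOn hf.smooth

/-- The outer region. -/
def Outer (c : ℝ) : Set (ℝ × ℝ) := {p | -1 < p.1 ∧ 0 < p.2 ∧ c < jap p.1 * p.2}

lemma continuous_jap : Continuous jap := by unfold jap; fun_prop

lemma isOpen_outer (c : ℝ) : IsOpen (Outer c) := by
  have h := continuous_jap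
  have h2 : Continuous fun p : ℝ × ℝ => jap p.1 * p.2 := by fun_prop
  exact (isOpen_lt continuous_const continuous_fst).inter
    ((isOpen_lt continuous_const continuous_snd).inter (isOpen_lt continuous_const h2))

lemma IsJost.symb_outer {f : ℝ → ℝ → ℂ} (hf : IsJost f) {c : ℝ} (hc : 0 < c) (hc1 : c ≤ 1) :
    Symb (Outer c) (fun x ξ => (jap x * ξ)⁻¹) (fun x ξ => mJost f x ξ - 1) := by
  obtain ⟨C, hC, h⟩ := exists_jostC_sub_one_bound hc hc1
  refine ⟨ContDiffOn.sub (hf.smooth_m.restrict fun p hp => hp.2.1) contDiffOn_const, fun n => ?_⟩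
  refine SymN.of_cauchy (isOpen_outer c) (fun p hp => hp.2.1) n (G := fun p => jostC p - 1)
    (δ := 1 / 24) (by norm_num) hC (fun x₀ ξ₀ hx p h1 h2 => ⟨?_, ?_⟩) (fun x ξ hx => ?_)
  · exact (jostC_analyticAt (adm_polydisc hx.1.le hx.2.1 h1 h2)).sub analyticAt_const
  · exact h x₀ ξ₀ hx.1.le hx.2.1 hx.2.2.le p h1 h2
  · rw [← hf.eq_jostC hx.2.1]; rfl

/-- The overlap region. -/
def Overlap : Set (ℝ × ℝ) := {p | 0 < p.1 ∧ 0 < p.2 ∧ 1 / 8 < p.1 * p.2 ∧ p.1 * p.2 < 1 / 2 ∧ p.2 < 3 / 2}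

lemma isOpen_overlap : IsOpen Overlap :=
  (isOpen_lt continuous_const continuous_fst).inter
    ((isOpen_lt continuous_const continuous_snd).inter
      ((isOpen_lt continuous_const (continuous_fst.mul continuous_snd)).inter
        ((isOpen_lt (continuous_fst.mul continuous_snd) continuous_const).inter
          (isOpen_lt continuous_snd continuous_const))))

lemma norm_mul_add_ge {x₀ ξ₀ t : ℝ} (h : (x₀, ξ₀) ∈ Overlap) (ht : 0 ≤ t) {p : ℂ × ℂ}
    (h1 : ‖p.1 - x₀‖ < 1 / 1000 * jap x₀) (h2 : ‖p.2 - ξ₀‖ < 1 / 1000 * ξ₀) :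
    1 / 2 * (1 / 8 + t) ≤ ‖p.1 * p.2 + t‖ := by
  obtain ⟨hx, hξ, hl, hu, hs⟩ := h
  simp only at hx hξ hl hu hs
  have hj : jap x₀ ≤ 13 * x₀ := by
    have := jap_le x₀
    rw [abs_of_pos hx] at this
    nlinarith
  have hB : ‖p.1 * p.2 + t - ((x₀ * ξ₀ + t : ℝ) : ℂ)‖ ≤ 1 / 2 * (x₀ * ξ₀) := by
    have e : p.1 * p.2 + t - ((x₀ * ξ₀ + t : ℝ) : ℂ) =
        (p.2 - ξ₀) * ((p.1 - x₀) + x₀) + ξ₀ * (p.1 - x₀) := by push_cast; ring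
    rw [e]
    have e3 := norm_add_le (p.1 - (x₀ : ℂ)) x₀
    rw [Complex.norm_real, Real.norm_of_nonneg hx.le] at e3
    calc _ ≤ ‖p.2 - ξ₀‖ * ‖(p.1 - x₀) + x₀‖ + ξ₀ * ‖p.1 - x₀‖ := by
          refine (norm_add_le _ _).trans (le_of_eq ?_)
          rw [norm_mul, norm_mul, Complex.norm_real, Real.norm_of_nonneg hξ.le]
      _ ≤ 1 / 1000 * ξ₀ * (2 * x₀) + ξ₀ * (1 / 1000 * (13 * x₀)) := by
          have : (0:ℝ) ≤ 2 * x₀ := by positivity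
          gcongr
          · linarith
          · linarith
      _ ≤ _ := by nlinarith
  have := norm_sub_norm_le ((x₀ * ξ₀ + t : ℝ) : ℂ) (p.1 * p.2 + t)
  rw [norm_sub_rev, Complex.norm_real, Real.norm_of_nonneg (by nlinarith)] at this
  linarith

/-- The potential of the free problem `2/x²`. -/
def freeBA (y : ℂ) : BA := (2 : ℂ) • (resBA y * resBA y)

lemma freeBA_apply {y : ℂ} (hy : OffNeg y) (t : ℝ) :
    freeBA y t = 2 * (1 + |t| : ℝ) ^ 2 / (y + |t|) ^ 2 := by
  simp only [freeBA, BoundedContinuousFunction.coe_smul, BoundedContinuousFunction.coe_mul,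
    Pi.mul_apply, smul_eq_mul, resBA_apply hy]
  rw [div_mul_div_comm, mul_div_assoc', sq, sq]

lemma solBA_freeBA {y : ℂ} (hy : OffNeg y) : solBA (freeBA y) 0 = 1 + Complex.I / y := by
  have hne : ∀ t : ℝ, 0 ≤ t → y + t ≠ 0 := fun t ht => hy.ne ht
  have hl : ∀ t : ℝ, HasDerivAt (fun t : ℝ => y + (t : ℂ)) 1 t := fun t =>
    (Complex.ofRealCLM.hasDerivAt (x := t)).const_add y
  have htop : Tendsto (fun t : ℝ => (y + (t : ℂ))⁻¹) atTop (nhds 0) := by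
    have := tendsto_inv₀_cobounded (α := ℂ)
    refine this.comp ?_
    rw [← tendsto_norm_atTop_iff_cobounded]
    refine tendsto_atTop_mono (f := fun t : ℝ => t - ‖y‖) (fun t => ?_)
      (tendsto_atTop_add_const_right _ _ tendsto_id)
    have h1 := norm_sub_norm_le (t : ℂ) (-y)
    rw [norm_neg, Complex.norm_real, sub_neg_eq_add, add_comm (t : ℂ)] at h1
    have := Real.le_norm_self t
    linarith
  have h := solBA_of_ode (n := fun t : ℝ => 1 + Complex.I * (y + t)⁻¹)
    (n' := fun t : ℝ => -Complex.I * ((y + t)⁻¹) ^ 2) (w := fun t : ℝ => 2 * ((y + t)⁻¹) ^ 2)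
    (W := freeBA y) (fun t ht => ?_) (fun t ht => ?_) ?_ ?_ (fun t ht => ?_) 0 le_rfl
  · rw [h]; simp [div_eq_mul_inv]
  · refine ((((hl t).inv (hne t ht)).const_mul Complex.I).const_add 1).congr_deriv ?_
    have := hne t ht
    field_simp
  · refine ((((hl t).inv (hne t ht)).pow 2).const_mul (-Complex.I)).congr_deriv ?_
    have := hne t ht
    simp only [Nat.cast_ofNat, Nat.add_one_sub_one, pow_one, Pi.inv_apply]
    field_simp
    ring_nf
    simp only [Complex.I_sq]
    ring
  · simpa using (htop.const_mul Complex.I).const_add 1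
  · simpa using (htop.pow 2).const_mul (-Complex.I)
  · rw [freeBA_apply hy, abs_of_nonneg ht]
    have := hne t ht
    have h1 : (1 + (t : ℂ)) ≠ 0 := by exact_mod_cast (by positivity : (1 + t : ℝ) ≠ 0)
    push_cast
    field_simp

/-- Stability of the Volterra equation with respect to the potential. -/
lemma exists_solBA_lipschitz (B : ℝ) : ∃ K : ℝ, 0 ≤ K ∧ ∀ W W₀ : BA, ‖W‖ ≤ B → ‖W₀‖ ≤ B →
    ‖solBA W - solBA W₀‖ ≤ K * ‖W - W₀‖ := by
  obtain ⟨K, hK, h⟩ := Tmap_bound B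
  obtain ⟨K', hK', h'⟩ := exists_solBA_bound B
  refine ⟨K * (‖Tmap‖ * K'), by positivity, fun W W₀ hW hW₀ => ?_⟩
  have e : solBA W - solBA W₀ = Tmap (W - W₀) (solBA W₀) + Tmap W (solBA W - solBA W₀) := by
    conv_lhs => rw [solBA_eq W, solBA_eq W₀]
    rw [map_sub, map_sub, sub_apply]
    abel
  refine (h W _ _ hW e).trans ?_
  rw [mul_assoc]
  refine mul_le_mul_of_nonneg_left ?_ hK
  calc _ ≤ ‖Tmap‖ * ‖W - W₀‖ * ‖solBA W₀‖ := Tmap.le_opNorm₂ _ _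
    _ ≤ ‖Tmap‖ * ‖W - W₀‖ * K' := by gcongr; exact h' _ hW₀
    _ = _ := by ring

lemma exists_jostC_free_bound : ∃ C : ℝ, 0 ≤ C ∧
    ∀ x₀ ξ₀ : ℝ, (x₀, ξ₀) ∈ Overlap → ∀ p : ℂ × ℂ,
      ‖p.1 - x₀‖ < 1 / 1000 * jap x₀ → ‖p.2 - ξ₀‖ < 1 / 1000 * ξ₀ →
      OffNeg (p.1 * p.2) ∧ ‖jostC p - (1 + Complex.I / (p.1 * p.2))‖ ≤ C * ξ₀ ^ 2 := by
  obtain ⟨K, hK, h⟩ := exists_solBA_lipschitz (128 * ((1 / 8 : ℝ) ^ 2)⁻¹)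
  refine ⟨K * (2 ^ 30), by positivity, fun x₀ ξ₀ hx p h1 h2 => ?_⟩
  have hlow := fun t ht => norm_mul_add_ge (t := t) hx ht h1 h2
  have hoff : OffNeg (p.1 * p.2) := ⟨1 / 16, by norm_num, fun t ht => by linarith [hlow t ht]⟩
  refine ⟨hoff, ?_⟩
  obtain ⟨hx0, hξ, hl, hu, hs⟩ := hx
  simp only at hx0 hξ hl hu hs
  have hj := jap_pos x₀
  have h1' : ‖p.1 - x₀‖ < 1 / 24 * jap x₀ := by linarith
  have h2' : ‖p.2 - ξ₀‖ < 1 / 24 * ξ₀ := by linarith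
  have hx1 : -1 ≤ x₀ := by linarith
  have hL : 1 / 8 ≤ jap x₀ * ξ₀ := by
    have := abs_le_jap x₀
    rw [abs_of_pos hx0] at this
    nlinarith
  have hadm := adm_polydisc hx1 hξ h1' h2'
  have hW := norm_potBA_le hx1 hξ h1' h2' (c := 1 / 8) (by norm_num) (by norm_num) hL
  have hratio : ∀ t : ℝ, (1 + |t|) / ‖p.1 * p.2 + |t|‖ ≤ 16 := fun t => by
    have := hlow |t| (abs_nonneg t)
    have h0 := abs_nonneg t
    rw [div_le_iff₀ (by linarith)]
    linarith
  have hW₀ : ‖freeBA (p.1 * p.2)‖ ≤ 128 * ((1 / 8 : ℝ) ^ 2)⁻¹ := by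
    refine (BoundedContinuousFunction.norm_le (by positivity)).2 fun t => ?_
    rw [freeBA_apply hoff, norm_div, norm_mul, norm_pow, norm_pow, Complex.norm_two,
      Complex.norm_real, Real.norm_of_nonneg (by positivity), mul_div_assoc, ← div_pow]
    calc _ ≤ 2 * (16 : ℝ) ^ 2 := by gcongr; exact hratio t
      _ ≤ _ := by norm_num
  have hζ : ‖p.2‖ ≤ 2 * ξ₀ := by
    have := norm_add_le (p.2 - ξ₀) (ξ₀ : ℂ)
    rw [sub_add_cancel, Complex.norm_real, Real.norm_of_nonneg hξ.le] at this
    linarith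
  have hD : ‖potBA p - freeBA (p.1 * p.2)‖ ≤ 2 ^ 30 * ξ₀ ^ 2 := by
    refine (BoundedContinuousFunction.norm_le (by positivity)).2 fun t => ?_
    have n1 := hoff.ne (abs_nonneg t)
    have n2 := hadm.1.ne (abs_nonneg t)
    have n3 := hadm.2.ne (abs_nonneg t)
    have e : (potBA p - freeBA (p.1 * p.2)) t =
        potBA p t * (-(p.2) ^ 2) / (p.1 * p.2 + |t|) ^ 2 := by
      have e2 : (p.2 * (p.1 + Complex.I) + |t|) * (p.2 * (p.1 - Complex.I) + |t|) =
          (p.1 * p.2 + |t|) ^ 2 + p.2 ^ 2 := by linear_combination -p.2 ^ 2 * Complex.I_sq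
      have n4 : (p.1 * p.2 + |t|) ^ 2 + p.2 ^ 2 ≠ 0 := e2 ▸ mul_ne_zero n2 n3
      rw [BoundedContinuousFunction.sub_apply, potBA_apply hadm, freeBA_apply hoff, e2]
      field_simp
      ring
    rw [e, norm_div, norm_mul, norm_neg, norm_pow, norm_pow, div_eq_mul_inv]
    have a1 := norm_potBA_apply_le hx1 hξ h1' h2' t
    have a2 : ‖potBA p t‖ ≤ 128 * ((1 / 8 : ℝ) ^ 2)⁻¹ :=
      (BoundedContinuousFunction.norm_coe_le_norm _ t).trans hW
    have a3 : (1 / 16 : ℝ) ≤ ‖p.1 * p.2 + |t|‖ := by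
      linarith [hlow |t| (abs_nonneg t), abs_nonneg t]
    calc _ ≤ 128 * ((1 / 8 : ℝ) ^ 2)⁻¹ * (2 * ξ₀) ^ 2 * ((1 / 16 : ℝ) ^ 2)⁻¹ := by gcongr
      _ ≤ _ := by nlinarith [sq_nonneg ξ₀]
  have := h _ _ hW hW₀
  have e : jostC p - (1 + Complex.I / (p.1 * p.2)) =
      (solBA (potBA p) - solBA (freeBA (p.1 * p.2))) 0 := by
    rw [BoundedContinuousFunction.sub_apply, solBA_freeBA hoff]; rfl
  rw [e]
  refine (BoundedContinuousFunction.norm_coe_le_norm _ _).trans (this.trans ?_)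
  rw [mul_assoc]
  exact mul_le_mul_of_nonneg_left hD hK

lemma IsJost.symb_overlap {f : ℝ → ℝ → ℂ} (hf : IsJost f) :
    Symb Overlap (fun _ ξ => ξ ^ 2)
      (fun x ξ => mJost f x ξ - (1 + Complex.I / ((x : ℂ) * ξ))) := by
  obtain ⟨C, hC, h⟩ := exists_jostC_free_bound
  have hsub : Overlap ⊆ {p : ℝ × ℝ | 0 < p.2} := fun p hp => hp.2.1
  refine ⟨ContDiffOn.sub (hf.smooth_m.restrict hsub) ?_, fun n => ?_⟩
  · simp only [div_eq_mul_inv]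
    refine contDiffOn_const.add (contDiffOn_const.mul
      (Smooth2.inv (F := fun x ξ => (x : ℂ) * ξ) ?_ ?_))
    · exact ((Complex.ofRealCLM.contDiff.comp contDiff_fst).mul
        (Complex.ofRealCLM.contDiff.comp contDiff_snd)).contDiffOn
    · exact fun x ξ hx => mul_ne_zero (by exact_mod_cast hx.1.ne') (by exact_mod_cast hx.2.1.ne')
  · refine SymN.of_cauchy isOpen_overlap hsub n
      (G := fun p => jostC p - (1 + Complex.I / (p.1 * p.2)))
      (δ := 1 / 1000) (by norm_num) hC (fun x₀ ξ₀ hx p h1 h2 => ?_) (fun x ξ hx => ?_)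
    · obtain ⟨a1, a2⟩ := h x₀ ξ₀ hx p h1 h2
      refine ⟨?_, a2⟩
      have hj := jap_pos x₀
      have hx0 : 0 < x₀ := hx.1
      have hξ : 0 < ξ₀ := hx.2.1
      refine (jostC_analyticAt (adm_polydisc (by linarith) hξ (by linarith) (by linarith))).sub
        (analyticAt_const.add (analyticAt_const.div (analyticAt_fst.mul analyticAt_snd) ?_))
      simpa using a1.ne le_rfl
    · rw [← hf.eq_jostC hx.2.1]; rfl

/-- The inner region. -/
def InnerR : Set (ℝ × ℝ) := {p | 0 < p.2 ∧ p.2 < 3 / 2 ∧ |p.1| * p.2 < 1 / 2}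

lemma isOpen_inner : IsOpen InnerR :=
  (isOpen_lt continuous_const continuous_snd).inter
    ((isOpen_lt continuous_snd continuous_const).inter
      (isOpen_lt (continuous_fst.abs.mul continuous_snd) continuous_const))

lemma inner_pos : ∀ p ∈ InnerR, 0 < p.2 := fun _ h => h.1

lemma inner_mono {x y ξ : ℝ} (h : (x, ξ) ∈ InnerR) (hy : |y| ≤ |x|) : (y, ξ) ∈ InnerR :=
  ⟨h.1, h.2.1, (mul_le_mul_of_nonneg_right hy h.1.le).trans_lt h.2.2⟩

lemma inner_zero {x ξ : ℝ} (h : (x, ξ) ∈ InnerR) : ((0 : ℝ), ξ) ∈ InnerR :=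
  inner_mono h (by simp)

/-- The quotient of the two zero-energy solutions. -/
def zeroQuot (t : ℝ) : ℝ := (Real.arctan t + t / (1 + t ^ 2)) / 2

lemma hasDerivAt_zeroQuot (t : ℝ) : HasDerivAt zeroQuot (((1 + t ^ 2) ^ 2)⁻¹) t := by
  have h0 : (1 + t ^ 2) ≠ 0 := by positivity
  have h1 : HasDerivAt (fun t : ℝ => 1 + t ^ 2) (2 * t) t := by
    simpa using (hasDerivAt_pow 2 t).const_add 1
  refine (((Real.hasDerivAt_arctan t).add ((hasDerivAt_id t).div h1 h0)).div_const 2).congr_deriv ?_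
  simp only [id]
  field_simp
  ring

lemma abs_zeroQuot_le {t : ℝ} (ht : 0 ≤ t) : |zeroQuot t| ≤ 5 / 4 := by
  have h1 := Real.arctan_lt_pi_div_two t
  have h2 : 0 ≤ Real.arctan t := Real.arctan_nonneg.2 ht
  have h3 : t / (1 + t ^ 2) ≤ 1 / 2 := by
    rw [div_le_iff₀ (by positivity)]
    nlinarith [sq_nonneg (t - 1)]
  have h4 : 0 ≤ t / (1 + t ^ 2) := by positivity
  have h5 := Real.pi_lt_four
  unfold zeroQuot
  rw [abs_of_nonneg (by positivity)]
  linarith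

/-- Perturbation of the zero-energy solutions. -/
lemma inner_core {u v h : ℝ → ℂ} {X ξ A : ℝ} (hξ : 0 < ξ) (hX : 0 ≤ X) (hXξ : X * ξ ≤ 1 / 2)
    (hA : 0 ≤ A)
    (hu : ∀ t ∈ Set.Icc 0 X, HasDerivAt u (v t) t)
    (hv : ∀ t ∈ Set.Icc 0 X, HasDerivAt v
      ((((2 / (1 + t ^ 2) : ℝ) : ℂ) - (ξ : ℂ) ^ 2) * u t + h t) t)
    (hh : ∀ t ∈ Set.Icc 0 X, ‖h t‖ ≤ A * ξ ^ 2 * (1 + t ^ 2)) :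
    ∃ M : ℝ, 0 ≤ M ∧ M ≤ 2 * (‖u 0‖ + ‖v 0‖ + A) ∧
      (∀ t ∈ Set.Icc 0 X, ‖u t‖ ≤ M * (1 + t ^ 2)) ∧
      (∀ t ∈ Set.Icc 0 X, ‖((1 + t ^ 2 : ℝ) : ℂ) * v t - 2 * t * u t - v 0‖ ≤
        t * ξ ^ 2 * (1 + t ^ 2) ^ 2 * (M + A)) ∧
      (∀ t ∈ Set.Icc 0 X, ‖u t / ((1 + t ^ 2 : ℝ) : ℂ) - u 0 - zeroQuot t * v 0‖ ≤
        t ^ 2 * ξ ^ 2 * (M + A)) := by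
  have hc0 : ∀ t : ℝ, ((1 + t ^ 2 : ℝ) : ℂ) ≠ 0 := fun t => by
    exact_mod_cast (by positivity : (1 + t ^ 2 : ℝ) ≠ 0)
  have hcd : ∀ t : ℝ, HasDerivAt (fun t : ℝ => ((1 + t ^ 2 : ℝ) : ℂ)) ((2 * t : ℝ) : ℂ) t :=
    fun t => by
    have h1 : HasDerivAt (fun t : ℝ => 1 + t ^ 2) (2 * t) t := by
      simpa using (hasDerivAt_pow 2 t).const_add 1
    exact h1.ofReal_comp
  set g : ℝ → ℂ := fun t => u t / ((1 + t ^ 2 : ℝ) : ℂ) with hg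
  set k : ℝ → ℂ := fun t => ((1 + t ^ 2 : ℝ) : ℂ) * v t - ((2 * t : ℝ) : ℂ) * u t with hk
  have hgd : ∀ t ∈ Set.Icc 0 X, HasDerivAt g (k t / ((1 + t ^ 2 : ℝ) : ℂ) ^ 2) t := by
    intro t ht
    refine ((hu t ht).fun_div (hcd t) (hc0 t)).congr_deriv ?_
    simp only [hk]
    ring
  have hkd : ∀ t ∈ Set.Icc 0 X, HasDerivAt k
      (((1 + t ^ 2 : ℝ) : ℂ) * (-(ξ : ℂ) ^ 2 * u t + h t)) t := by
    intro t ht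
    have h1 : HasDerivAt (fun t : ℝ => ((2 * t : ℝ) : ℂ)) (2 : ℂ) t := by
      simpa using ((hasDerivAt_id t).const_mul (2 : ℝ)).ofReal_comp
    refine (((hcd t).fun_mul (hv t ht)).fun_sub (h1.fun_mul (hu t ht))).congr_deriv ?_
    have := hc0 t
    push_cast at this ⊢
    field_simp
    ring
  have hgc : ContinuousOn g (Set.Icc 0 X) := fun t ht =>
    (hgd t ht).continuousAt.continuousWithinAt
  obtain ⟨t₀, ht₀, hmax⟩ := isCompact_Icc.exists_isMaxOn (Set.nonempty_Icc.2 hX) hgc.norm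
  set M := ‖g t₀‖ with hM
  have hgM : ∀ t ∈ Set.Icc 0 X, ‖g t‖ ≤ M := fun t ht => hmax ht
  have hM0 : 0 ≤ M := norm_nonneg _
  have hcn : ∀ t : ℝ, ‖((1 + t ^ 2 : ℝ) : ℂ)‖ = 1 + t ^ 2 := fun t => by
    rw [Complex.norm_real, Real.norm_of_nonneg (by positivity)]
  have huM : ∀ t ∈ Set.Icc 0 X, ‖u t‖ ≤ M * (1 + t ^ 2) := by
    intro t ht
    have := hgM t ht
    rw [hg, norm_div, hcn, div_le_iff₀ (by positivity)] at this
    exact this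
  have h0 : (0 : ℝ) ∈ Set.Icc 0 X := ⟨le_rfl, hX⟩
  have hk0 : k 0 = v 0 := by simp [hk]
  have hkb : ∀ t ∈ Set.Icc 0 X, ‖k t - v 0‖ ≤ t * ξ ^ 2 * (1 + t ^ 2) ^ 2 * (M + A) := by
    intro t ht
    have := norm_image_sub_le_of_norm_deriv_le_segment' (f := k)
      (f' := fun s => ((1 + s ^ 2 : ℝ) : ℂ) * (-(ξ : ℂ) ^ 2 * u s + h s)) (a := 0) (b := t)
      (C := ξ ^ 2 * (1 + t ^ 2) ^ 2 * (M + A))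
      (fun s hs => (hkd s ⟨hs.1, hs.2.trans ht.2⟩).hasDerivWithinAt) (fun s hs => ?_) t
      ⟨ht.1, le_rfl⟩
    · rw [hk0] at this
      refine this.trans (le_of_eq ?_)
      ring
    · have hs' : s ∈ Set.Icc 0 X := ⟨hs.1, hs.2.le.trans ht.2⟩
      rw [norm_mul, hcn]
      have hst : s ^ 2 ≤ t ^ 2 := pow_le_pow_left₀ hs.1 hs.2.le 2
      calc _ ≤ (1 + s ^ 2) * (ξ ^ 2 * (M * (1 + s ^ 2)) + A * ξ ^ 2 * (1 + s ^ 2)) := by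
            gcongr
            refine (norm_add_le _ _).trans ?_
            rw [norm_mul, norm_neg, norm_pow, Complex.norm_real, Real.norm_of_nonneg hξ.le]
            gcongr
            · exact huM s hs'
            · exact hh s hs'
        _ = ξ ^ 2 * (1 + s ^ 2) ^ 2 * (M + A) := by ring
        _ ≤ _ := by gcongr
  have hEb : ∀ t ∈ Set.Icc 0 X, ‖g t - u 0 - zeroQuot t * v 0‖ ≤ t ^ 2 * ξ ^ 2 * (M + A) := by
    intro t ht
    have hE : ∀ s ∈ Set.Icc 0 t, HasDerivAt (fun s => g s - u 0 - zeroQuot s * v 0)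
        ((k s - v 0) / ((1 + s ^ 2 : ℝ) : ℂ) ^ 2) s := by
      intro s hs
      refine (((hgd s ⟨hs.1, hs.2.trans ht.2⟩).sub_const (u 0)).fun_sub
        (((hasDerivAt_zeroQuot s).ofReal_comp).mul_const (v 0))).congr_deriv ?_
      have := hc0 s
      push_cast at this ⊢
      field_simp
    have := norm_image_sub_le_of_norm_deriv_le_segment' (f := fun s => g s - u 0 - zeroQuot s * v 0)
      (a := 0) (b := t) (C := t * ξ ^ 2 * (M + A))
      (fun s hs => (hE s hs).hasDerivWithinAt) (fun s hs => ?_) t ⟨ht.1, le_rfl⟩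
    · have e : g 0 - u 0 - zeroQuot 0 * v 0 = 0 := by simp [hg, zeroQuot]
      rw [e, sub_zero] at this
      refine this.trans (le_of_eq ?_)
      ring
    · rw [norm_div, norm_pow, hcn, div_le_iff₀ (by positivity)]
      have h2 := hkb s ⟨hs.1, hs.2.le.trans ht.2⟩
      have h3 : s ≤ t := hs.2.le
      calc _ ≤ _ := h2
        _ ≤ t * ξ ^ 2 * (1 + s ^ 2) ^ 2 * (M + A) := by gcongr
        _ = _ := by ring
  refine ⟨M, hM0, ?_, huM, fun t ht => ?_, hEb⟩
  · have h1 := hEb t₀ ht₀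
    have h2 := abs_zeroQuot_le ht₀.1
    have h3 : t₀ ^ 2 * ξ ^ 2 ≤ 1 / 4 := by
      have : t₀ * ξ ≤ 1 / 2 := (mul_le_mul_of_nonneg_right ht₀.2 hξ.le).trans hXξ
      have h4 : 0 ≤ t₀ * ξ := mul_nonneg ht₀.1 hξ.le
      nlinarith
    have h4 : ‖g t₀‖ ≤ ‖g t₀ - u 0 - zeroQuot t₀ * v 0‖ + ‖u 0‖ + |zeroQuot t₀| * ‖v 0‖ := by
      have := norm_add₃_le (a := g t₀ - u 0 - zeroQuot t₀ * v 0) (b := u 0)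
        (c := zeroQuot t₀ * v 0)
      rw [norm_mul, Complex.norm_real, Real.norm_eq_abs] at this
      have e : g t₀ - u 0 - zeroQuot t₀ * v 0 + u 0 + zeroQuot t₀ * v 0 = g t₀ := by ring
      rwa [e] at this
    have h5 : t₀ ^ 2 * ξ ^ 2 * (M + A) ≤ 1 / 4 * (M + A) := by gcongr
    have h6 : |zeroQuot t₀| * ‖v 0‖ ≤ 5 / 4 * ‖v 0‖ := by gcongr
    have := norm_nonneg (u 0)
    have := norm_nonneg (v 0)
    linarith
  · have := hkb t ht
    simp only [hk] at this
    push_cast at this ⊢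
    exact this

lemma inner_bound_pos {u v h : ℝ → ℂ} {X ξ A : ℝ} (hξ : 0 < ξ) (hξ1 : ξ < 3 / 2) (hX : 0 ≤ X)
    (hXξ : X * ξ ≤ 1 / 2) (hA : 0 ≤ A)
    (hu : ∀ t ∈ Set.Icc 0 X, HasDerivAt u (v t) t)
    (hv : ∀ t ∈ Set.Icc 0 X, HasDerivAt v
      ((((2 / (1 + t ^ 2) : ℝ) : ℂ) - (ξ : ℂ) ^ 2) * u t + h t) t)
    (hh : ∀ t ∈ Set.Icc 0 X, ‖h t‖ ≤ A * ξ ^ 2 * (1 + t ^ 2)) :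
    ‖u X‖ ≤ 20 * (‖u 0‖ + ‖v 0‖ + A) * jap X ^ 2 ∧ ‖v X‖ ≤ 20 * (‖u 0‖ + ‖v 0‖ + A) * jap X := by
  obtain ⟨M, hM0, hM, huM, hkM, -⟩ := inner_core hξ hX hXξ hA hu hv hh
  have hXm : X ∈ Set.Icc 0 X := ⟨hX, le_rfl⟩
  set N := ‖u 0‖ + ‖v 0‖ + A
  have hu0 := norm_nonneg (u 0)
  have hN : 0 ≤ N := by positivity
  have hv0 : ‖v 0‖ ≤ N := by simp only [N]; linarith
  have hAN : A ≤ N := by simp only [N]; linarith [norm_nonneg (v 0)]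
  have h1 := huM X hXm
  have h2 := hkM X hXm
  refine ⟨?_, ?_⟩
  · rw [jap_sq]
    refine h1.trans ?_
    gcongr
    linarith
  · have h3 : ‖((1 + X ^ 2 : ℝ) : ℂ) * v X‖ ≤
        X * ξ ^ 2 * (1 + X ^ 2) ^ 2 * (M + A) + 2 * X * ‖u X‖ + ‖v 0‖ := by
      have e : ((1 + X ^ 2 : ℝ) : ℂ) * v X =
        (((1 + X ^ 2 : ℝ) : ℂ) * v X - 2 * X * u X - v 0) + 2 * X * u X + v 0 := by ring
      rw [e]
      refine (norm_add₃_le).trans ?_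
      rw [norm_mul (2 * (X : ℂ)), norm_mul, Complex.norm_two, Complex.norm_real,
        Real.norm_of_nonneg hX]
      gcongr
    rw [norm_mul, Complex.norm_real, Real.norm_of_nonneg (by positivity)] at h3
    have hξX : ξ ^ 2 * (1 + X ^ 2) ≤ 5 / 2 := by
      have : (X * ξ) ^ 2 ≤ (1 / 2) ^ 2 := pow_le_pow_left₀ (by positivity) hXξ 2
      nlinarith
    have hpos : 0 < 1 + X ^ 2 := by positivity
    have h4 : X * ξ ^ 2 * (1 + X ^ 2) ^ 2 * (M + A) ≤ (1 + X ^ 2) * (X * (15 / 2 * N)) := by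
      calc X * ξ ^ 2 * (1 + X ^ 2) ^ 2 * (M + A) =
            (1 + X ^ 2) * (X * ((ξ ^ 2 * (1 + X ^ 2)) * (M + A))) := by ring
        _ ≤ (1 + X ^ 2) * (X * ((5 / 2) * (2 * N + N))) := by gcongr
        _ = _ := by ring
    have h5 : 2 * X * ‖u X‖ ≤ (1 + X ^ 2) * (X * (4 * N)) := by
      calc 2 * X * ‖u X‖ ≤ 2 * X * (2 * N * (1 + X ^ 2)) := by
            have : ‖u X‖ ≤ 2 * N * (1 + X ^ 2) := h1.trans (by gcongr)
            gcongr
        _ = _ := by ring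
    have h6 : ‖v 0‖ ≤ (1 + X ^ 2) * N := by nlinarith
    have h7 : (1 + X ^ 2) * ‖v X‖ ≤ (1 + X ^ 2) * (X * (23 / 2 * N) + N) := by linarith
    have h8 := le_of_mul_le_mul_left h7 hpos
    have h9 := abs_le_jap X
    rw [abs_of_nonneg hX] at h9
    have h10 := one_le_jap X
    nlinarith

lemma inner_bound {u v h : ℝ → ℂ} {x ξ A : ℝ} (hx : (x, ξ) ∈ InnerR) (hA : 0 ≤ A)
    (hu : ∀ t, |t| ≤ |x| → HasDerivAt u (v t) t)
    (hv : ∀ t, |t| ≤ |x| → HasDerivAt v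
      ((((2 / (1 + t ^ 2) : ℝ) : ℂ) - (ξ : ℂ) ^ 2) * u t + h t) t)
    (hh : ∀ t, |t| ≤ |x| → ‖h t‖ ≤ A * ξ ^ 2 * (1 + t ^ 2)) :
    ‖u x‖ ≤ 20 * (‖u 0‖ + ‖v 0‖ + A) * jap x ^ 2 ∧ ‖v x‖ ≤ 20 * (‖u 0‖ + ‖v 0‖ + A) * jap x := by
  obtain ⟨h1, h2, h3⟩ := hx
  rcases le_total 0 x with h0 | h0
  · rw [abs_of_nonneg h0] at hu hv hh h3
    have hI : ∀ t ∈ Set.Icc 0 x, |t| ≤ x := fun t ht => (abs_of_nonneg ht.1).trans_le ht.2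
    exact inner_bound_pos h1 h2 h0 h3.le hA (fun t ht => hu t (hI t ht))
      (fun t ht => hv t (hI t ht)) (fun t ht => hh t (hI t ht))
  · rw [abs_of_nonpos h0] at hu hv hh h3
    have hI : ∀ t ∈ Set.Icc 0 (-x), |-t| ≤ -x := fun t ht => by
      rw [abs_neg, abs_of_nonneg ht.1]; exact ht.2
    have := inner_bound_pos (u := fun t => u (-t)) (v := fun t => - v (-t)) (h := fun t => h (-t))
      h1 h2 (neg_nonneg.2 h0) h3.le hA (fun t ht => ?_) (fun t ht => ?_) (fun t ht => ?_)
    · simpa [jap_neg] using this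
    · exact ((hu (-t) (hI t ht)).scomp t (hasDerivAt_neg t)).congr_deriv (by simp)
    · refine ((hv (-t) (hI t ht)).scomp t (hasDerivAt_neg t)).neg.congr_deriv ?_
      simp [add_comm]
    · simpa using hh (-t) (hI t ht)

/-- Pointwise bounds for solutions in the inner region. -/
lemma WBdd.of_ode {u h : ℝ → ℝ → ℂ} {ρ : ℝ → ℝ} (su : Smooth2 InnerR u)
    (hρ : ∀ ξ, 0 < ξ → 0 ≤ ρ ξ)
    (ode : ∀ x ξ : ℝ, (x, ξ) ∈ InnerR → PDX (PDX u) x ξ =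
      (((2 / (1 + x ^ 2) : ℝ) : ℂ) - (ξ : ℂ) ^ 2) * u x ξ + h x ξ)
    (hh : WBdd InnerR (fun x ξ => ξ ^ 2 * ρ ξ * jap x ^ 2) h)
    (h0 : WBdd InnerR (fun _ ξ => ρ ξ) (fun _ ξ => u 0 ξ))
    (h1 : WBdd InnerR (fun _ ξ => ρ ξ) (fun _ ξ => PDX u 0 ξ)) :
    WBdd InnerR (fun x ξ => ρ ξ * jap x ^ 2) u ∧
      WBdd InnerR (fun x ξ => ρ ξ * jap x) (PDX u) := by
  have hU := isOpen_inner
  have sx := su.pdx hU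
  obtain ⟨A, hA, bh⟩ := hh
  obtain ⟨B, hB, b0⟩ := h0
  obtain ⟨D, hD, b1⟩ := h1
  have main : ∀ x ξ, (x, ξ) ∈ InnerR →
      ‖u x ξ‖ ≤ 20 * (‖u 0 ξ‖ + ‖PDX u 0 ξ‖ + A * ρ ξ) * jap x ^ 2 ∧
      ‖PDX u x ξ‖ ≤ 20 * (‖u 0 ξ‖ + ‖PDX u 0 ξ‖ + A * ρ ξ) * jap x := by
    intro x ξ hx
    have hr := hρ ξ hx.1
    refine inner_bound (u := fun t => u t ξ) (v := fun t => PDX u t ξ) (h := fun t => h t ξ) hx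
      (by positivity) (fun t ht => su.hasDerivAt_left hU (inner_mono hx ht)) (fun t ht => ?_)
      (fun t ht => ?_)
    · rw [← ode t ξ (inner_mono hx ht)]
      exact sx.hasDerivAt_left hU (inner_mono hx ht)
    · refine (bh t ξ (inner_mono hx ht)).trans (le_of_eq ?_)
      simp only [jap_sq]; ring
  have hsum : ∀ x ξ, (x, ξ) ∈ InnerR →
      20 * (‖u 0 ξ‖ + ‖PDX u 0 ξ‖ + A * ρ ξ) ≤ 20 * (B + D + A) * ρ ξ := by
    intro x ξ hx
    have := b0 x ξ hx
    have := b1 x ξ hx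
    simp only at *
    linarith
  refine ⟨⟨20 * (B + D + A), by positivity, fun x ξ hx => (main x ξ hx).1.trans ?_⟩,
    ⟨20 * (B + D + A), by positivity, fun x ξ hx => (main x ξ hx).2.trans ?_⟩⟩
  · rw [← mul_assoc]
    exact mul_le_mul_of_nonneg_right (hsum x ξ hx) (sq_nonneg _)
  · rw [← mul_assoc]
    exact mul_le_mul_of_nonneg_right (hsum x ξ hx) (jap_pos x).le

/-- Symbol estimates for solutions in the inner region. -/
lemma SymN.of_ode (n : ℕ) {u h : ℝ → ℝ → ℂ} {ρ : ℝ → ℝ} (su : Smooth2 InnerR u)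
    (sh : Smooth2 InnerR h) (hρ : ∀ ξ, 0 < ξ → 0 ≤ ρ ξ)
    (ode : ∀ x ξ : ℝ, (x, ξ) ∈ InnerR → PDX (PDX u) x ξ =
      (((2 / (1 + x ^ 2) : ℝ) : ℂ) - (ξ : ℂ) ^ 2) * u x ξ + h x ξ)
    (hh : SymN InnerR n (fun x ξ => ξ ^ 2 * ρ ξ * jap x ^ 2) h)
    (h0 : SymN InnerR n (fun _ ξ => ρ ξ) (fun _ ξ => u 0 ξ))
    (h1 : SymN InnerR n (fun _ ξ => ρ ξ) (fun _ ξ => PDX u 0 ξ)) :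
    SymN InnerR n (fun x ξ => ρ ξ * jap x ^ 2) u ∧ SymN InnerR n (fun x ξ => ρ ξ * jap x) (PDX u) := by
  have hU := isOpen_inner
  induction n generalizing u h ρ with
  | zero => exact WBdd.of_ode su hρ ode hh h0 h1
  | succ n ih =>
    have hne : ∀ p ∈ InnerR, p.2 ≠ 0 := fun p hp => hp.1.ne'
    have sx := su.pdx hU
    obtain ⟨iu, ix⟩ := ih su sh hρ ode hh.pred h0.pred h1.pred
    have sxi := su.pdxi hU
    have scomm : ∀ x ξ, (x, ξ) ∈ InnerR → PDX (PDXI u) x ξ = PDXI (PDX u) x ξ :=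
      fun x ξ hx => su.comm hU hx
    have sξ : Smooth2 InnerR (fun _ ξ => (ξ : ℂ)) := (symb_right hne).1
    have sh1 : Smooth2 InnerR (fun x ξ => PDXI h x ξ + (-2) * ((ξ : ℂ) * u x ξ)) :=
      (sh.pdxi hU).add ((Smooth2.const (-2)).mul (sξ.mul su))
    have hh1 : SymN InnerR n (fun x ξ => ξ ^ 2 * (ρ ξ / |ξ|) * jap x ^ 2)
        (fun x ξ => PDXI h x ξ + (-2) * ((ξ : ℂ) * u x ξ)) := by
      refine SymN.add hU (sh.pdxi hU) ((Smooth2.const (-2)).mul (sξ.mul su))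
        (hh.2.2.weight_eq fun x ξ hx => by ring) ?_
      refine SymN.const_mul hU _ (sξ.mul su) ((SymN.mul hU sξ su ((symb_right hne).2 n) iu).weight_eq
        fun x ξ hx => ?_)
      have hξ : 0 < ξ := hx.1
      rw [abs_of_pos hξ]
      field_simp
    have ode1 : ∀ x ξ : ℝ, (x, ξ) ∈ InnerR → PDX (PDX (PDXI u)) x ξ =
        (((2 / (1 + x ^ 2) : ℝ) : ℂ) - (ξ : ℂ) ^ 2) * PDXI u x ξ +
          (PDXI h x ξ + (-2) * ((ξ : ℂ) * u x ξ)) := by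
      intro x ξ hx
      rw [PDX_congr hU scomm hx, sx.comm hU hx, PDXI_congr hU ode hx]
      have d1 : HasDerivAt (fun η : ℝ => ((2 / (1 + x ^ 2) : ℝ) : ℂ) - (η : ℂ) ^ 2)
          (-(2 * ξ)) ξ := by
        have := (Complex.ofRealCLM.hasDerivAt (x := ξ)).fun_pow 2
        exact (this.const_sub _).congr_deriv (by simp)
      refine ((d1.fun_mul (su.hasDerivAt_right hU hx)).fun_add (sh.hasDerivAt_right hU hx)).deriv.trans ?_
      ring
    have h11 : SymN InnerR n (fun _ ξ => ρ ξ / |ξ|) (fun _ ξ => PDX (PDXI u) 0 ξ) :=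
      SymN.congr hU h1.2.2 fun x ξ hx => (scomm 0 ξ (inner_zero hx)).symm
    obtain ⟨ju, jx⟩ := ih (ρ := fun ξ => ρ ξ / |ξ|) sxi sh1
      (fun ξ hξ => div_nonneg (hρ ξ hξ) (abs_nonneg ξ)) ode1 hh1 h0.2.2 h11
    obtain ⟨bu, bx⟩ := WBdd.of_ode su hρ ode hh.bdd h0.bdd h1.bdd
    refine ⟨⟨bu, ix.weight_eq fun x ξ _ => ?_, ju.weight_eq fun x ξ _ => by ring⟩,
      ⟨bx, ?_, (jx.congr hU scomm).weight_eq fun x ξ _ => by ring⟩⟩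
    · have := (jap_pos x).ne'
      field_simp
    · have hj : ∀ x ξ, (x, ξ) ∈ InnerR → ξ ^ 2 * jap x ^ 2 ≤ 5 / 2 := by
        intro x ξ hx
        obtain ⟨a1, a2, a3⟩ := hx
        simp only at a1 a2 a3
        have : (|x| * ξ) ^ 2 ≤ (1 / 2) ^ 2 := pow_le_pow_left₀ (by positivity) a3.le 2
        rw [mul_pow, sq_abs] at this
        rw [jap_sq]
        nlinarith
      have hr : ∀ x ξ, (x, ξ) ∈ InnerR → ξ ^ 2 * ρ ξ * jap x ^ 2 ≤ 5 / 2 * (ρ ξ * jap x / jap x) := by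
        intro x ξ hx
        rw [mul_div_assoc, div_self (jap_pos x).ne', mul_one]
        calc _ = (ξ ^ 2 * jap x ^ 2) * ρ ξ := by ring
          _ ≤ _ := mul_le_mul_of_nonneg_right (hj x ξ hx) (hρ ξ hx.1)
      have sV := symb_inv_one_add_sq hU
      have s2 := sξ.mul (sξ.mul su)
      have sVu := (sV.1.mul su)
      refine SymN.congr hU (F := fun x ξ => (2 * (((1 + x ^ 2 : ℝ) : ℂ)⁻¹ * u x ξ) +
        (-1) * ((ξ : ℂ) * ((ξ : ℂ) * u x ξ))) + h x ξ) ?_ fun x ξ hx => ?_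
      · refine SymN.add hU (((Smooth2.const 2).mul sVu).add ((Smooth2.const (-1)).mul s2)) sh
          (SymN.add hU ((Smooth2.const 2).mul sVu) ((Smooth2.const (-1)).mul s2) ?_ ?_) ?_
        · refine SymN.const_mul hU _ sVu ((SymN.mul hU sV.1 su (sV.2 n) iu).weight_eq
            fun x ξ hx => ?_)
          have := (jap_pos x).ne'
          field_simp
        · refine SymN.const_mul hU _ s2 ((SymN.mul hU sξ (sξ.mul su) ((symb_right hne).2 n)
            (SymN.mul hU sξ su ((symb_right hne).2 n) iu)).mono (K := 5 / 2) (by norm_num)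
            fun x ξ hx => le_trans (le_of_eq ?_) (hr x ξ hx))
          have hξ : 0 < ξ := hx.1
          rw [abs_of_pos hξ]
          ring
        · exact hh.pred.mono (K := 5 / 2) (by norm_num) hr
      · rw [ode x ξ hx]
        push_cast
        ring

/-- Symbol estimates for primitives in the inner region. -/
lemma SymN.primitive (n : ℕ) {P : ℝ → ℝ → ℂ} {w : ℝ → ℝ} (sP : Smooth2 InnerR P)
    (h0 : ∀ ξ, 0 < ξ → P 0 ξ = 0) (h : SymN InnerR n (fun _ ξ => w ξ) (PDX P)) :
    SymN InnerR n (fun x ξ => jap x * w ξ) P := by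
  have hU := isOpen_inner
  have key : ∀ {P : ℝ → ℝ → ℂ} {w : ℝ → ℝ}, Smooth2 InnerR P → (∀ ξ, 0 < ξ → P 0 ξ = 0) →
      WBdd InnerR (fun _ ξ => w ξ) (PDX P) → WBdd InnerR (fun x ξ => jap x * w ξ) P := by
    rintro P w sP h0 ⟨C, hC, h⟩
    refine ⟨C, hC, fun x ξ hx => ?_⟩
    have hb := Convex.norm_image_sub_le_of_norm_hasDerivWithin_le (f := fun t => P t ξ)
      (f' := fun t => PDX P t ξ) (s := Set.Icc (-|x|) |x|) (C := C * w ξ)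
      (fun t ht => (sP.hasDerivAt_left hU (inner_mono hx (abs_le.2 ht))).hasDerivWithinAt)
      (fun t ht => h t ξ (inner_mono hx (abs_le.2 ht))) (convex_Icc _ _)
      (x := 0) (y := x) (abs_le.1 (by simp)) (abs_le.1 le_rfl)
    simp only [h0 ξ hx.1, sub_zero, Real.norm_eq_abs] at hb
    have hw : 0 ≤ C * w ξ := (norm_nonneg _).trans (h x ξ hx)
    refine hb.trans ?_
    calc _ ≤ C * w ξ * jap x := mul_le_mul_of_nonneg_left (abs_le_jap x) hw
      _ = _ := by ring
  induction n generalizing P w with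
  | zero => exact key sP h0 h
  | succ n ih =>
    refine ⟨key sP h0 h.1, h.pred.weight_eq fun x ξ _ => ?_, ?_⟩
    · have := (jap_pos x).ne'
      field_simp
    · refine (ih (P := PDXI P) (w := fun ξ => w ξ / |ξ|) (sP.pdxi hU) (fun ξ hξ => ?_)
        (SymN.congr hU h.2.2 fun x ξ hx => (sP.comm hU hx).symm)).weight_eq fun x ξ _ => by ring
      refine (Filter.EventuallyEq.deriv_eq (f := fun _ => (0 : ℂ)) ?_).trans (deriv_const _ _)
      exact (lt_mem_nhds hξ).mono fun η hη => h0 η hη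

/-- The upper half-plane of positive frequencies. -/
def Upper : Set (ℝ × ℝ) := {p | 0 < p.2}

lemma upper_open : IsOpen Upper := isOpen_upper

lemma hasDerivAt_conj {u : ℝ → ℂ} {d : ℂ} {x : ℝ} (h : HasDerivAt u d x) :
    HasDerivAt (fun t => (starRingEnd ℂ) (u t)) ((starRingEnd ℂ) d) x :=
  Complex.conjCLE.toContinuousLinearMap.hasFDerivAt.comp_hasDerivAt x h

lemma Smooth2.conj {U : Set (ℝ × ℝ)} {F : ℝ → ℝ → ℂ} (hF : Smooth2 U F) :
    Smooth2 U (fun x ξ => (starRingEnd ℂ) (F x ξ)) :=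
  Complex.conjCLE.toContinuousLinearMap.contDiff.comp_contDiffOn hF

lemma Smooth2.at_zero {F : ℝ → ℝ → ℂ} (hF : Smooth2 Upper F) :
    Smooth2 Upper (fun _ ξ => F 0 ξ) :=
  ContDiffOn.comp (g := fun p : ℝ × ℝ => F p.1 p.2) hF (f := fun p : ℝ × ℝ => ((0 : ℝ), p.2))
    (by fun_prop) (fun p hp => hp)

lemma Smooth2.reflect {F : ℝ → ℝ → ℂ} (hF : Smooth2 Upper F) :
    Smooth2 Upper (fun x ξ => F (-x) ξ) :=
  ContDiffOn.comp (g := fun p : ℝ × ℝ => F p.1 p.2) hF (f := fun p : ℝ × ℝ => (-p.1, p.2))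
    (by fun_prop) (fun p hp => hp)

/-- Smooth families of solutions of the stationary equation. -/
structure IsSol (u : ℝ → ℝ → ℂ) : Prop where
  smooth : Smooth2 Upper u
  ode : ∀ ξ : ℝ, 0 < ξ → ∀ x : ℝ,
    PDX (PDX u) x ξ = (((2 / (1 + x ^ 2) : ℝ) : ℂ) - (ξ : ℂ) ^ 2) * u x ξ

section scattering

variable {f u v : ℝ → ℝ → ℂ} {ξ : ℝ}

lemma IsJost.isSol (hf : IsJost f) : IsSol f := ⟨hf.smooth, hf.ode⟩

lemma IsSol.hasDerivAt (hu : IsSol u) (hξ : 0 < ξ) (x : ℝ) :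
    HasDerivAt (fun t => u t ξ) (PDX u x ξ) x := hu.smooth.hasDerivAt_left upper_open hξ

lemma IsSol.hasDerivAt' (hu : IsSol u) (hξ : 0 < ξ) (x : ℝ) :
    HasDerivAt (fun t => PDX u t ξ)
      ((((2 / (1 + x ^ 2) : ℝ) : ℂ) - (ξ : ℂ) ^ 2) * u x ξ) x := by
  rw [← hu.ode ξ hξ x]
  exact (hu.smooth.pdx upper_open).hasDerivAt_left upper_open hξ

lemma IsSol.of_hasDerivAt {u' : ℝ → ℝ → ℂ} (hs : Smooth2 Upper u)
    (h1 : ∀ ξ : ℝ, 0 < ξ → ∀ x : ℝ, HasDerivAt (fun t => u t ξ) (u' x ξ) x)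
    (h2 : ∀ ξ : ℝ, 0 < ξ → ∀ x : ℝ, HasDerivAt (fun t => u' t ξ)
      ((((2 / (1 + x ^ 2) : ℝ) : ℂ) - (ξ : ℂ) ^ 2) * u x ξ) x) : IsSol u := by
  refine ⟨hs, fun ξ hξ x => ?_⟩
  rw [PDX_congr upper_open (F := PDX u) (G := u') (fun y η hη => (h1 η hη y).deriv) (show (x, ξ) ∈ Upper from hξ)]
  exact (h2 ξ hξ x).deriv

lemma IsSol.pdx_lin {a b : ℝ → ℂ} (hu : IsSol u) (hv : IsSol v) (hξ : 0 < ξ) (x : ℝ) :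
    PDX (fun x ξ => a ξ * u x ξ + b ξ * v x ξ) x ξ = a ξ * PDX u x ξ + b ξ * PDX v x ξ :=
  (((hu.hasDerivAt hξ x).const_mul _).fun_add ((hv.hasDerivAt hξ x).const_mul _)).deriv

lemma IsSol.lin {a b : ℝ → ℂ} (hu : IsSol u) (hv : IsSol v)
    (ha : Smooth2 Upper (fun _ ξ => a ξ)) (hb : Smooth2 Upper (fun _ ξ => b ξ)) :
    IsSol (fun x ξ => a ξ * u x ξ + b ξ * v x ξ) := by
  refine IsSol.of_hasDerivAt ((ha.mul hu.smooth).add (hb.mul hv.smooth))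
    (fun ξ hξ x => ((hu.hasDerivAt hξ x).const_mul _).fun_add ((hv.hasDerivAt hξ x).const_mul _))
    (fun ξ hξ x => (((hu.hasDerivAt' hξ x).const_mul _).fun_add
      ((hv.hasDerivAt' hξ x).const_mul _)).congr_deriv (by ring))

lemma IsSol.pdx_conj (hu : IsSol u) (hξ : 0 < ξ) (x : ℝ) :
    PDX (fun x ξ => (starRingEnd ℂ) (u x ξ)) x ξ = (starRingEnd ℂ) (PDX u x ξ) :=
  (hasDerivAt_conj (hu.hasDerivAt hξ x)).deriv

lemma IsSol.conj (hu : IsSol u) : IsSol (fun x ξ => (starRingEnd ℂ) (u x ξ)) :=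
  IsSol.of_hasDerivAt hu.smooth.conj (fun ξ hξ x => hasDerivAt_conj (hu.hasDerivAt hξ x))
    (fun ξ hξ x => (hasDerivAt_conj (hu.hasDerivAt' hξ x)).congr_deriv (by
      simp only [map_mul, map_sub, map_pow, Complex.conj_ofReal]))

lemma hasDerivAt_comp_neg {u : ℝ → ℂ} {d : ℂ} {x : ℝ} (h : HasDerivAt u d (-x)) :
    HasDerivAt (fun t => u (-t)) (-d) x :=
  (h.scomp x (hasDerivAt_neg x)).congr_deriv (by simp)

lemma IsSol.pdx_reflect (hu : IsSol u) (hξ : 0 < ξ) (x : ℝ) :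
    PDX (fun x ξ => u (-x) ξ) x ξ = - PDX u (-x) ξ :=
  (hasDerivAt_comp_neg (hu.hasDerivAt hξ (-x))).deriv

lemma IsSol.reflect (hu : IsSol u) : IsSol (fun x ξ => u (-x) ξ) :=
  IsSol.of_hasDerivAt hu.smooth.reflect
    (fun ξ hξ x => hasDerivAt_comp_neg (hu.hasDerivAt hξ (-x)))
    (fun ξ hξ x => (hasDerivAt_comp_neg (hu.hasDerivAt' hξ (-x))).neg.congr_deriv (by
      rw [neg_neg, neg_sq]))

lemma IsSol.wronskian_const (hu : IsSol u) (hv : IsSol v) (hξ : 0 < ξ) (x y : ℝ) :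
    u x ξ * PDX v x ξ - PDX u x ξ * v x ξ = u y ξ * PDX v y ξ - PDX u y ξ * v y ξ := by
  have h : ∀ t, HasDerivAt (fun t => u t ξ * PDX v t ξ - PDX u t ξ * v t ξ) 0 t := fun t =>
    (((hu.hasDerivAt hξ t).fun_mul (hv.hasDerivAt' hξ t)).fun_sub
      ((hu.hasDerivAt' hξ t).fun_mul (hv.hasDerivAt hξ t))).congr_deriv (by ring)
  exact is_const_of_deriv_eq_zero (fun t => (h t).differentiableAt) (fun t => (h t).deriv) x y

lemma IsJost.wronskian_conj (hf : IsJost f) (hξ : 0 < ξ) (x : ℝ) :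
    f x ξ * (starRingEnd ℂ) (PDX f x ξ) - PDX f x ξ * (starRingEnd ℂ) (f x ξ) =
      -2 * Complex.I * ξ := by
  have hc : ∀ y, f y ξ * (starRingEnd ℂ) (PDX f y ξ) - PDX f y ξ * (starRingEnd ℂ) (f y ξ) =
      f x ξ * (starRingEnd ℂ) (PDX f x ξ) - PDX f x ξ * (starRingEnd ℂ) (f x ξ) := fun y => by
    have := hf.isSol.wronskian_const hf.isSol.conj hξ y x
    rwa [hf.isSol.pdx_conj hξ, hf.isSol.pdx_conj hξ] at this
  have cj : Continuous (starRingEnd ℂ) := Complex.continuous_conj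
  have h1 := hf.asym ξ hξ
  have h2 := hf.asym' ξ hξ
  have h3 := (h1.mul ((cj.tendsto _).comp h2)).sub (h2.mul ((cj.tendsto _).comp h1))
  have h4 : Tendsto (fun _ : ℝ => f x ξ * (starRingEnd ℂ) (PDX f x ξ) -
      PDX f x ξ * (starRingEnd ℂ) (f x ξ)) atTop
      (nhds (1 * (starRingEnd ℂ) (Complex.I * ξ) - Complex.I * ξ * (starRingEnd ℂ) 1)) := by
    refine h3.congr fun y => ?_
    rw [← hc y]
    simp only [Function.comp, map_mul, ← Complex.exp_conj, map_neg, Complex.conj_I,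
      Complex.conj_ofReal]
    have he : Complex.exp (-Complex.I * y * ξ) * Complex.exp (- -Complex.I * y * ξ) = 1 := by
      rw [← Complex.exp_add]; simp
    linear_combination (f y ξ * (starRingEnd ℂ) (PDX f y ξ) -
      PDX f y ξ * (starRingEnd ℂ) (f y ξ)) * he
  rw [tendsto_nhds_unique tendsto_const_nhds h4]
  simp
  ring

lemma IsJost.zero_ne (hf : IsJost f) (hξ : 0 < ξ) : f 0 ξ ≠ 0 := by
  intro h
  have := hf.wronskian_conj hξ 0
  rw [h] at this
  simp [hξ.ne'] at this

lemma IsJost.pdx_zero_ne (hf : IsJost f) (hξ : 0 < ξ) : PDX f 0 ξ ≠ 0 := by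
  intro h
  have := hf.wronskian_conj hξ 0
  rw [h] at this
  simp [hξ.ne'] at this

lemma IsJost.unique (hf : IsJost f) (hu : IsSol u) (hξ : 0 < ξ) (h0 : u 0 ξ = 0)
    (h1 : PDX u 0 ξ = 0) (x : ℝ) : u x ξ = 0 := by
  have w1 := hu.wronskian_const hf.isSol hξ x 0
  have w2 := hu.wronskian_const hf.isSol.conj hξ x 0
  have w3 := hf.wronskian_conj hξ x
  rw [hf.isSol.pdx_conj hξ, hf.isSol.pdx_conj hξ] at w2
  rw [h0, h1] at w1 w2
  have : u x ξ * (-2 * Complex.I * ξ) = 0 := by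
    rw [← w3]
    linear_combination f x ξ * w2 - (starRingEnd ℂ) (f x ξ) * w1
  simpa [hξ.ne'] using this

lemma IsJost.tcoef_eq (hf : IsJost f) (hξ : 0 < ξ) :
    Tcoef f ξ = Complex.I * ξ / (f 0 ξ * PDX f 0 ξ) := by
  have h := hf.isSol.pdx_reflect hξ 0
  have hW : Wr f (fminus f) ξ = -2 * (f 0 ξ * PDX f 0 ξ) := by
    change f 0 ξ * PDX (fun x ξ => f (-x) ξ) 0 ξ - PDX f 0 ξ * f (-0) ξ = _
    rw [h, neg_zero]
    ring
  rw [Tcoef, hW, mul_assoc, mul_div_mul_left _ _ (by norm_num)]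

/-- Reflection coefficient. -/
def Rcoef (f : ℝ → ℝ → ℂ) (ξ : ℝ) : ℂ := Tcoef f ξ - (starRingEnd ℂ) (f 0 ξ) / f 0 ξ

lemma smooth2_ofReal_right {U : Set (ℝ × ℝ)} : Smooth2 U (fun _ ξ => (ξ : ℂ)) :=
  (Complex.ofRealCLM.contDiff.comp contDiff_snd).contDiffOn

lemma IsJost.smooth_T (hf : IsJost f) : Smooth2 Upper (fun _ ξ => Tcoef f ξ) := by
  refine Smooth2.congr (F := fun _ ξ => Complex.I * ξ * (f 0 ξ * PDX f 0 ξ)⁻¹) ?_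
    fun x ξ hξ => ?_
  · exact ((Smooth2.const _).mul smooth2_ofReal_right).mul
      ((Smooth2.mul hf.isSol.smooth.at_zero (hf.isSol.smooth.pdx upper_open).at_zero).inv
        fun x ξ hξ => mul_ne_zero (hf.zero_ne hξ) (hf.pdx_zero_ne hξ))
  · rw [hf.tcoef_eq hξ, div_eq_mul_inv]

lemma IsJost.smooth_R (hf : IsJost f) : Smooth2 Upper (fun _ ξ => Rcoef f ξ) := by
  refine Smooth2.congr (F := fun _ ξ => Tcoef f ξ + (-1) * ((starRingEnd ℂ) (f 0 ξ) * (f 0 ξ)⁻¹)) ?_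
    fun x ξ hξ => ?_
  · exact hf.smooth_T.add ((Smooth2.const _).mul (hf.isSol.smooth.at_zero.conj.mul
      (hf.isSol.smooth.at_zero.inv fun x ξ hξ => hf.zero_ne hξ)))
  · rw [Rcoef]; ring

/-- The scattering relation. -/
lemma IsJost.scattering (hf : IsJost f) (hξ : 0 < ξ) (x : ℝ) :
    Tcoef f ξ * f x ξ = (starRingEnd ℂ) (f (-x) ξ) + Rcoef f ξ * f (-x) ξ := by
  have hs := hf.isSol
  have m1 : Smooth2 Upper (fun _ ξ => (-1) * Rcoef f ξ) := (Smooth2.const (-1)).mul hf.smooth_R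
  have s1 := hs.lin hs.reflect hf.smooth_T m1
  have s2 := s1.lin hs.conj.reflect (Smooth2.const 1) (Smooth2.const (-1))
  have hF := hf.zero_ne hξ
  have hG := hf.pdx_zero_ne hξ
  have hW := hf.wronskian_conj hξ 0
  have hT := hf.tcoef_eq hξ
  have hR : Rcoef f ξ = Tcoef f ξ - (starRingEnd ℂ) (f 0 ξ) / f 0 ξ := rfl
  have := hf.unique s2 hξ ?_ ?_ x
  · linear_combination this
  · simp only [neg_zero, hR]
    field_simp
    ring
  · rw [s1.pdx_lin hs.conj.reflect hξ, hs.pdx_lin hs.reflect hξ, hs.pdx_reflect hξ,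
      hs.conj.pdx_reflect hξ, neg_zero, hs.pdx_conj hξ, hR, hT]
    field_simp
    linear_combination hW

/-- Solution with Cauchy data `(0, 1)` at the origin. -/
def solS (f : ℝ → ℝ → ℂ) (x ξ : ℝ) : ℂ :=
  ((starRingEnd ℂ) (f 0 ξ) * (2 * Complex.I * ξ)⁻¹) * f x ξ +
    (-(f 0 ξ) * (2 * Complex.I * ξ)⁻¹) * (starRingEnd ℂ) (f x ξ)

/-- Solution with Cauchy data `(1, 0)` at the origin. -/
def solC (f : ℝ → ℝ → ℂ) (x ξ : ℝ) : ℂ :=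
  (-(starRingEnd ℂ) (PDX f 0 ξ) * (2 * Complex.I * ξ)⁻¹) * f x ξ +
    (PDX f 0 ξ * (2 * Complex.I * ξ)⁻¹) * (starRingEnd ℂ) (f x ξ)

lemma two_I_mul_ne (hξ : 0 < ξ) : (2 * Complex.I * ξ : ℂ) ≠ 0 := by
  have : (ξ : ℂ) ≠ 0 := by exact_mod_cast hξ.ne'
  simp [this]

lemma smooth_two_I_inv : Smooth2 Upper (fun _ ξ => (2 * Complex.I * ξ : ℂ)⁻¹) :=
  ((Smooth2.const (2 * Complex.I)).mul smooth2_ofReal_right).inv fun _ _ h => two_I_mul_ne h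

lemma Smooth2.neg {U : Set (ℝ × ℝ)} {F : ℝ → ℝ → ℂ} (hF : Smooth2 U F) :
    Smooth2 U (fun x ξ => - F x ξ) := ContDiffOn.neg hF

lemma IsJost.smooth_solS_left (hf : IsJost f) :
    Smooth2 Upper (fun _ ξ => (starRingEnd ℂ) (f 0 ξ) * (2 * Complex.I * ξ : ℂ)⁻¹) :=
  hf.isSol.smooth.at_zero.conj.mul smooth_two_I_inv

lemma IsJost.smooth_solS_right (hf : IsJost f) :
    Smooth2 Upper (fun _ ξ => -(f 0 ξ) * (2 * Complex.I * ξ : ℂ)⁻¹) :=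
  hf.isSol.smooth.at_zero.neg.mul smooth_two_I_inv

lemma IsJost.smooth_solC_left (hf : IsJost f) :
    Smooth2 Upper (fun _ ξ => -(starRingEnd ℂ) (PDX f 0 ξ) * (2 * Complex.I * ξ : ℂ)⁻¹) :=
  (hf.isSol.smooth.pdx upper_open).at_zero.conj.neg.mul smooth_two_I_inv

lemma IsJost.smooth_solC_right (hf : IsJost f) :
    Smooth2 Upper (fun _ ξ => PDX f 0 ξ * (2 * Complex.I * ξ : ℂ)⁻¹) :=
  (hf.isSol.smooth.pdx upper_open).at_zero.mul smooth_two_I_inv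

lemma IsJost.isSol_solS (hf : IsJost f) : IsSol (solS f) :=
  hf.isSol.lin hf.isSol.conj hf.smooth_solS_left hf.smooth_solS_right

lemma IsJost.isSol_solC (hf : IsJost f) : IsSol (solC f) :=
  hf.isSol.lin hf.isSol.conj hf.smooth_solC_left hf.smooth_solC_right

lemma IsJost.pdx_solS (hf : IsJost f) (hξ : 0 < ξ) (x : ℝ) :
    PDX (solS f) x ξ = ((starRingEnd ℂ) (f 0 ξ) * (2 * Complex.I * ξ)⁻¹) * PDX f x ξ +
      (-(f 0 ξ) * (2 * Complex.I * ξ)⁻¹) * (starRingEnd ℂ) (PDX f x ξ) := by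
  rw [← hf.isSol.pdx_conj hξ x]
  exact hf.isSol.pdx_lin (a := fun ξ => (starRingEnd ℂ) (f 0 ξ) * (2 * Complex.I * ξ)⁻¹)
    (b := fun ξ => -(f 0 ξ) * (2 * Complex.I * ξ)⁻¹) hf.isSol.conj hξ x

lemma IsJost.pdx_solC (hf : IsJost f) (hξ : 0 < ξ) (x : ℝ) :
    PDX (solC f) x ξ = (-(starRingEnd ℂ) (PDX f 0 ξ) * (2 * Complex.I * ξ)⁻¹) * PDX f x ξ +
      (PDX f 0 ξ * (2 * Complex.I * ξ)⁻¹) * (starRingEnd ℂ) (PDX f x ξ) := by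
  rw [← hf.isSol.pdx_conj hξ x]
  exact hf.isSol.pdx_lin (a := fun ξ => -(starRingEnd ℂ) (PDX f 0 ξ) * (2 * Complex.I * ξ)⁻¹)
    (b := fun ξ => PDX f 0 ξ * (2 * Complex.I * ξ)⁻¹) hf.isSol.conj hξ x

lemma solS_zero : solS f 0 ξ = 0 := by
  rw [solS]; ring

lemma IsJost.pdx_solS_zero (hf : IsJost f) (hξ : 0 < ξ) : PDX (solS f) 0 ξ = 1 := by
  rw [hf.pdx_solS hξ]
  have h := two_I_mul_ne hξ
  calc _ = -(f 0 ξ * (starRingEnd ℂ) (PDX f 0 ξ) - PDX f 0 ξ * (starRingEnd ℂ) (f 0 ξ)) *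
        (2 * Complex.I * ξ)⁻¹ := by ring
    _ = (2 * Complex.I * ξ) * (2 * Complex.I * ξ)⁻¹ := by rw [hf.wronskian_conj hξ 0]; ring
    _ = 1 := mul_inv_cancel₀ h

lemma IsJost.solC_zero (hf : IsJost f) (hξ : 0 < ξ) : solC f 0 ξ = 1 := by
  rw [solC]
  have h := two_I_mul_ne hξ
  calc _ = -(f 0 ξ * (starRingEnd ℂ) (PDX f 0 ξ) - PDX f 0 ξ * (starRingEnd ℂ) (f 0 ξ)) *
        (2 * Complex.I * ξ)⁻¹ := by ring
    _ = (2 * Complex.I * ξ) * (2 * Complex.I * ξ)⁻¹ := by rw [hf.wronskian_conj hξ 0]; ring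
    _ = 1 := mul_inv_cancel₀ h

lemma IsJost.pdx_solC_zero (hf : IsJost f) (hξ : 0 < ξ) : PDX (solC f) 0 ξ = 0 := by
  rw [hf.pdx_solC hξ]; ring

/-- The Jost solution at the origin as a Wronskian. -/
lemma IsJost.wronskian_solS (hf : IsJost f) (hξ : 0 < ξ) (x : ℝ) :
    f x ξ * PDX (solS f) x ξ - PDX f x ξ * solS f x ξ = f 0 ξ := by
  rw [hf.isSol.wronskian_const hf.isSol_solS hξ x 0, hf.pdx_solS_zero hξ, solS_zero]; ring

lemma IsJost.wronskian_conj_solS (hf : IsJost f) (hξ : 0 < ξ) (x : ℝ) :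
    (starRingEnd ℂ) (f x ξ) * PDX (solS f) x ξ - (starRingEnd ℂ) (PDX f x ξ) * solS f x ξ =
      (starRingEnd ℂ) (f 0 ξ) := by
  have := hf.isSol.conj.wronskian_const hf.isSol_solS hξ x 0
  rw [hf.pdx_solS_zero hξ, solS_zero, hf.isSol.pdx_conj hξ] at this
  rw [this]; ring

lemma IsJost.wronskian_solC (hf : IsJost f) (hξ : 0 < ξ) (x : ℝ) :
    -(f x ξ * PDX (solC f) x ξ - PDX f x ξ * solC f x ξ) = PDX f 0 ξ := by
  rw [hf.isSol.wronskian_const hf.isSol_solC hξ x 0, hf.pdx_solC_zero hξ, hf.solC_zero hξ]; ring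

lemma norm_solS_le (hξ : 0 < ξ) (x : ℝ) : ‖solS f x ξ‖ ≤ ‖f 0 ξ‖ * ‖f x ξ‖ * ξ⁻¹ := by
  refine (norm_add_le _ _).trans (le_of_eq ?_)
  simp only [norm_mul, norm_neg, norm_inv, Complex.norm_real, Real.norm_of_nonneg hξ.le,
    Complex.norm_I, RCLike.norm_conj, RCLike.norm_ofNat]
  field_simp
  ring

lemma norm_solC_le (hξ : 0 < ξ) (x : ℝ) : ‖solC f x ξ‖ ≤ ‖PDX f 0 ξ‖ * ‖f x ξ‖ * ξ⁻¹ := by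
  refine (norm_add_le _ _).trans (le_of_eq ?_)
  simp only [norm_mul, norm_neg, norm_inv, Complex.norm_real, Real.norm_of_nonneg hξ.le,
    Complex.norm_I, RCLike.norm_conj, RCLike.norm_ofNat]
  field_simp
  ring

lemma inner_subset_upper : InnerR ⊆ Upper := fun _ h => h.1

lemma overlap_subset_inner : Overlap ⊆ InnerR := fun p h =>
  ⟨h.2.1, h.2.2.2.2, by rw [abs_of_pos h.1]; exact h.2.2.2.1⟩

/-- Symbol estimates for solutions in the inner region in terms of their Cauchy data. -/
lemma IsSol.symb_inner (hu : IsSol u) {ρ : ℝ → ℝ} (hρ : ∀ ξ, 0 < ξ → 0 ≤ ρ ξ)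
    (h0 : Symb InnerR (fun _ ξ => ρ ξ) (fun _ ξ => u 0 ξ))
    (h1 : Symb InnerR (fun _ ξ => ρ ξ) (fun _ ξ => PDX u 0 ξ)) :
    Symb InnerR (fun x ξ => ρ ξ * jap x ^ 2) u ∧ Symb InnerR (fun x ξ => ρ ξ * jap x) (PDX u) := by
  have hs := hu.smooth.restrict inner_subset_upper
  have key := fun n => SymN.of_ode n hs (Smooth2.const 0) hρ
    (fun x ξ hx => by rw [hu.ode ξ hx.1 x, add_zero]) SymN.zero (h0.2 n) (h1.2 n)
  exact ⟨⟨hs, fun n => (key n).1⟩, ⟨hs.pdx isOpen_inner, fun n => (key n).2⟩⟩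

lemma IsJost.symb_solS (hf : IsJost f) :
    Symb InnerR (fun x _ => jap x ^ 2) (solS f) ∧ Symb InnerR (fun x _ => jap x) (PDX (solS f)) := by
  have := hf.isSol_solS.symb_inner (ρ := fun _ => 1) (fun _ _ => zero_le_one)
    (((Symb.const 0).mono_le fun _ _ _ => le_rfl).congr isOpen_inner fun _ _ _ => solS_zero.symm)
    ((Symb.const 1).congr isOpen_inner fun _ ξ h => (hf.pdx_solS_zero h.1).symm)
  simpa only [one_mul] using this

lemma IsJost.symb_solC (hf : IsJost f) :
    Symb InnerR (fun x _ => jap x ^ 2) (solC f) ∧ Symb InnerR (fun x _ => jap x) (PDX (solC f)) := by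
  have := hf.isSol_solC.symb_inner (ρ := fun _ => 1) (fun _ _ => zero_le_one)
    ((Symb.const 1).congr isOpen_inner fun _ ξ h => (hf.solC_zero h.1).symm)
    ((Symb.const 0).congr isOpen_inner fun _ ξ h => (hf.pdx_solC_zero h.1).symm)
  simpa only [one_mul] using this

/-- Smooth functions of `x * ξ` where this product is bounded. -/
lemma symb_comp_mul {U : Set (ℝ × ℝ)} (hU : IsOpen U) (h0 : ∀ p ∈ U, p.2 ≠ 0) {K : ℝ} (hK : 0 ≤ K)
    (hb : ∀ x ξ, (x, ξ) ∈ U → jap x * |ξ| ≤ K) {φ : ℝ → ℂ} (hφ : ContDiff ℝ (⊤ : ℕ∞) φ) :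
    Symb U (fun _ _ => 1) (fun x ξ => φ (x * ξ)) := by
  refine Symb.comp hU (g := fun x ξ => x * ξ) ?_ hφ
  refine ((Symb.mul hU symb_left (symb_right h0)).mono (K := K) hK fun x ξ h => ?_).congr hU
    fun x ξ _ => by push_cast; rfl
  simpa using hb x ξ h

lemma inner_jap_mul_le {x ξ : ℝ} (h : (x, ξ) ∈ InnerR) : jap x * ξ ≤ 2 := by
  obtain ⟨h1, h2, h3⟩ := h
  simp only at h1 h2 h3
  nlinarith [jap_le x]

lemma symb_inner_comp_mul {φ : ℝ → ℂ} (hφ : ContDiff ℝ (⊤ : ℕ∞) φ) :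
    Symb InnerR (fun _ _ => 1) (fun x ξ => φ (x * ξ)) :=
  symb_comp_mul isOpen_inner (fun p hp => (inner_pos p hp).ne') (K := 2) (by norm_num)
    (fun x ξ h => by rw [abs_of_pos h.1]; exact inner_jap_mul_le h) hφ

lemma contDiff_expI (c : ℂ) : ContDiff ℝ (⊤ : ℕ∞) (fun y : ℝ => Complex.exp (c * y)) :=
  (contDiff_const.mul Complex.ofRealCLM.contDiff).cexp

lemma f_eq_m (f : ℝ → ℝ → ℂ) (x ξ : ℝ) : f x ξ = Complex.exp (Complex.I * ((x * ξ : ℝ) : ℂ)) * mJost f x ξ := by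
  rw [mJost, ← mul_assoc, ← Complex.exp_add]
  push_cast
  rw [show Complex.I * ((x : ℂ) * ξ) + -Complex.I * x * ξ = 0 by ring]
  simp

lemma overlap_subset_outer : Overlap ⊆ Outer (1 / 8) := fun p h =>
  ⟨by linarith [h.1], h.2.1, h.2.2.1.trans_le
    (mul_le_mul_of_nonneg_right ((le_abs_self _).trans (abs_le_jap _)) h.2.1.le)⟩

lemma IsJost.symb_f_overlap (hf : IsJost f) : Symb Overlap (fun _ _ => 1) f := by
  have h1 := (hf.symb_outer (c := 1 / 8) (by norm_num) (by norm_num)).restrict overlap_subset_outer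
  have h2 : Symb Overlap (fun _ _ => 1) (fun x ξ => (mJost f x ξ - 1) + 1) := by
    refine Symb.add isOpen_overlap (h1.mono (K := 8) (by norm_num) fun x ξ h => ?_) (Symb.const 1)
    have h3 := (overlap_subset_outer h).2.2
    simp only at h3
    rw [inv_le_comm₀ (by linarith) (by norm_num)]
    linarith
  have h3 := ((symb_inner_comp_mul (contDiff_expI Complex.I)).restrict
    overlap_subset_inner).mul isOpen_overlap h2
  refine (h3.weight_eq fun _ _ _ => one_mul 1).congr isOpen_overlap fun x ξ h => ?_
  rw [f_eq_m f x ξ]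
  ring

/-- The strip of low frequencies. -/
def LowS : Set (ℝ × ℝ) := {p | p.2 ∈ Set.Ioo (0 : ℝ) (3 / 2)}

lemma isOpen_lowS : IsOpen LowS := isOpen_Ioo.preimage continuous_snd

lemma lowS_subset_upper : LowS ⊆ Upper := fun _ h => h.1

lemma exists_mem_overlap {ξ : ℝ} (h : ξ ∈ Set.Ioo (0 : ℝ) (3 / 2)) : (1 / (4 * ξ), ξ) ∈ Overlap := by
  obtain ⟨h1, h2⟩ := h
  have : 1 / (4 * ξ) * ξ = 1 / 4 := by field_simp
  refine ⟨by positivity, h1, ?_, ?_, h2⟩ <;> simp only [this] <;> norm_num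

lemma Symb.low_of_overlap {w : ℝ → ℝ} {φ : ℝ → ℂ} (hs : Smooth2 Upper (fun _ ξ => φ ξ))
    (h : Symb Overlap (fun _ ξ => w ξ) (fun _ ξ => φ ξ)) :
    Symb LowS (fun _ ξ => w ξ) (fun _ ξ => φ ξ) :=
  ⟨hs.restrict lowS_subset_upper, fun n => SymN.lift (fun _ hξ => ⟨_, exists_mem_overlap hξ⟩) (h.2 n)⟩

lemma overlap_jap_le {x ξ : ℝ} (h : (x, ξ) ∈ Overlap) : jap x ≤ 2 * ξ⁻¹ := by
  have h1 := inner_jap_mul_le (overlap_subset_inner h)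
  have : 0 < ξ := h.2.1
  rw [← div_eq_mul_inv, le_div_iff₀ this]
  exact h1

lemma IsJost.symb_wronskian (hf : IsJost f) (hu : Symb InnerR (fun x _ => jap x ^ 2) u)
    (hu' : Symb InnerR (fun x _ => jap x) (PDX u)) :
    Symb Overlap (fun _ ξ => ξ⁻¹) (fun x ξ => f x ξ * PDX u x ξ - PDX f x ξ * u x ξ) := by
  have o := isOpen_overlap
  have h1 := hf.symb_f_overlap
  have h2 := h1.pdx o
  refine Symb.sub o ((h1.mul o (hu'.restrict overlap_subset_inner)).mono (K := 2) (by norm_num)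
    fun x ξ h => ?_) ((h2.mul o (hu.restrict overlap_subset_inner)).mono (K := 2) (by norm_num)
    fun x ξ h => ?_)
  · rw [one_mul]; exact overlap_jap_le h
  · have := (jap_pos x).ne'
    rw [show 1 / jap x * jap x ^ 2 = jap x by field_simp]
    exact overlap_jap_le h

lemma IsJost.low_zero (hf : IsJost f) : Symb LowS (fun _ ξ => ξ⁻¹) (fun _ ξ => f 0 ξ) :=
  Symb.low_of_overlap hf.isSol.smooth.at_zero ((hf.symb_wronskian hf.symb_solS.1 hf.symb_solS.2).congr
    isOpen_overlap fun x _ h => hf.wronskian_solS h.2.1 x)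

lemma IsJost.low_pdx_zero (hf : IsJost f) : Symb LowS (fun _ ξ => ξ⁻¹) (fun _ ξ => PDX f 0 ξ) :=
  Symb.low_of_overlap (hf.isSol.smooth.pdx upper_open).at_zero
    (((hf.symb_wronskian hf.symb_solC.1 hf.symb_solC.2).neg isOpen_overlap).congr
      isOpen_overlap fun x _ h => hf.wronskian_solC h.2.1 x)

lemma Smooth2.continuousOn_right {φ : ℝ → ℂ} (h : Smooth2 Upper (fun _ ξ => φ ξ)) :
    ContinuousOn φ (Set.Ioi 0) :=
  ContinuousOn.comp (g := fun p : ℝ × ℝ => φ p.2) h.continuousOn (f := fun ξ => ((0 : ℝ), ξ))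
    (by fun_prop) (fun _ hξ => hξ)

lemma exists_pos_le_norm {φ : ℝ → ℂ} (h : ContinuousOn φ (Set.Ioi 0)) (hne : ∀ ξ, 0 < ξ → φ ξ ≠ 0)
    {α β : ℝ} (hα : 0 < α) : ∃ c : ℝ, 0 < c ∧ ∀ ξ ∈ Set.Icc α β, c ≤ ‖φ ξ‖ := by
  rcases (Set.Icc α β).eq_empty_or_nonempty with he | he
  · exact ⟨1, one_pos, by simp [he]⟩
  obtain ⟨z, hz, hm⟩ := isCompact_Icc.exists_isMinOn he
    ((h.mono fun ξ hξ => hα.trans_le hξ.1).norm)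
  exact ⟨‖φ z‖, norm_pos_iff.2 (hne z (hα.trans_le hz.1)), fun ξ hξ => hm hξ⟩

lemma exists_low_lower {φ : ℝ → ℂ} (h : ContinuousOn φ (Set.Ioi 0)) (hne : ∀ ξ, 0 < ξ → φ ξ ≠ 0)
    {c₀ : ℝ} (h0 : 0 < c₀) (hs : ∀ ξ, 0 < ξ → ξ ≤ 1 / 4 → c₀ * ξ⁻¹ ≤ ‖φ ξ‖) :
    ∃ c : ℝ, 0 < c ∧ ∀ ξ ∈ Set.Ioo (0 : ℝ) (3 / 2), c * ξ⁻¹ ≤ ‖φ ξ‖ := by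
  obtain ⟨c₁, h1, hc⟩ := exists_pos_le_norm h hne (α := 1 / 4) (β := 3 / 2) (by norm_num)
  refine ⟨min c₀ (c₁ / 4), by positivity, fun ξ hξ => ?_⟩
  have hi : 0 < ξ⁻¹ := inv_pos.2 hξ.1
  rcases le_total ξ (1 / 4) with h4 | h4
  · exact (mul_le_mul_of_nonneg_right (min_le_left _ _) hi.le).trans (hs ξ hξ.1 h4)
  · refine (mul_le_mul_of_nonneg_right (min_le_right _ _) hi.le).trans
      (le_trans ?_ (hc ξ ⟨h4, hξ.2.le⟩))
    have : ξ⁻¹ ≤ 4 := by rw [inv_le_comm₀ hξ.1 (by norm_num)]; linarith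
    nlinarith

lemma zeroQuot_ge {t : ℝ} (ht : 1 ≤ t) : 3 / 8 ≤ zeroQuot t := by
  have h1 : Real.pi / 4 ≤ Real.arctan t := by
    rw [← Real.arctan_one]; exact Real.arctan_mono ht
  have h2 : 0 ≤ t / (1 + t ^ 2) := by positivity
  have := Real.pi_gt_three
  rw [zeroQuot]
  linarith

lemma IsSol.inner_approx (hu : IsSol u) (hξ : 0 < ξ) (h4 : ξ ≤ 1 / 4)
    (hb : ‖u 0 ξ‖ + ‖PDX u 0 ξ‖ ≤ 1) : ∃ t : ℝ, 1 ≤ t ∧ t = 1 / (4 * ξ) ∧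
    (‖u 0 ξ + zeroQuot t * PDX u 0 ξ‖ - 1 / 8) * (1 / (16 * ξ ^ 2)) ≤ ‖u t ξ‖ := by
  have ht : 1 ≤ 1 / (4 * ξ) := by rw [le_div_iff₀ (by positivity)]; linarith
  refine ⟨1 / (4 * ξ), ht, rfl, ?_⟩
  set t := 1 / (4 * ξ) with hdef
  have htξ : t * ξ = 1 / 4 := by rw [hdef]; field_simp
  obtain ⟨M, hM0, hM, -, -, h3⟩ := inner_core (u := fun t => u t ξ) (v := fun t => PDX u t ξ)
    (h := fun _ => 0) (A := 0) (X := t) hξ (by linarith) (by rw [htξ]; norm_num) le_rfl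
    (fun s _ => hu.hasDerivAt hξ s) (fun s _ => by rw [add_zero]; exact hu.hasDerivAt' hξ s)
    (fun s _ => by simp)
  have h3 := h3 t ⟨by linarith, le_rfl⟩
  have hM2 : M ≤ 2 := by linarith
  have e1 : t ^ 2 * ξ ^ 2 * (M + 0) ≤ 1 / 8 := by
    rw [← mul_pow, htξ]; linarith
  have h5 : ‖u 0 ξ + zeroQuot t * PDX u 0 ξ‖ - 1 / 8 ≤ ‖u t ξ / ((1 + t ^ 2 : ℝ) : ℂ)‖ := by
    have := norm_sub_norm_le (u 0 ξ + zeroQuot t * PDX u 0 ξ) (u t ξ / ((1 + t ^ 2 : ℝ) : ℂ))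
    have h6 : ‖u 0 ξ + zeroQuot t * PDX u 0 ξ - u t ξ / ((1 + t ^ 2 : ℝ) : ℂ)‖ ≤ 1 / 8 := by
      rw [norm_sub_rev]
      refine (le_of_eq ?_).trans (h3.trans e1)
      congr 1; ring
    linarith
  have hp : 0 < 1 + t ^ 2 := by positivity
  rw [norm_div, Complex.norm_real, Real.norm_of_nonneg hp.le] at h5
  have h7 : 1 / (16 * ξ ^ 2) ≤ 1 + t ^ 2 := by
    have : 1 / (16 * ξ ^ 2) = t ^ 2 := by rw [hdef]; field_simp; norm_num
    linarith
  rcases le_total (‖u 0 ξ + zeroQuot t * PDX u 0 ξ‖ - 1 / 8) 0 with h0 | h0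
  · exact (mul_nonpos_of_nonpos_of_nonneg h0 (by positivity)).trans (norm_nonneg _)
  · calc _ ≤ (‖u 0 ξ + zeroQuot t * PDX u 0 ξ‖ - 1 / 8) * (1 + t ^ 2) :=
          mul_le_mul_of_nonneg_left h7 h0
      _ ≤ ‖u t ξ‖ / (1 + t ^ 2) * (1 + t ^ 2) := mul_le_mul_of_nonneg_right h5 hp.le
      _ = _ := div_mul_cancel₀ _ hp.ne'

lemma IsJost.exists_low_lower_aux (hf : IsJost f) : ∃ c : ℝ, 0 < c ∧ ∀ ξ, 0 < ξ → ξ ≤ 1 / 4 →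
    c * ξ⁻¹ ≤ ‖f 0 ξ‖ ∧ c * ξ⁻¹ ≤ ‖PDX f 0 ξ‖ := by
  obtain ⟨B, hB, hb⟩ := (hf.symb_f_overlap.2 0).bdd
  refine ⟨1 / (64 * (B + 1)), by positivity, fun ξ hξ h4 => ?_⟩
  have key : ∀ {r d : ℝ}, 0 ≤ d → 1 / 4 * (1 / (16 * ξ ^ 2)) ≤ r → r ≤ d * ‖f (1 / (4 * ξ)) ξ‖ * ξ⁻¹ →
      1 / (64 * (B + 1)) * ξ⁻¹ ≤ d := by
    intro r d hd h1 h2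
    have h3 : ‖f (1 / (4 * ξ)) ξ‖ ≤ B + 1 := by
      have := hb _ ξ (exists_mem_overlap ⟨hξ, by linarith⟩)
      linarith
    have h5 : 1 / 4 * (1 / (16 * ξ ^ 2)) ≤ d * (B + 1) * ξ⁻¹ :=
      h1.trans (h2.trans (by gcongr))
    calc 1 / (64 * (B + 1)) * ξ⁻¹ = (1 / 4 * (1 / (16 * ξ ^ 2))) * (ξ / (B + 1)) := by
          field_simp; norm_num
      _ ≤ (d * (B + 1) * ξ⁻¹) * (ξ / (B + 1)) := by gcongr
      _ = d := by field_simp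
  constructor
  · obtain ⟨t, ht, rfl, h⟩ := hf.isSol_solS.inner_approx hξ h4
      (by rw [solS_zero, hf.pdx_solS_zero hξ]; simp)
    refine key (norm_nonneg _) (le_trans ?_ h) (norm_solS_le hξ _)
    rw [solS_zero, hf.pdx_solS_zero hξ, zero_add, mul_one, Complex.norm_real, Real.norm_eq_abs]
    have := (zeroQuot_ge ht).trans (le_abs_self _)
    gcongr
    linarith
  · obtain ⟨t, ht, rfl, h⟩ := hf.isSol_solC.inner_approx hξ h4
      (by rw [hf.solC_zero hξ, hf.pdx_solC_zero hξ]; simp)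
    refine key (norm_nonneg _) (le_trans ?_ h) (norm_solC_le hξ _)
    rw [hf.solC_zero hξ, hf.pdx_solC_zero hξ, mul_zero, add_zero, norm_one]
    gcongr
    norm_num

lemma IsJost.low_zero_inv (hf : IsJost f) : Symb LowS (fun _ ξ => ξ) (fun _ ξ => (f 0 ξ)⁻¹) := by
  obtain ⟨c₀, h0, hc⟩ := hf.exists_low_lower_aux
  obtain ⟨c, hc0, h⟩ := exists_low_lower hf.isSol.smooth.at_zero.continuousOn_right
    (fun ξ hξ => hf.zero_ne hξ) h0 (fun ξ h1 h2 => (hc ξ h1 h2).1)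
  exact (hf.low_zero.inv isOpen_lowS hc0 (fun x ξ hx => inv_pos.2 hx.1)
    (fun x ξ hx => h ξ hx)).weight_eq fun _ _ _ => inv_inv _

lemma IsJost.low_pdx_zero_inv (hf : IsJost f) :
    Symb LowS (fun _ ξ => ξ) (fun _ ξ => (PDX f 0 ξ)⁻¹) := by
  obtain ⟨c₀, h0, hc⟩ := hf.exists_low_lower_aux
  obtain ⟨c, hc0, h⟩ := exists_low_lower (hf.isSol.smooth.pdx upper_open).at_zero.continuousOn_right
    (fun ξ hξ => hf.pdx_zero_ne hξ) h0 (fun ξ h1 h2 => (hc ξ h1 h2).2)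
  exact (hf.low_pdx_zero.inv isOpen_lowS hc0 (fun x ξ hx => inv_pos.2 hx.1)
    (fun x ξ hx => h ξ hx)).weight_eq fun _ _ _ => inv_inv _

lemma lowS_ne : ∀ p ∈ LowS, p.2 ≠ 0 := fun _ h => h.1.ne'

lemma inner_subset_low : InnerR ⊆ LowS := fun _ h => ⟨h.1, h.2.1⟩

lemma symb_low_right : Symb LowS (fun _ ξ => ξ) (fun _ ξ => (ξ : ℂ)) :=
  (symb_right lowS_ne).weight_eq fun _ _ h => abs_of_pos h.1

lemma IsJost.low_T (hf : IsJost f) : Symb LowS (fun _ ξ => ξ ^ 3) (fun _ ξ => Tcoef f ξ) := by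
  have o := isOpen_lowS
  refine (((symb_low_right.const_mul o Complex.I).mul o
    (hf.low_zero_inv.mul o hf.low_pdx_zero_inv)).weight_eq fun x ξ _ => by ring).congr o
    fun x ξ h => ?_
  rw [hf.tcoef_eq h.1, div_eq_mul_inv, mul_inv]

/-- In the inner region `T f₊` is of size `ξ² ⟨x⟩²`. -/
lemma IsJost.inner_Tf (hf : IsJost f) :
    Symb InnerR (fun x ξ => ξ ^ 2 * jap x ^ 2) (fun x ξ => Tcoef f ξ * f x ξ) := by
  have o := isOpen_lowS
  have hs : IsSol (fun x ξ => Tcoef f ξ * f x ξ + 0 * f x ξ) :=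
    hf.isSol.lin (b := fun _ => 0) hf.isSol hf.smooth_T (Smooth2.const 0)
  have h1 := (hf.low_pdx_zero_inv.mul o symb_low_right).const_mul o Complex.I
  have h2 := (hf.low_zero_inv.mul o symb_low_right).const_mul o Complex.I
  refine (hs.symb_inner (ρ := fun ξ => ξ ^ 2) (fun ξ _ => sq_nonneg ξ) ?_ ?_).1.congr isOpen_inner
    fun x ξ h => by ring
  · refine ((h1.restrict inner_subset_low).weight_eq fun x ξ _ => by ring).congr isOpen_inner
      fun x ξ h => ?_
    have := hf.zero_ne h.1
    have := hf.pdx_zero_ne h.1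
    rw [hf.tcoef_eq h.1]
    field_simp
    ring
  · refine ((h2.restrict inner_subset_low).weight_eq fun x ξ _ => by ring).congr isOpen_inner
      fun x ξ h => ?_
    have := hf.zero_ne h.1
    have := hf.pdx_zero_ne h.1
    have e := hf.isSol.pdx_lin (a := fun ξ => Tcoef f ξ) (b := fun _ => 0) hf.isSol h.1 0
    rw [e, hf.tcoef_eq h.1]
    field_simp
    ring

lemma Differentiable.contDiff_comp_ofReal {g : ℂ → ℂ} (hg : Differentiable ℂ g) :
    ContDiff ℝ (⊤ : ℕ∞) (fun y : ℝ => g y) :=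
  ((hg.contDiff (n := (⊤ : ℕ∞))).restrict_scalars ℝ).comp Complex.ofRealCLM.contDiff

lemma exists_sinc : ∃ S : ℂ → ℂ, Differentiable ℂ S ∧ ∀ z, z * S z = Complex.sin z := by
  refine ⟨dslope Complex.sin 0, ?_, fun z => ?_⟩
  · rw [← differentiableOn_univ]
    exact (Complex.differentiableOn_dslope univ_mem).2 Complex.differentiable_sin.differentiableOn
  · have := sub_smul_dslope Complex.sin 0 z
    simpa using this

/-- The real part of the free decaying solution, written as `y²` times a smooth function. -/
lemma exists_freeRe : ∃ J J₁ h : ℝ → ℂ, ContDiff ℝ (⊤ : ℕ∞) J ∧ ContDiff ℝ (⊤ : ℕ∞) J₁ ∧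
    ContDiff ℝ (⊤ : ℕ∞) h ∧ (∀ y : ℝ, J y = (y : ℂ) ^ 2 * h y) ∧
    (∀ y : ℝ, y * J y = y * Complex.cos y - Complex.sin y) ∧
    (∀ y, HasDerivAt J (J₁ y) y) ∧ ∀ y, HasDerivAt J₁ (2 * h y - J y) y := by
  obtain ⟨S, hS, hz⟩ := exists_sinc
  have hS1 : Differentiable ℂ (deriv S) := hS.deriv
  have hS2 : Differentiable ℂ (deriv (deriv S)) := hS1.deriv
  have e1 : ∀ z, S z + z * deriv S z = Complex.cos z := fun z => by
    have h1 := (hasDerivAt_id z).fun_mul (hS z).hasDerivAt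
    have h2 : (fun z => id z * S z) = Complex.sin := funext hz
    rw [h2] at h1
    have := h1.unique (Complex.hasDerivAt_sin z)
    simpa using this
  have e2 : ∀ z, 2 * deriv S z + z * deriv (deriv S) z = - (z * S z) := fun z => by
    have h1 := (hS z).hasDerivAt.fun_add ((hasDerivAt_id z).fun_mul (hS1 z).hasDerivAt)
    have h2 : (fun z => S z + id z * deriv S z) = Complex.cos := funext e1
    rw [h2] at h1
    have := h1.unique (Complex.hasDerivAt_cos z)
    rw [hz, ← this]
    simp only [id]
    ring
  refine ⟨fun y => Complex.cos y - S y, fun y => -Complex.sin y - deriv S y,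
    fun y => -(S y + deriv (deriv S) y) / 2,
    (Complex.differentiable_cos.sub hS).contDiff_comp_ofReal,
    (Complex.differentiable_sin.neg.sub hS1).contDiff_comp_ofReal,
    ((hS.add hS2).neg.div_const 2).contDiff_comp_ofReal, fun y => ?_, fun y => ?_, fun y => ?_,
    fun y => ?_⟩
  · linear_combination -e1 y + (y / 2 : ℂ) * e2 y
  · linear_combination - hz y
  · exact ((Complex.hasDerivAt_cos y).sub (hS y).hasDerivAt).comp_ofReal
  · refine (((Complex.hasDerivAt_sin y).neg.sub (hS1 y).hasDerivAt).comp_ofReal).congr_deriv (by ring)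

lemma IsJost.low_re_zero (hf : IsJost f) :
    Symb LowS (fun _ _ => 1) (fun _ ξ => f 0 ξ + (starRingEnd ℂ) (f 0 ξ)) := by
  obtain ⟨J, J₁, h, cJ, cJ₁, ch, hJ, hJe, dJ, dJ₁⟩ := exists_freeRe
  have oI := isOpen_inner
  have oO := isOpen_overlap
  have hne : ∀ p ∈ InnerR, p.2 ≠ 0 := fun p hp => (inner_pos p hp).ne'
  have hs := hf.isSol_solS
  have dmul : ∀ x ξ : ℝ, HasDerivAt (fun t : ℝ => t * ξ) ξ x := fun x ξ => by
    simpa using (hasDerivAt_id x).mul_const ξ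
  have d1 : ∀ x ξ : ℝ, HasDerivAt (fun t => J (t * ξ)) (ξ * J₁ (x * ξ)) x := fun x ξ => by
    exact ((dJ (x * ξ)).scomp x (dmul x ξ)).congr_deriv (by simp)
  have d2 : ∀ x ξ : ℝ, HasDerivAt (fun t => J₁ (t * ξ)) (ξ * (2 * h (x * ξ) - J (x * ξ))) x :=
    fun x ξ => by
      exact ((dJ₁ (x * ξ)).scomp x (dmul x ξ)).congr_deriv (by simp)
  have sξ : Symb InnerR (fun _ ξ => |ξ|) (fun _ ξ => (ξ : ℂ)) := symb_right hne
  -- the Wronskian of the free solution with `solS`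
  let P : ℝ → ℝ → ℂ := fun x ξ => J (x * ξ) * PDX (solS f) x ξ - ξ * J₁ (x * ξ) * solS f x ξ
  have sP : Smooth2 InnerR P :=
    (((symb_inner_comp_mul cJ).mul oI hf.symb_solS.2).1).sub
      (((sξ.mul oI (symb_inner_comp_mul cJ₁)).mul oI hf.symb_solS.1).1)
  have dP : ∀ x ξ, (x, ξ) ∈ InnerR → PDX P x ξ =
      (-2) * (((1 + x ^ 2 : ℝ) : ℂ)⁻¹ * (h (x * ξ) * solS f x ξ) * (ξ * ξ)) := fun x ξ hx => by
    have e := (((d1 x ξ).fun_mul (hs.hasDerivAt' hx.1 x)).fun_sub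
      (((d2 x ξ).const_mul (ξ : ℂ)).fun_mul (hs.hasDerivAt hx.1 x))).deriv
    refine e.trans ?_
    rw [hJ]
    have hp : ((1 + x ^ 2 : ℝ) : ℂ) ≠ 0 := by
      exact_mod_cast (by positivity : (1 + x ^ 2 : ℝ) ≠ 0)
    push_cast at hp ⊢
    field_simp
    ring
  have bP' : Symb InnerR (fun _ ξ => ξ ^ 2) (PDX P) := by
    refine (((((symb_inv_one_add_sq oI).mul oI ((symb_inner_comp_mul ch).mul oI hf.symb_solS.1)).mul
      oI (sξ.mul oI sξ)).const_mul oI (-2)).weight_eq fun x ξ _ => ?_).congr oI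
      fun x ξ hx => (dP x ξ hx).symm
    have := (jap_pos x).ne'
    rw [abs_mul_abs_self]
    field_simp
  have bP : Symb InnerR (fun x ξ => jap x * ξ ^ 2) P :=
    ⟨sP, fun n => SymN.primitive n sP (fun ξ _ => by
      have : J 0 = 0 := by simpa using hJ 0
      simp [P, this, solS_zero]) (bP'.2 n)⟩
  have bP1 : Symb Overlap (fun _ _ => 1) (fun x ξ => 2 * P x ξ) := by
    refine ((bP.restrict overlap_subset_inner).const_mul oO 2).mono (K := 3) (by norm_num)
      fun x ξ hx => ?_
    have h1 := inner_jap_mul_le (overlap_subset_inner hx)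
    have h2 : 0 < ξ := hx.2.1
    have h3 : ξ < 3 / 2 := hx.2.2.2.2
    nlinarith
  -- the remainder of the expansion of the Jost solution
  have b1 : Symb Overlap (fun _ ξ => ξ ^ 2) (fun x ξ => Complex.exp (Complex.I * ((x * ξ : ℝ) : ℂ)) *
      (mJost f x ξ - (1 + Complex.I / ((x : ℂ) * ξ)))) :=
    (((symb_inner_comp_mul (contDiff_expI Complex.I)).restrict overlap_subset_inner).mul oO
      hf.symb_overlap).weight_eq fun _ _ _ => one_mul _
  have b2 := b1.add oO (b1.conj oO)
  have e2 : ∀ x ξ, (x, ξ) ∈ Overlap → f x ξ + (starRingEnd ℂ) (f x ξ) - 2 * J (x * ξ) =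
      Complex.exp (Complex.I * ((x * ξ : ℝ) : ℂ)) *
        (mJost f x ξ - (1 + Complex.I / ((x : ℂ) * ξ))) +
      (starRingEnd ℂ) (Complex.exp (Complex.I * ((x * ξ : ℝ) : ℂ)) *
        (mJost f x ξ - (1 + Complex.I / ((x : ℂ) * ξ)))) := fun x ξ hx => by
    have hy : ((x * ξ : ℝ) : ℂ) ≠ 0 := by
      exact_mod_cast (mul_pos hx.1 hx.2.1).ne'
    have hj := hJe (x * ξ)
    rw [mul_sub, ← f_eq_m, map_sub, ← Complex.ofReal_mul]
    have hc : (starRingEnd ℂ) (Complex.exp (Complex.I * ((x * ξ : ℝ) : ℂ)) *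
        (1 + Complex.I / ((x * ξ : ℝ) : ℂ))) = Complex.exp (-((x * ξ : ℝ) : ℂ) * Complex.I) *
        (1 - Complex.I / ((x * ξ : ℝ) : ℂ)) := by
      simp only [map_mul, ← Complex.exp_conj, map_add, map_one, map_div₀, Complex.conj_I,
        Complex.conj_ofReal]
      ring_nf
    rw [hc, mul_comm Complex.I]
    set y : ℂ := ((x * ξ : ℝ) : ℂ) with hydef
    have hJ2 : 2 * J (x * ξ) = 2 * (Complex.cos y - Complex.sin y / y) := by
      field_simp
      linear_combination hj
    rw [hJ2, Complex.cos, Complex.sin]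
    field_simp
    ring_nf
  have b3 : Symb Overlap (fun _ ξ => ξ ^ 2)
      (fun x ξ => f x ξ + (starRingEnd ℂ) (f x ξ) - 2 * J (x * ξ)) :=
    b2.congr oO fun x ξ hx => (e2 x ξ hx).symm
  have b4 : Symb Overlap (fun _ _ => 1) (fun x ξ =>
      (f x ξ + (starRingEnd ℂ) (f x ξ) - 2 * J (x * ξ)) * PDX (solS f) x ξ -
        PDX (fun x ξ => f x ξ + (starRingEnd ℂ) (f x ξ) - 2 * J (x * ξ)) x ξ * solS f x ξ) := by
    have hw : ∀ x ξ, (x, ξ) ∈ Overlap → ξ ^ 2 * jap x ≤ 3 * 1 := fun x ξ hx => by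
      have h1 := inner_jap_mul_le (overlap_subset_inner hx)
      have h2 : 0 < ξ := hx.2.1
      have h3 : ξ < 3 / 2 := hx.2.2.2.2
      nlinarith
    refine Symb.sub oO
      ((b3.mul oO (hf.symb_solS.2.restrict overlap_subset_inner)).mono (K := 3) (by norm_num) hw)
      (((b3.pdx oO).mul oO (hf.symb_solS.1.restrict overlap_subset_inner)).mono (K := 3)
        (by norm_num) fun x ξ hx => ?_)
    refine (le_of_eq ?_).trans (hw x ξ hx)
    have := (jap_pos x).ne'
    field_simp
  refine Symb.low_of_overlap (w := fun _ => 1)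
    (hf.isSol.smooth.at_zero.add hf.isSol.smooth.at_zero.conj) ((b4.add oO bP1).congr oO
    fun x ξ hx => ?_)
  have hξ : 0 < ξ := hx.2.1
  have e3 : PDX (fun x ξ => f x ξ + (starRingEnd ℂ) (f x ξ) - 2 * J (x * ξ)) x ξ =
      PDX f x ξ + (starRingEnd ℂ) (PDX f x ξ) - 2 * (ξ * J₁ (x * ξ)) :=
    (((hf.isSol.hasDerivAt hξ x).fun_add (hasDerivAt_conj (hf.isSol.hasDerivAt hξ x))).fun_sub
      ((d1 x ξ).const_mul 2)).deriv
  rw [e3]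
  simp only [P]
  linear_combination hf.wronskian_solS hξ x + hf.wronskian_conj_solS hξ x

lemma IsJost.low_R (hf : IsJost f) : Symb LowS (fun _ ξ => ξ) (fun _ ξ => Rcoef f ξ - 1) := by
  have o := isOpen_lowS
  have h1 : Symb LowS (fun _ ξ => ξ) (fun _ ξ => Tcoef f ξ) := hf.low_T.mono (K := 9 / 4) (by norm_num)
    fun x ξ h => by nlinarith [h.1, h.2, mul_pos h.1 h.1]
  refine (h1.sub o ((hf.low_re_zero.mul o hf.low_zero_inv).weight_eq fun _ _ _ => one_mul _)).congr o
    fun x ξ h => ?_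
  have := hf.zero_ne h.1
  rw [Rcoef]
  field_simp
  ring

/-- The half-plane of high frequencies. -/
def HighS : Set (ℝ × ℝ) := {p | p.2 ∈ Set.Ioi (1 : ℝ)}

lemma isOpen_highS : IsOpen HighS := isOpen_Ioi.preimage continuous_snd

lemma highS_pos {x ξ : ℝ} (h : (x, ξ) ∈ HighS) : 0 < ξ := one_pos.trans h

lemma highS_ne : ∀ p ∈ HighS, p.2 ≠ 0 := fun _ h => (highS_pos h).ne'

lemma jap_zero : jap 0 = 1 := by simp [jap]

lemma highS_outer {ξ : ℝ} (h : ξ ∈ Set.Ioi (1 : ℝ)) : ((0 : ℝ), ξ) ∈ Outer 1 :=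
  ⟨by norm_num, one_pos.trans h, by simpa [jap_zero] using h⟩

lemma mJost_zero : mJost f 0 ξ = f 0 ξ := by simp [mJost]

lemma IsJost.high_zero (hf : IsJost f) : Symb HighS (fun _ ξ => ξ⁻¹) (fun _ ξ => f 0 ξ - 1) :=
  (((hf.symb_outer one_pos le_rfl).at_zero fun _ h => highS_outer h).weight_eq
    fun x ξ _ => by rw [jap_zero, one_mul]).congr isOpen_highS fun x ξ _ => by rw [mJost_zero]

lemma isOpen_outer_one : IsOpen (Outer 1) := isOpen_outer 1

lemma IsJost.high_pdx_m (hf : IsJost f) :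
    Symb HighS (fun _ ξ => ξ⁻¹) (fun _ ξ => PDX (mJost f) 0 ξ) := by
  refine ((((hf.symb_outer one_pos le_rfl).pdx isOpen_outer_one).at_zero
    fun _ h => highS_outer h).weight_eq fun x ξ _ => by rw [jap_zero, one_mul, div_one]).congr
    isOpen_highS fun x ξ _ => ?_
  exact deriv_sub_const (f := fun y => mJost f y ξ) 1

lemma IsJost.pdx_zero_eq (hf : IsJost f) (hξ : 0 < ξ) :
    PDX f 0 ξ = Complex.I * (ξ * f 0 ξ) + PDX (mJost f) 0 ξ := by
  have h1 : HasDerivAt (fun t : ℝ => Complex.exp (-(Complex.I) * t * ξ)) (-(Complex.I) * ξ) 0 := by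
    have := (((Complex.ofRealCLM.hasDerivAt (x := (0 : ℝ))).const_mul (-Complex.I)).mul_const
      (ξ : ℂ)).cexp
    simpa using this
  have h2 : PDX (mJost f) 0 ξ = _ := (h1.fun_mul (hf.isSol.hasDerivAt hξ 0)).deriv
  rw [h2]
  simp
  ring

lemma symb_high_right : Symb HighS (fun _ ξ => ξ) (fun _ ξ => (ξ : ℂ)) :=
  (symb_right highS_ne).weight_eq fun _ _ h => abs_of_pos (highS_pos h)

lemma high_inv_le_one {x ξ : ℝ} (h : (x, ξ) ∈ HighS) : ξ⁻¹ ≤ 1 := inv_le_one_of_one_le₀ (le_of_lt h)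

lemma IsJost.high_zero_bdd (hf : IsJost f) : Symb HighS (fun _ _ => 1) (fun _ ξ => f 0 ξ) :=
  ((hf.high_zero.mono_le fun _ _ h => high_inv_le_one h).add isOpen_highS (Symb.const 1)).congr
    isOpen_highS fun _ _ _ => sub_add_cancel _ _

lemma IsJost.high_pdx_zero (hf : IsJost f) : Symb HighS (fun _ ξ => ξ) (fun _ ξ => PDX f 0 ξ) := by
  have o := isOpen_highS
  refine (Symb.add o (((symb_high_right.mul o hf.high_zero_bdd).weight_eq fun _ _ _ =>
    mul_one _).const_mul o Complex.I) (hf.high_pdx_m.mono_le fun x ξ h =>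
      (high_inv_le_one h).trans (le_of_lt h))).congr o fun x ξ h => (hf.pdx_zero_eq (highS_pos h)).symm

lemma IsJost.exists_high_lower (hf : IsJost f) : ∃ c : ℝ, 0 < c ∧ ∀ ξ : ℝ, 1 < ξ →
    c * 1 ≤ ‖f 0 ξ‖ ∧ c * ξ ≤ ‖PDX f 0 ξ‖ := by
  obtain ⟨A, hA, ha⟩ := (hf.high_zero.2 0).bdd
  obtain ⟨B, hB, hb⟩ := (hf.high_pdx_m.2 0).bdd
  set K := 4 * (A + B + 1) with hK
  obtain ⟨c₁, h1, hc1⟩ := exists_pos_le_norm hf.isSol.smooth.at_zero.continuousOn_right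
    (fun ξ hξ => hf.zero_ne hξ) (α := 1) (β := K) one_pos
  obtain ⟨c₂, h2, hc2⟩ := exists_pos_le_norm
    (hf.isSol.smooth.pdx upper_open).at_zero.continuousOn_right
    (fun ξ hξ => hf.pdx_zero_ne hξ) (α := 1) (β := K) one_pos
  have hKp : 0 < K := by positivity
  refine ⟨min (min c₁ (c₂ / K)) (1 / 4), by positivity, fun ξ hξ => ?_⟩
  have hξ0 : 0 < ξ := one_pos.trans hξ
  rcases le_total ξ K with h | h
  · refine ⟨?_, ?_⟩
    · rw [mul_one]
      exact ((min_le_left _ _).trans (min_le_left _ _)).trans (hc1 ξ ⟨hξ.le, h⟩)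
    · calc _ ≤ c₂ / K * ξ := mul_le_mul_of_nonneg_right
            ((min_le_left _ _).trans (min_le_right _ _)) hξ0.le
        _ ≤ c₂ / K * K := by gcongr
        _ = c₂ := div_mul_cancel₀ _ hKp.ne'
        _ ≤ _ := hc2 ξ ⟨hξ.le, h⟩
  · have ha := ha 0 ξ hξ
    have hb := hb 0 ξ hξ
    simp only at ha hb
    have hi : A * ξ⁻¹ ≤ 1 / 4 := by
      rw [← div_eq_mul_inv, div_le_iff₀ hξ0]; linarith
    have hi2 : B * ξ⁻¹ ≤ 1 / 4 := by
      rw [← div_eq_mul_inv, div_le_iff₀ hξ0]; linarith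
    have hn : 3 / 4 ≤ ‖f 0 ξ‖ := by
      have := norm_sub_norm_le (1 : ℂ) (1 - f 0 ξ)
      rw [norm_one, sub_sub_cancel, norm_sub_rev] at this
      linarith
    have hm : min (min c₁ (c₂ / K)) (1 / 4) ≤ 1 / 4 := min_le_right _ _
    refine ⟨by linarith, ?_⟩
    have h3 : ξ * (3 / 4) - 1 / 4 ≤ ‖PDX f 0 ξ‖ := by
      rw [hf.pdx_zero_eq hξ0]
      have := norm_sub_le_norm_add (Complex.I * (ξ * f 0 ξ)) (PDX (mJost f) 0 ξ)
      rw [norm_mul, norm_mul, Complex.norm_I, one_mul, Complex.norm_real,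
        Real.norm_of_nonneg hξ0.le] at this
      nlinarith
    nlinarith

lemma IsJost.high_zero_inv (hf : IsJost f) : Symb HighS (fun _ _ => 1) (fun _ ξ => (f 0 ξ)⁻¹) := by
  obtain ⟨c, hc, h⟩ := hf.exists_high_lower
  exact (hf.high_zero_bdd.inv isOpen_highS hc (fun _ _ _ => one_pos)
    fun x ξ hx => (h ξ hx).1).weight_eq fun _ _ _ => inv_one

lemma IsJost.high_pdx_zero_inv (hf : IsJost f) :
    Symb HighS (fun _ ξ => ξ⁻¹) (fun _ ξ => (PDX f 0 ξ)⁻¹) := by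
  obtain ⟨c, hc, h⟩ := hf.exists_high_lower
  exact hf.high_pdx_zero.inv isOpen_highS hc (fun _ _ h => highS_pos h) fun x ξ hx => (h ξ hx).2

lemma IsJost.high_quot (hf : IsJost f) :
    Symb HighS (fun _ ξ => ξ⁻¹) (fun _ ξ => (starRingEnd ℂ) (f 0 ξ) / f 0 ξ - 1) := by
  have o := isOpen_highS
  refine ((((hf.high_zero.conj o).sub o hf.high_zero).mul o hf.high_zero_inv).weight_eq
    fun _ _ _ => mul_one _).congr o fun x ξ h => ?_
  have := hf.zero_ne (highS_pos h)
  rw [map_sub, map_one]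
  field_simp
  ring

lemma IsJost.high_quot_pdx (hf : IsJost f) :
    Symb HighS (fun _ ξ => ξ⁻¹) (fun _ ξ => (starRingEnd ℂ) (PDX f 0 ξ) / PDX f 0 ξ + 1) := by
  have o := isOpen_highS
  have h1 : Symb HighS (fun _ _ => 1)
      (fun _ ξ => PDX f 0 ξ + (starRingEnd ℂ) (PDX f 0 ξ)) := by
    have h2 := ((symb_high_right.mul o (hf.high_zero.sub o (hf.high_zero.conj o))).const_mul o
      Complex.I).weight_eq (w' := fun _ _ => 1) fun x ξ h => mul_inv_cancel₀ (highS_pos h).ne'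
    have h3 := (hf.high_pdx_m.add o (hf.high_pdx_m.conj o)).mono_le (w' := fun _ _ => 1)
      fun x ξ h => high_inv_le_one h
    refine (h2.add o h3).congr o fun x ξ h => ?_
    rw [hf.pdx_zero_eq (highS_pos h)]
    simp only [map_sub, map_one, map_add, map_mul, Complex.conj_I, Complex.conj_ofReal]
    ring
  refine ((h1.mul o hf.high_pdx_zero_inv).weight_eq fun _ _ _ => one_mul _).congr o fun x ξ h => ?_
  have := hf.pdx_zero_ne (highS_pos h)
  field_simp
  ring

lemma IsJost.high_T (hf : IsJost f) : Symb HighS (fun _ ξ => ξ⁻¹) (fun _ ξ => Tcoef f ξ - 1) := by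
  have o := isOpen_highS
  refine ((hf.high_quot.sub o hf.high_quot_pdx).const_mul o (1 / 2)).congr o fun x ξ h => ?_
  have hξ := highS_pos h
  have h0 := hf.zero_ne hξ
  have h1 := hf.pdx_zero_ne hξ
  rw [hf.tcoef_eq hξ]
  field_simp
  linear_combination - hf.wronskian_conj hξ 0

lemma IsJost.high_R (hf : IsJost f) : Symb HighS (fun _ ξ => ξ⁻¹) (fun _ ξ => Rcoef f ξ) := by
  have o := isOpen_highS
  refine (hf.high_T.sub o hf.high_quot).congr o fun x ξ h => ?_
  rw [Rcoef]
  ring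

end scattering

/-- The weight `L² / (1 + L³)` with `L = ⟨x⟩|ξ|`. -/
def coefWeight (x ξ : ℝ) : ℝ := (jap x * |ξ|) ^ 2 / (1 + (jap x * |ξ|) ^ 3)

lemma jap_mul_abs_nonneg (x ξ : ℝ) : 0 ≤ jap x * |ξ| := mul_nonneg (jap_pos x).le (abs_nonneg ξ)

lemma coefWeight_nonneg (x ξ : ℝ) : 0 ≤ coefWeight x ξ := by
  have := jap_mul_abs_nonneg x ξ
  unfold coefWeight
  positivity

lemma coefWeight_neg (x ξ : ℝ) : coefWeight (-x) (-ξ) = coefWeight x ξ := by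
  simp [coefWeight, jap_neg]

lemma inv_le_coefWeight {c x ξ : ℝ} (hc : 0 < c) (hξ : 0 < ξ) (h : c ≤ jap x * ξ) :
    (jap x * ξ)⁻¹ ≤ (1 + (c ^ 3)⁻¹) * coefWeight x ξ := by
  rw [coefWeight, abs_of_pos hξ]
  set L := jap x * ξ
  have hL : 0 < L := hc.trans_le h
  rw [mul_div_assoc', le_div_iff₀ (by positivity), inv_mul_le_iff₀ hL]
  have h3 : c ^ 3 ≤ L ^ 3 := pow_le_pow_left₀ hc.le h 3
  have h4 : 1 ≤ (c ^ 3)⁻¹ * L ^ 3 := by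
    rw [le_inv_mul_iff₀ (by positivity)]; linarith
  nlinarith

lemma sq_le_coefWeight {x ξ : ℝ} (hξ : 0 < ξ) (h : jap x * ξ ≤ 2) :
    ξ ^ 2 * jap x ^ 2 ≤ 9 * coefWeight x ξ := by
  rw [coefWeight, abs_of_pos hξ]
  have hL : 0 < jap x * ξ := mul_pos (jap_pos x) hξ
  rw [show ξ ^ 2 * jap x ^ 2 = (jap x * ξ) ^ 2 by ring]
  generalize jap x * ξ = L at *
  rw [mul_div_assoc', le_div_iff₀ (by positivity)]
  have h3 : L ^ 3 ≤ 8 := by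
    calc L ^ 3 ≤ 2 ^ 3 := pow_le_pow_left₀ hL.le h 3
      _ = 8 := by norm_num
  nlinarith [sq_nonneg L]

/-- The derivative bounds satisfied by the coefficients. -/
def Good (V : Set (ℝ × ℝ)) (F : ℝ → ℝ → ℂ) : Prop :=
  Smooth2 V F ∧ Symb V (fun x ξ => coefWeight x ξ / jap x) (PDX F) ∧
    Symb V (fun x ξ => (1 + ξ ^ 2)⁻¹ + coefWeight x ξ / |ξ|) (PDXI F)

section good
variable {U V V₁ V₂ : Set (ℝ × ℝ)} {F G : ℝ → ℝ → ℂ}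

lemma Good.of_symb (hV : IsOpen V) (h : Symb V coefWeight F) : Good V F :=
  ⟨h.1, h.pdx hV, (h.pdxi hV).mono_le fun x ξ _ => le_add_of_nonneg_left (by positivity)⟩

lemma Good.of_right {φ : ℝ → ℂ} (hs : Smooth2 V fun _ ξ => φ ξ)
    (h : Symb V (fun _ ξ => (1 + ξ ^ 2)⁻¹) (PDXI fun _ ξ => φ ξ)) : Good V fun _ ξ => φ ξ := by
  refine ⟨hs, ?_, h.mono_le fun x ξ _ => le_add_of_nonneg_right
    (div_nonneg (coefWeight_nonneg x ξ) (abs_nonneg ξ))⟩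
  have : PDX (fun _ ξ => φ ξ) = fun _ _ => 0 := by
    funext x ξ
    exact deriv_const x (φ ξ)
  rw [this]
  exact Symb.zero

lemma Good.const (c : ℂ) : Good V fun _ _ => c := by
  refine Good.of_right (φ := fun _ => c) (Smooth2.const c) ?_
  have : PDXI (fun _ _ => c) = fun _ _ => 0 := by
    funext x ξ
    exact deriv_const ξ c
  rw [this]
  exact Symb.zero

lemma Good.congr (hV : IsOpen V) (hF : Good V F) (h : ∀ x ξ, (x, ξ) ∈ V → F x ξ = G x ξ) :
    Good V G :=
  ⟨hF.1.congr h, hF.2.1.congr hV fun _ _ hx => PDX_congr hV h hx,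
    hF.2.2.congr hV fun _ _ hx => PDXI_congr hV h hx⟩

lemma Good.add (hV : IsOpen V) (hF : Good V F) (hG : Good V G) :
    Good V fun x ξ => F x ξ + G x ξ :=
  ⟨hF.1.add hG.1,
    (hF.2.1.add hV hG.2.1).congr hV fun _ _ hx =>
      (((hF.1.hasDerivAt_left hV hx).add (hG.1.hasDerivAt_left hV hx)).deriv).symm,
    (hF.2.2.add hV hG.2.2).congr hV fun _ _ hx =>
      (((hF.1.hasDerivAt_right hV hx).add (hG.1.hasDerivAt_right hV hx)).deriv).symm⟩

lemma Good.const_mul (hV : IsOpen V) (c : ℂ) (hF : Good V F) : Good V fun x ξ => c * F x ξ :=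
  ⟨(Smooth2.const c).mul hF.1,
    (hF.2.1.const_mul hV c).congr hV fun _ _ hx =>
      (((hF.1.hasDerivAt_left hV hx).const_mul c).deriv).symm,
    (hF.2.2.const_mul hV c).congr hV fun _ _ hx =>
      (((hF.1.hasDerivAt_right hV hx).const_mul c).deriv).symm⟩

lemma Smooth2.union (o₁ : IsOpen V₁) (o₂ : IsOpen V₂) (h₁ : Smooth2 V₁ F) (h₂ : Smooth2 V₂ F)
    (hU : ∀ p ∈ U, p ∈ V₁ ∨ p ∈ V₂) : Smooth2 U F := fun p hp =>
  (hU p hp).elim (fun h => (h₁.contDiffAt (o₁.mem_nhds h)).contDiffWithinAt)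
    fun h => (h₂.contDiffAt (o₂.mem_nhds h)).contDiffWithinAt

lemma Good.union (o₁ : IsOpen V₁) (o₂ : IsOpen V₂) (h₁ : Good V₁ F) (h₂ : Good V₂ F)
    (hU : ∀ p ∈ U, p ∈ V₁ ∨ p ∈ V₂) : Good U F :=
  ⟨h₁.1.union o₁ o₂ h₂.1 hU,
    h₁.2.1.union o₁ o₂ h₂.2.1 hU fun x ξ _ => div_nonneg (coefWeight_nonneg x ξ) (jap_pos x).le,
    h₁.2.2.union o₁ o₂ h₂.2.2 hU fun x ξ _ =>
      add_nonneg (by positivity) (div_nonneg (coefWeight_nonneg x ξ) (abs_nonneg ξ))⟩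

lemma Good.restrict (h : Good U F) (hV : V ⊆ U) : Good V F :=
  ⟨h.1.restrict hV, h.2.1.restrict hV, h.2.2.restrict hV⟩

lemma Good.reflect (hU : IsOpen U) (h : Good U F) :
    Good {p | (-p.1, -p.2) ∈ U} fun x ξ => F (-x) (-ξ) := by
  have o : IsOpen {p : ℝ × ℝ | (-p.1, -p.2) ∈ U} :=
    hU.preimage (continuous_fst.neg.prodMk continuous_snd.neg)
  have r {w : ℝ → ℝ → ℝ} {G : ℝ → ℝ → ℂ} (hG : Symb U w G) :
      Symb {p | (-p.1, -p.2) ∈ U} (fun x ξ => w (-x) (-ξ)) fun x ξ => G (-x) (-ξ) := by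
    have := hG.reflect (-1) (-1) (Or.inr rfl) (Or.inr rfl)
    simpa only [neg_mul, one_mul] using this
  refine ⟨?_, ?_, ?_⟩
  · exact ContDiffOn.comp (g := fun p : ℝ × ℝ => F p.1 p.2) h.1
      (contDiff_fst.neg.prodMk contDiff_snd.neg).contDiffOn fun p hp => hp
  · refine (((r h.2.1).neg o).weight_eq fun x ξ _ => ?_).congr o fun x ξ _ => ?_
    · rw [coefWeight_neg, jap_neg]
    · exact (deriv_comp_neg (fun y => F y (-ξ)) x).symm
  · refine (((r h.2.2).neg o).weight_eq fun x ξ _ => ?_).congr o fun x ξ _ => ?_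
    · rw [coefWeight_neg, abs_neg, neg_sq]
    · exact (deriv_comp_neg (fun y => F (-x) y) ξ).symm

end good

section coefficients

variable {f : ℝ → ℝ → ℂ} {x ξ : ℝ}

lemma upper_cover : ∀ p ∈ Upper, p ∈ LowS ∨ p ∈ HighS := fun p hp => by
  rcases lt_or_ge p.2 (3 / 2) with h | h
  · exact Or.inl ⟨hp, h⟩
  · exact Or.inr (lt_of_lt_of_le (by norm_num) h)

lemma IsJost.symb_T (hf : IsJost f) : Symb Upper (fun _ _ => 1) fun _ ξ => Tcoef f ξ := by
  refine Symb.union isOpen_lowS isOpen_highS (hf.low_T.mono (K := 4) (by norm_num) ?_) ?_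
    upper_cover fun _ _ _ => zero_le_one
  · intro x ξ h
    have := pow_le_pow_left₀ h.1.le h.2.le 3
    norm_num at this ⊢
    linarith
  · exact ((hf.high_T.mono_le fun x ξ h => high_inv_le_one h).add isOpen_highS
      (Symb.const 1)).congr isOpen_highS fun x ξ _ => by ring

lemma IsJost.symb_R (hf : IsJost f) : Symb Upper (fun _ _ => 1) fun _ ξ => Rcoef f ξ := by
  refine Symb.union isOpen_lowS isOpen_highS ?_ (hf.high_R.mono_le fun x ξ h => high_inv_le_one h)
    upper_cover fun _ _ _ => zero_le_one
  exact ((hf.low_R.mono (K := 3 / 2) (w' := fun _ _ => 1) (by norm_num) fun x ξ h => by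
    linarith [h.2]).add isOpen_lowS (Symb.const 1)).congr isOpen_lowS fun x ξ _ => by ring

lemma low_weight_le {x ξ : ℝ} (h : (x, ξ) ∈ LowS) : 1 ≤ 4 * (1 + ξ ^ 2)⁻¹ := by
  rw [← div_eq_mul_inv, le_div_iff₀ (by positivity)]
  nlinarith [h.1, h.2]

lemma high_weight_le {x ξ : ℝ} (h : (x, ξ) ∈ HighS) : ξ⁻¹ / |ξ| ≤ 2 * (1 + ξ ^ 2)⁻¹ := by
  have h1 : 1 < ξ := h
  rw [abs_of_pos (highS_pos h), ← div_eq_mul_inv, inv_eq_one_div, div_div,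
    div_le_div_iff₀ (by positivity) (by positivity)]
  nlinarith

lemma PDXI_sub_const {φ : ℝ → ℂ} (c : ℂ) :
    PDXI (fun _ ξ => φ ξ - c) = PDXI fun _ ξ => φ ξ := by
  funext x ξ
  exact deriv_sub_const c

lemma good_right {φ : ℝ → ℂ} (hs : Smooth2 Upper fun _ ξ => φ ξ) {w : ℝ → ℝ} (c d : ℂ)
    (hw : ∀ ξ ∈ Set.Ioo (0 : ℝ) (3 / 2), w ξ ≤ 4 * ξ)
    (hl : Symb LowS (fun _ ξ => w ξ) fun _ ξ => φ ξ - c)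
    (hh : Symb HighS (fun _ ξ => ξ⁻¹) fun _ ξ => φ ξ - d) : Good Upper fun _ ξ => φ ξ := by
  refine Good.of_right hs ?_
  refine Symb.union isOpen_lowS isOpen_highS ?_ ?_ upper_cover fun _ _ _ => by positivity
  · rw [← PDXI_sub_const c]
    refine (hl.pdxi isOpen_lowS).mono (K := 16) (by norm_num) fun x ξ h => ?_
    have h1 : w ξ / |ξ| ≤ 4 := by
      rw [abs_of_pos h.1, div_le_iff₀ h.1]
      exact hw ξ h
    linarith [low_weight_le h]
  · rw [← PDXI_sub_const d]
    exact (hh.pdxi isOpen_highS).mono (K := 2) (by norm_num) fun x ξ h => high_weight_le h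

lemma IsJost.good_T (hf : IsJost f) : Good Upper fun _ ξ => Tcoef f ξ :=
  good_right hf.smooth_T 0 1
    (fun ξ h => by
      have : ξ ^ 2 ≤ 4 := by nlinarith [h.1, h.2]
      nlinarith [h.1])
    (hf.low_T.congr isOpen_lowS fun _ _ _ => (sub_zero _).symm) hf.high_T

lemma IsJost.good_R (hf : IsJost f) : Good Upper fun _ ξ => Rcoef f ξ :=
  good_right hf.smooth_R 1 0 (fun ξ h => by linarith [h.1]) hf.low_R
    (hf.high_R.congr isOpen_highS fun _ _ _ => (sub_zero _).symm)

/-- A smooth cutoff, equal to `1` for `z ≤ -1/5` and to `0` for `z ≥ -1/10`. -/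
def leftCut (z : ℝ) : ℂ := (Real.smoothTransition (-10 * z - 1) : ℝ)

lemma leftCut_zero {z : ℝ} (h : -(1 / 10) ≤ z) : leftCut z = 0 := by
  rw [leftCut, Real.smoothTransition.zero_of_nonpos (by linarith), Complex.ofReal_zero]

lemma leftCut_one {z : ℝ} (h : z ≤ -(1 / 5)) : leftCut z = 1 := by
  rw [leftCut, Real.smoothTransition.one_of_one_le (by linarith), Complex.ofReal_one]

lemma contDiff_leftCut : ContDiff ℝ (⊤ : ℕ∞) leftCut :=
  Complex.ofRealCLM.contDiff.comp
    (Real.smoothTransition.contDiff.comp ((contDiff_const.mul contDiff_id).sub contDiff_const))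

lemma conj_leftCut (z : ℝ) : (starRingEnd ℂ) (leftCut z) = leftCut z := Complex.conj_ofReal _

/-- The phase-space variable `x ξ / ⟨ξ⟩`. -/
def cutVar (x ξ : ℝ) : ℝ := x * lam ξ

lemma continuous_cutVar : Continuous fun p : ℝ × ℝ => cutVar p.1 p.2 :=
  continuous_fst.mul (contDiff_lam.continuous.comp continuous_snd)

lemma lam_pos (h : 0 < ξ) : 0 < lam ξ := div_pos h (jap_pos ξ)

lemma lam_le (h : 0 < ξ) : lam ξ ≤ ξ := div_le_self h.le (one_le_jap ξ)

lemma lam_le_one : lam ξ ≤ 1 :=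
  (div_le_one (jap_pos ξ)).2 ((le_abs_self ξ).trans (abs_le_jap ξ))

/-- The part of phase space to the right of the cutoff region. -/
def RightS : Set (ℝ × ℝ) := {p | 0 < p.2 ∧ -(1 / 10) < cutVar p.1 p.2}
/-- The part of phase space to the left of the cutoff region. -/
def LeftS : Set (ℝ × ℝ) := {p | 0 < p.2 ∧ cutVar p.1 p.2 < -(1 / 20)}
/-- The part of phase space where the cutoff equals `1`. -/
def FarLeft : Set (ℝ × ℝ) := {p | 0 < p.2 ∧ cutVar p.1 p.2 < -(1 / 5)}
/-- The part of phase space to the right of the central region. -/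
def FarRight : Set (ℝ × ℝ) := {p | 0 < p.2 ∧ 1 / 20 < cutVar p.1 p.2}
/-- The central region at low frequency. -/
def MidLow : Set (ℝ × ℝ) := {p | p ∈ LowS ∧ |cutVar p.1 p.2| < 1 / 4}
/-- The central region at high frequency. -/
def MidHigh : Set (ℝ × ℝ) := {p | p ∈ HighS ∧ |cutVar p.1 p.2| < 1 / 4}

lemma isOpen_rightS : IsOpen RightS := upper_open.inter (isOpen_lt continuous_const continuous_cutVar)
lemma isOpen_leftS : IsOpen LeftS := upper_open.inter (isOpen_lt continuous_cutVar continuous_const)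
lemma isOpen_farLeft : IsOpen FarLeft :=
  upper_open.inter (isOpen_lt continuous_cutVar continuous_const)
lemma isOpen_farRight : IsOpen FarRight :=
  upper_open.inter (isOpen_lt continuous_const continuous_cutVar)
lemma isOpen_midLow : IsOpen MidLow :=
  isOpen_lowS.inter (isOpen_lt continuous_cutVar.abs continuous_const)
lemma isOpen_midHigh : IsOpen MidHigh :=
  isOpen_highS.inter (isOpen_lt continuous_cutVar.abs continuous_const)

lemma left_right_cover : ∀ p ∈ Upper, p ∈ LeftS ∨ p ∈ RightS := fun p hp => by
  rcases lt_or_ge (cutVar p.1 p.2) (-(1 / 20)) with h | h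
  · exact Or.inl ⟨hp, h⟩
  · exact Or.inr ⟨hp, lt_of_lt_of_le (by norm_num) h⟩

lemma left_neg (h : (x, ξ) ∈ LeftS) : x < 0 ∧ 1 / 20 < jap x * ξ := by
  have h1 : x * lam ξ < -(1 / 20) := h.2
  have hl := lam_pos h.1
  have hx : x < 0 := by
    by_contra hx
    have := mul_nonneg (not_lt.1 hx) hl.le
    linarith
  refine ⟨hx, ?_⟩
  have h2 := mul_le_mul (abs_le_jap x) (lam_le h.1) hl.le (jap_pos x).le
  rw [abs_of_neg hx] at h2
  linarith

lemma farRight_pos (h : (x, ξ) ∈ FarRight) : 0 < x ∧ 1 / 20 < jap x * ξ := by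
  have h1 : 1 / 20 < x * lam ξ := h.2
  have hl := lam_pos h.1
  have hx : 0 < x := by
    by_contra hx
    have := mul_nonpos_of_nonpos_of_nonneg (not_lt.1 hx) hl.le
    linarith
  refine ⟨hx, ?_⟩
  have h2 := mul_le_mul (abs_le_jap x) (lam_le h.1) hl.le (jap_pos x).le
  rw [abs_of_pos hx] at h2
  linarith

lemma midLow_subset_inner : MidLow ⊆ InnerR := fun p h => by
  have h0 : 0 < p.2 := h.1.1
  have h1 : p.2 < 3 / 2 := h.1.2
  refine ⟨h0, h1, ?_⟩
  have h2 : |p.1| * lam p.2 < 1 / 4 := by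
    have := h.2
    rwa [cutVar, abs_mul, abs_of_pos (lam_pos h0)] at this
  have hj : jap p.2 < 2 := by
    by_contra hj
    have := jap_sq p.2
    nlinarith [not_lt.1 hj]
  have h3 : |p.1| * p.2 = |p.1| * lam p.2 * jap p.2 := by
    rw [lam, mul_assoc, div_mul_cancel₀ _ (jap_pos _).ne']
  rw [h3]
  have := mul_nonneg (abs_nonneg p.1) (lam_pos h0).le
  nlinarith [jap_pos p.2]

lemma midHigh_abs (h : (x, ξ) ∈ MidHigh) : |x| < 1 / 2 := by
  have h1 : 1 < ξ := h.1
  have h0 : 0 < ξ := highS_pos h.1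
  have h2 : |x| * lam ξ < 1 / 4 := by
    have := h.2
    rwa [cutVar, abs_mul, abs_of_pos (lam_pos h0)] at this
  have hl : 1 / 2 ≤ lam ξ := by
    rw [lam, le_div_iff₀ (jap_pos ξ)]
    have := jap_sq ξ
    nlinarith [jap_pos ξ]
  nlinarith [abs_nonneg x]

lemma midHigh_outer : MidHigh ⊆ Outer 1 := fun p h => by
  have h1 : 1 < p.2 := h.1
  have := abs_lt.1 (midHigh_abs (x := p.1) (ξ := p.2) h)
  exact ⟨by linarith, by linarith, by nlinarith [one_le_jap p.1]⟩

lemma symb_cutVar {U : Set (ℝ × ℝ)} (hU : IsOpen U) (hU0 : U ⊆ Upper)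
    (h : ∀ x ξ, (x, ξ) ∈ U → |cutVar x ξ| ≤ 1 / 4) :
    Symb U (fun _ _ => 1) fun x ξ => (cutVar x ξ : ℂ) := by
  refine ((symb_left.mul hU (symb_lam hU fun p hp => (hU0 hp).ne')).mono (K := 5 / 4)
    (by norm_num) fun x ξ hx => ?_).congr hU fun x ξ _ => ?_
  · have h0 : 0 < ξ := hU0 hx
    have h1 := h x ξ hx
    rw [cutVar, abs_mul, abs_of_pos (lam_pos h0)] at h1
    have h2 : |ξ| / jap ξ = lam ξ := by rw [abs_of_pos h0, lam]
    rw [h2]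
    nlinarith [jap_le x, lam_pos h0, lam_le_one (ξ := ξ)]
  · rw [cutVar, Complex.ofReal_mul]

lemma symb_leftCut : Symb Upper (fun _ _ => 1) fun x ξ => leftCut (cutVar x ξ) := by
  have o : IsOpen {p : ℝ × ℝ | 0 < p.2 ∧ |cutVar p.1 p.2| < 1 / 4} :=
    upper_open.inter (isOpen_lt continuous_cutVar.abs continuous_const)
  have h1 : Symb {p : ℝ × ℝ | 0 < p.2 ∧ |cutVar p.1 p.2| < 1 / 4} (fun _ _ => 1)
      fun x ξ => leftCut (cutVar x ξ) :=
    Symb.comp o (symb_cutVar o (fun p hp => hp.1) fun x ξ hx => hx.2.le) contDiff_leftCut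
  have h2 : Symb FarLeft (fun _ _ => 1) fun x ξ => leftCut (cutVar x ξ) :=
    (Symb.const 1).congr isOpen_farLeft fun x ξ hx => (leftCut_one hx.2.le).symm
  have h3 : Symb RightS (fun _ _ => 1) fun x ξ => leftCut (cutVar x ξ) :=
    Symb.zero.congr isOpen_rightS fun x ξ hx => (leftCut_zero hx.2.le).symm
  refine Symb.union o (isOpen_farLeft.union isOpen_rightS) h1
    (Symb.union isOpen_farLeft isOpen_rightS h2 h3 (fun p hp => hp) fun _ _ _ => zero_le_one)
    (fun p hp => ?_) fun _ _ _ => zero_le_one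
  rcases lt_or_ge |cutVar p.1 p.2| (1 / 4) with h | h
  · exact Or.inl ⟨hp, h⟩
  · rcases le_abs.1 h with h | h
    · exact Or.inr (Or.inr ⟨hp, by linarith⟩)
    · exact Or.inr (Or.inl ⟨hp, by linarith⟩)

lemma symb_rightCut : Symb Upper (fun _ _ => 1) fun x ξ => 1 - leftCut (cutVar x ξ) :=
  (Symb.const 1).sub upper_open symb_leftCut

lemma IsJost.symb_left (hf : IsJost f) :
    Symb LeftS coefWeight fun x ξ => mJost f (-x) ξ - 1 := by
  have h := (hf.symb_outer (c := 1 / 20) (by norm_num) (by norm_num)).reflect_left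
  refine (h.restrict fun p hp => ?_).mono (K := 1 + ((1 / 20 : ℝ) ^ 3)⁻¹) (by norm_num) ?_
  · have := left_neg (x := p.1) (ξ := p.2) hp
    exact ⟨by linarith, hp.1, by rw [jap_neg]; exact this.2⟩
  · intro x ξ hx
    rw [jap_neg]
    exact inv_le_coefWeight (by norm_num) hx.1 (left_neg hx).2.le

lemma IsJost.symb_cut_m (hf : IsJost f) :
    Symb Upper coefWeight fun x ξ => leftCut (cutVar x ξ) * (mJost f (-x) ξ - 1) := by
  refine Symb.union isOpen_leftS isOpen_rightS ?_ ?_ left_right_cover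
    fun x ξ _ => coefWeight_nonneg x ξ
  · exact ((symb_leftCut.restrict fun p hp => hp.1).mul isOpen_leftS hf.symb_left).weight_eq
      fun x ξ _ => one_mul _
  · exact Symb.zero.congr isOpen_rightS fun x ξ hx => by rw [leftCut_zero hx.2.le, zero_mul]

lemma midLow_leftCut : Symb MidLow coefWeight fun x ξ => leftCut (cutVar x ξ) := by
  have o : IsOpen (MidLow ∩ LeftS) := isOpen_midLow.inter isOpen_leftS
  refine Symb.union (V₁ := MidLow ∩ LeftS) o isOpen_rightS ?_
    (Symb.zero.congr isOpen_rightS fun x ξ hx => (leftCut_zero hx.2.le).symm)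
    (fun p hp => (left_right_cover p hp.1.1).imp (fun h => ⟨hp, h⟩) id)
    fun x ξ _ => coefWeight_nonneg x ξ
  refine (symb_leftCut.restrict fun p hp => hp.2.1).mono (K := 3600) (by norm_num) fun x ξ hx => ?_
  have h1 := (left_neg hx.2).2
  have h2 := sq_le_coefWeight hx.2.1 (inner_jap_mul_le (midLow_subset_inner hx.1))
  have h3 : 1 ≤ 400 * (ξ ^ 2 * jap x ^ 2) := by nlinarith
  linarith

/-- The leading part of the first coefficient. -/
def coefMain (f : ℝ → ℝ → ℂ) (x ξ : ℝ) : ℂ :=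
  (1 - leftCut (cutVar x ξ)) * (Tcoef f ξ * mJost f x ξ) + leftCut (cutVar x ξ)

lemma IsJost.symb_tail (hf : IsJost f) {V : Set (ℝ × ℝ)} (hV : IsOpen V) {c : ℝ} (hc : 0 < c)
    (hc1 : c ≤ 1) (h : V ⊆ Outer c) :
    Symb V coefWeight fun x ξ => Tcoef f ξ * (mJost f x ξ - 1) := by
  refine (((hf.symb_T.restrict fun p hp => (h hp).2.1).mul hV
    ((hf.symb_outer hc hc1).restrict h)).mono (K := 1 + (c ^ 3)⁻¹) (by positivity) fun x ξ hx => ?_)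
  rw [one_mul]
  exact inv_le_coefWeight hc (h hx).2.1 (h hx).2.2.le

lemma IsJost.good_farRight (hf : IsJost f) : Good FarRight (coefMain f) := by
  have h1 : Good FarRight fun x ξ => Tcoef f ξ * (mJost f x ξ - 1) :=
    Good.of_symb isOpen_farRight <| hf.symb_tail isOpen_farRight (c := 1 / 20) (by norm_num)
      (by norm_num) fun p hp => by
        have := farRight_pos (x := p.1) (ξ := p.2) hp
        exact ⟨by linarith, hp.1, this.2⟩
  refine ((hf.good_T.restrict fun p hp => hp.1).add isOpen_farRight h1).congr isOpen_farRight
    fun x ξ hx => ?_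
  rw [coefMain, leftCut_zero (by linarith [hx.2])]
  ring

lemma good_farLeft : Good FarLeft (coefMain f) :=
  (Good.const 1).congr isOpen_farLeft fun x ξ hx => by
    rw [coefMain, leftCut_one hx.2.le]
    ring

lemma IsJost.good_midLow (hf : IsJost f) : Good MidLow (coefMain f) := by
  have o := isOpen_midLow
  have h1 : Symb MidLow coefWeight fun x ξ => Tcoef f ξ * f x ξ :=
    (hf.inner_Tf.restrict midLow_subset_inner).mono (K := 9) (by norm_num) fun x ξ hx =>
      sq_le_coefWeight hx.1.1 (inner_jap_mul_le (midLow_subset_inner hx))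
  have h2 := ((symb_rightCut.restrict fun p hp => hp.1.1).mul o
    ((symb_inner_comp_mul (contDiff_expI (-Complex.I))).restrict midLow_subset_inner)).mul o h1
  refine Good.of_symb o (((h2.weight_eq fun x ξ _ => ?_).add o midLow_leftCut).congr o
    fun x ξ _ => ?_)
  · rw [one_mul, one_mul]
  · rw [coefMain, mJost]
    push_cast
    rw [← mul_assoc (-Complex.I)]
    ring

lemma symb_midHigh_cut {φ : ℝ → ℂ}
    (h : Symb HighS (fun _ ξ => ξ⁻¹) fun _ ξ => φ ξ) :
    Symb MidHigh coefWeight fun x ξ => leftCut (cutVar x ξ) * φ ξ := by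
  refine ((symb_leftCut.restrict fun p hp => highS_pos hp.1).mul isOpen_midHigh
    (h.restrict fun p hp => hp.1)).mono (K := 4) (by norm_num) fun x ξ hx => ?_
  have h0 : 0 < ξ := highS_pos hx.1
  have h1 : 1 ≤ jap x * ξ := (midHigh_outer hx).2.2.le
  have h2 := inv_le_coefWeight one_pos h0 h1
  have h3 : jap x ≤ 2 := by linarith [jap_le x, midHigh_abs hx]
  have h4 : ξ⁻¹ = jap x * (jap x * ξ)⁻¹ := by
    rw [mul_inv, mul_inv_cancel_left₀ (jap_pos x).ne']
  have h5 : 0 ≤ (jap x * ξ)⁻¹ := by positivity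
  norm_num at h2
  rw [one_mul, h4]
  rw [← mul_inv] at h2
  rw [mul_comm ξ] at h2
  nlinarith

lemma IsJost.good_midHigh (hf : IsJost f) : Good MidHigh (coefMain f) := by
  have o := isOpen_midHigh
  have h1 : Symb MidHigh coefWeight fun x ξ =>
      (1 - leftCut (cutVar x ξ)) * (Tcoef f ξ * (mJost f x ξ - 1)) :=
    ((symb_rightCut.restrict fun p hp => highS_pos hp.1).mul o
      (hf.symb_tail o one_pos le_rfl midHigh_outer)).weight_eq fun x ξ _ => one_mul _
  have h2 := h1.sub o (symb_midHigh_cut hf.high_T)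
  refine ((hf.good_T.restrict fun p hp => highS_pos hp.1).add o (Good.of_symb o h2)).congr o
    fun x ξ _ => ?_
  rw [coefMain]
  ring

lemma cut_cover : ∀ p ∈ Upper, p ∈ FarLeft ∪ FarRight ∨ p ∈ MidLow ∪ MidHigh := fun p hp => by
  rcases lt_or_ge |cutVar p.1 p.2| (1 / 4) with h | h
  · exact Or.inr ((upper_cover p hp).imp (fun h' => ⟨h', h⟩) fun h' => ⟨h', h⟩)
  · rcases le_abs.1 h with h | h
    · exact Or.inl (Or.inr ⟨hp, by linarith⟩)
    · exact Or.inl (Or.inl ⟨hp, by linarith⟩)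

lemma good_of_cover {F : ℝ → ℝ → ℂ} (h1 : Good FarLeft F) (h2 : Good FarRight F)
    (h3 : Good MidLow F) (h4 : Good MidHigh F) : Good Upper F :=
  Good.union (isOpen_farLeft.union isOpen_farRight) (isOpen_midLow.union isOpen_midHigh)
    (h1.union isOpen_farLeft isOpen_farRight h2 fun _ hp => hp)
    (h3.union isOpen_midLow isOpen_midHigh h4 fun _ hp => hp) cut_cover

lemma IsJost.good_coefMain (hf : IsJost f) : Good Upper (coefMain f) :=
  good_of_cover good_farLeft hf.good_farRight hf.good_midLow hf.good_midHigh

lemma IsJost.good_cut_R (hf : IsJost f) :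
    Good Upper fun x ξ => leftCut (cutVar x ξ) * Rcoef f ξ := by
  refine good_of_cover ?_ ?_ ?_ ?_
  · exact (hf.good_R.restrict fun p hp => hp.1).congr isOpen_farLeft fun x ξ hx => by
      rw [leftCut_one hx.2.le, one_mul]
  · exact (Good.const 0).congr isOpen_farRight fun x ξ hx => by
      rw [leftCut_zero (by linarith [hx.2]), zero_mul]
  · exact Good.of_symb isOpen_midLow ((midLow_leftCut.mul isOpen_midLow
      (hf.symb_R.restrict fun p hp => hp.1.1)).weight_eq fun x ξ _ => mul_one _)
  · exact Good.of_symb isOpen_midHigh (symb_midHigh_cut hf.high_R)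

/-- The coefficient of `e^{ixξ}` for positive frequencies, up to normalisation. -/
def coefA (f : ℝ → ℝ → ℂ) (x ξ : ℝ) : ℂ :=
  (1 - leftCut (cutVar x ξ)) * (Tcoef f ξ * mJost f x ξ) +
    leftCut (cutVar x ξ) * (starRingEnd ℂ) (mJost f (-x) ξ)

/-- The coefficient of `e^{-ixξ}` for positive frequencies, up to normalisation. -/
def coefB (f : ℝ → ℝ → ℂ) (x ξ : ℝ) : ℂ :=
  leftCut (cutVar x ξ) * (Rcoef f ξ * mJost f (-x) ξ)

lemma IsJost.good_coefA (hf : IsJost f) : Good Upper (coefA f) := by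
  refine (hf.good_coefMain.add upper_open
    (Good.of_symb upper_open (hf.symb_cut_m.conj upper_open))).congr upper_open fun x ξ _ => ?_
  rw [coefMain, coefA, map_mul, map_sub, map_one, conj_leftCut]
  ring

lemma IsJost.good_coefB (hf : IsJost f) : Good Upper (coefB f) := by
  have h := (hf.symb_R.mul upper_open hf.symb_cut_m).weight_eq (w' := coefWeight)
    fun x ξ _ => one_mul _
  refine (hf.good_cut_R.add upper_open (Good.of_symb upper_open h)).congr upper_open
    fun x ξ _ => ?_
  rw [coefB]
  ring

lemma IsJost.coef_decomposition (hf : IsJost f) (hξ : 0 < ξ) (x : ℝ) :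
    Tcoef f ξ * f x ξ = Complex.exp (Complex.I * x * ξ) * coefA f x ξ +
      Complex.exp (-(Complex.I) * x * ξ) * coefB f x ξ := by
  have e1 : Complex.exp (Complex.I * x * ξ) * mJost f x ξ = f x ξ := by
    rw [mJost, ← mul_assoc, ← Complex.exp_add]
    rw [show Complex.I * x * ξ + -(Complex.I) * x * ξ = 0 by ring, Complex.exp_zero, one_mul]
  have e2 : Complex.exp (-(Complex.I) * x * ξ) * mJost f (-x) ξ = f (-x) ξ := by
    rw [mJost, ← mul_assoc, ← Complex.exp_add]
    rw [show -(Complex.I) * x * ξ + -(Complex.I) * (-x : ℝ) * ξ = 0 by push_cast; ring,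
      Complex.exp_zero, one_mul]
  have e3 : Complex.exp (Complex.I * x * ξ) * (starRingEnd ℂ) (mJost f (-x) ξ) =
      (starRingEnd ℂ) (f (-x) ξ) := by
    rw [← e2, map_mul, ← Complex.exp_conj]
    simp
  have hs := hf.scattering hξ x
  rw [coefA, coefB]
  linear_combination (1 - leftCut (cutVar x ξ)) * (-Tcoef f ξ * e1) -
    leftCut (cutVar x ξ) * e3 - leftCut (cutVar x ξ) * Rcoef f ξ * e2 +
    leftCut (cutVar x ξ) * hs

/-- Extension to negative frequencies by the symmetry `(x, ξ) ↦ (-x, -ξ)`. -/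
def evenExt (F : ℝ → ℝ → ℂ) (x ξ : ℝ) : ℂ := if 0 < ξ then F x ξ else F (-x) (-ξ)

lemma evenExt_pos {F : ℝ → ℝ → ℂ} (hξ : 0 < ξ) : evenExt F x ξ = F x ξ := if_pos hξ

lemma evenExt_neg {F : ℝ → ℝ → ℂ} (hξ : ξ ≠ 0) : evenExt F x (-ξ) = evenExt F (-x) ξ := by
  rcases lt_or_gt_of_ne hξ with h | h
  · rw [evenExt, evenExt, if_pos (by linarith), if_neg (by linarith), neg_neg]
  · rw [evenExt, evenExt, if_neg (by linarith), if_pos h, neg_neg]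

lemma isOpen_ne_zero_right : IsOpen {p : ℝ × ℝ | p.2 ≠ 0} :=
  isOpen_ne_fun continuous_snd continuous_const

lemma Good.evenExt {F : ℝ → ℝ → ℂ} (h : Good Upper F) : Good {p | p.2 ≠ 0} (evenExt F) := by
  have o : IsOpen {p : ℝ × ℝ | (-p.1, -p.2) ∈ Upper} :=
    upper_open.preimage (continuous_fst.neg.prodMk continuous_snd.neg)
  have h2 := (h.reflect upper_open).congr (G := _root_.evenExt F) o fun x ξ hx => by
    have : 0 < -ξ := hx
    rw [_root_.evenExt, if_neg (by linarith)]
  refine (h.congr upper_open fun x ξ hx => (evenExt_pos hx).symm).union upper_open o h2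
    fun p hp => ?_
  rcases lt_or_gt_of_ne hp with h | h
  · exact Or.inr (neg_pos.2 h)
  · exact Or.inl h

lemma Symb.exists_bound {w : ℝ → ℝ → ℝ} {F : ℝ → ℝ → ℂ} (h : Symb {p | p.2 ≠ 0} w F) :
    ∃ C : ℕ → ℕ → ℝ, ∀ k l, 0 ≤ C k l ∧
      ∀ x ξ, ξ ≠ 0 → ‖(DX^[k] (DXI^[l] F)) x ξ‖ ≤ C k l * w x ξ := by
  choose C hC hb using fun k l =>
    ((h.iterate isOpen_ne_zero_right (fun _ hp => hp) k l).2 0).bdd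
  exact ⟨C, fun k l => ⟨hC k l, hb k l⟩⟩

lemma coefWeight_mul_jap_le (x ξ : ℝ) : coefWeight x ξ * jap (x * ξ) ≤ 2 := by
  have hL := jap_mul_abs_nonneg x ξ
  have h1 : jap (x * ξ) ≤ 1 + jap x * |ξ| := by
    refine (jap_le _).trans (add_le_add_right ?_ _)
    rw [abs_mul]
    exact mul_le_mul_of_nonneg_right (abs_le_jap x) (abs_nonneg ξ)
  refine (mul_le_mul_of_nonneg_left h1 (coefWeight_nonneg x ξ)).trans ?_
  unfold coefWeight
  generalize jap x * |ξ| = L at *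
  rw [div_mul_eq_mul_div, div_le_iff₀ (by positivity)]
  nlinarith [mul_nonneg hL (sq_nonneg (L - 1)), sq_nonneg (L - 1)]

lemma coefWeight_le_sq (x ξ : ℝ) : coefWeight x ξ ≤ ξ ^ 2 * jap x ^ 2 := by
  have hL := jap_mul_abs_nonneg x ξ
  refine (div_le_self (sq_nonneg _) (le_add_of_nonneg_right (pow_nonneg hL 3))).trans_eq ?_
  rw [mul_pow, sq_abs, mul_comm]

lemma coefWeight_le_inv (x : ℝ) (hξ : ξ ≠ 0) : coefWeight x ξ ≤ (jap x * |ξ|)⁻¹ := by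
  have hL : 0 < jap x * |ξ| := mul_pos (jap_pos x) (abs_pos.2 hξ)
  unfold coefWeight
  generalize jap x * |ξ| = L at *
  rw [div_le_iff₀ (by positivity), le_inv_mul_iff₀ hL]
  nlinarith

end coefficients

lemma weight_x_le_bracket (x ξ : ℝ) :
    coefWeight x ξ / jap x ≤ 2 * ((jap x)⁻¹ * (jap (x * ξ))⁻¹) := by
  have h := coefWeight_mul_jap_le x ξ
  rw [← le_div_iff₀ (jap_pos _)] at h
  calc coefWeight x ξ / jap x ≤ 2 / jap (x * ξ) / jap x :=
        div_le_div_of_nonneg_right h (jap_pos x).le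
    _ = 2 * ((jap x)⁻¹ * (jap (x * ξ))⁻¹) := by ring

lemma weight_x_le_inner (x ξ : ℝ) : coefWeight x ξ / jap x ≤ ξ ^ 2 * jap x := by
  rw [div_le_iff₀ (jap_pos x)]
  exact (coefWeight_le_sq x ξ).trans_eq (by ring)

lemma weight_x_le_high (x : ℝ) {ξ : ℝ} (hξ : ξ ≠ 0) :
    coefWeight x ξ / jap x ≤ |ξ|⁻¹ * (jap x ^ 2)⁻¹ := by
  refine (div_le_div_of_nonneg_right (coefWeight_le_inv x hξ) (jap_pos x).le).trans_eq ?_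
  rw [mul_inv, div_eq_mul_inv]
  ring

lemma weight_x_le_outer {x ξ : ℝ} (hx : x ≠ 0) (hξ : ξ ≠ 0) :
    coefWeight x ξ / jap x ≤ (x ^ 2)⁻¹ * |ξ|⁻¹ := by
  refine (weight_x_le_high x hξ).trans ?_
  rw [mul_comm]
  refine mul_le_mul_of_nonneg_right (inv_anti₀ (by positivity) ?_) (by positivity)
  rw [jap_sq]
  linarith

lemma weight_xi_le_low (x ξ : ℝ) :
    (1 + ξ ^ 2)⁻¹ + coefWeight x ξ / |ξ| ≤ 2 * (1 + |ξ|⁻¹ * (jap (x * ξ))⁻¹) := by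
  have h := coefWeight_mul_jap_le x ξ
  rw [← le_div_iff₀ (jap_pos _)] at h
  have h1 : (1 + ξ ^ 2)⁻¹ ≤ 1 := inv_le_one_of_one_le₀ (by nlinarith [sq_nonneg ξ])
  have h2 : coefWeight x ξ / |ξ| ≤ 2 / jap (x * ξ) / |ξ| :=
    div_le_div_of_nonneg_right h (abs_nonneg ξ)
  have h3 : 2 / jap (x * ξ) / |ξ| = 2 * (|ξ|⁻¹ * (jap (x * ξ))⁻¹) := by ring
  linarith

lemma weight_xi_le_high (x : ℝ) {ξ : ℝ} (hξ : ξ ≠ 0) :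
    (1 + ξ ^ 2)⁻¹ + coefWeight x ξ / |ξ| ≤ 2 * (ξ ^ 2)⁻¹ := by
  have h1 : (1 + ξ ^ 2)⁻¹ ≤ (ξ ^ 2)⁻¹ := inv_anti₀ (by positivity) (by linarith)
  have h2 : coefWeight x ξ / |ξ| ≤ (ξ ^ 2)⁻¹ := by
    refine (div_le_div_of_nonneg_right (coefWeight_le_inv x hξ) (abs_nonneg ξ)).trans ?_
    rw [div_eq_mul_inv, ← mul_inv]
    refine inv_anti₀ (by positivity) ?_
    rw [← sq_abs ξ, mul_assoc, ← sq]
    exact le_mul_of_one_le_left (sq_nonneg _) (one_le_jap x)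
  linarith

/-- finer derivative bounds on the coefficients `a, b` of the distorted
Fourier basis, stable under arbitrary applications of `⟨x⟩∂ₓ` and `ξ∂_ξ`. -/
theorem finer_ab_bounds
    (fplus : ℝ → ℝ → ℂ)
    (hsmooth : ContDiffOn ℝ (⊤ : ℕ∞) (fun p : ℝ × ℝ => fplus p.1 p.2) {p : ℝ × ℝ | 0 < p.2})
    (hODE : ∀ ξ : ℝ, 0 < ξ → ∀ x : ℝ,
      - deriv (deriv (fun y : ℝ => fplus y ξ)) x
          + ((2 / (1 + x ^ 2) : ℝ) : ℂ) * fplus x ξ = ((ξ : ℂ)) ^ 2 * fplus x ξ)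
    (hAsym : ∀ ξ : ℝ, 0 < ξ →
      Tendsto (fun x : ℝ => Complex.exp (-(Complex.I) * x * ξ) * fplus x ξ)
        atTop (nhds 1))
    (hAsym' : ∀ ξ : ℝ, 0 < ξ →
      Tendsto (fun x : ℝ =>
          Complex.exp (-(Complex.I) * x * ξ) * deriv (fun y : ℝ => fplus y ξ) x)
        atTop (nhds (Complex.I * ξ))) :
    ∃ a b : ℝ → ℝ → ℂ,
      ContDiffOn ℝ (⊤ : ℕ∞) (fun p : ℝ × ℝ => a p.1 p.2) {p : ℝ × ℝ | p.2 ≠ 0} ∧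
      ContDiffOn ℝ (⊤ : ℕ∞) (fun p : ℝ × ℝ => b p.1 p.2) {p : ℝ × ℝ | p.2 ≠ 0} ∧
      -- decomposition of the basis for ξ > 0
      (∀ x ξ : ℝ, 0 < ξ →
        eBasis fplus x ξ
          = Complex.exp (Complex.I * x * ξ) * a x ξ
            + Complex.exp (-(Complex.I) * x * ξ) * b x ξ) ∧
      -- extension to negative frequencies by symmetry
      (∀ x ξ : ℝ, ξ ≠ 0 → a x (-ξ) = a (-x) ξ ∧ b x (-ξ) = b (-x) ξ) ∧
      ∃ C : ℕ → ℕ → ℝ, (∀ k l : ℕ, 0 < C k l) ∧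
      -- small frequencies 0 < |ξ| ≤ 1
      (∀ k l : ℕ, ∀ x ξ : ℝ, ξ ≠ 0 → |ξ| ≤ 1 →
        ‖(DX^[k] (DXI^[l] (PDX a))) x ξ‖ + ‖(DX^[k] (DXI^[l] (PDX b))) x ξ‖
          ≤ C k l * (jap x)⁻¹ * (jap (x * ξ))⁻¹) ∧
      (∀ k l : ℕ, ∀ x ξ : ℝ, ξ ≠ 0 → |ξ| ≤ 1 →
        ‖(DX^[k] (DXI^[l] (PDXI a))) x ξ‖ + ‖(DX^[k] (DXI^[l] (PDXI b))) x ξ‖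
          ≤ C k l * (1 + |ξ|⁻¹ * (jap (x * ξ))⁻¹)) ∧
      (∀ k l : ℕ, ∀ x ξ : ℝ, ξ ≠ 0 → |ξ| ≤ 1 → |x * ξ| ≤ 1 →
        ‖(DX^[k] (DXI^[l] (PDX a))) x ξ‖ + ‖(DX^[k] (DXI^[l] (PDX b))) x ξ‖
          ≤ C k l * ξ ^ 2 * jap x) ∧
      (∀ k l : ℕ, ∀ x ξ : ℝ, ξ ≠ 0 → |ξ| ≤ 1 → 1 ≤ |x * ξ| →
        ‖(DX^[k] (DXI^[l] (PDX a))) x ξ‖ + ‖(DX^[k] (DXI^[l] (PDX b))) x ξ‖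
          ≤ C k l * (x ^ 2)⁻¹ * |ξ|⁻¹) ∧
      -- large frequencies |ξ| ≥ 1
      (∀ k l : ℕ, ∀ x ξ : ℝ, 1 ≤ |ξ| →
        ‖(DX^[k] (DXI^[l] (PDX a))) x ξ‖ + ‖(DX^[k] (DXI^[l] (PDX b))) x ξ‖
          ≤ C k l * |ξ|⁻¹ * ((jap x) ^ 2)⁻¹) ∧
      (∀ k l : ℕ, ∀ x ξ : ℝ, 1 ≤ |ξ| →
        ‖(DX^[k] (DXI^[l] (PDXI a))) x ξ‖ + ‖(DX^[k] (DXI^[l] (PDXI b))) x ξ‖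
          ≤ C k l * (ξ ^ 2)⁻¹) := by
  have hf : IsJost fplus := by
    refine ⟨hsmooth, fun ξ hξ x => ?_, hAsym, hAsym'⟩
    have h : -PDX (PDX fplus) x ξ + ((2 / (1 + x ^ 2) : ℝ) : ℂ) * fplus x ξ =
        (ξ : ℂ) ^ 2 * fplus x ξ := hODE ξ hξ x
    linear_combination -h
  set ρ : ℂ := Complex.ofReal (Real.sqrt (2 * Real.pi))⁻¹
  have ga := hf.good_coefA.evenExt.const_mul isOpen_ne_zero_right ρ
  have gb := hf.good_coefB.evenExt.const_mul isOpen_ne_zero_right ρ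
  obtain ⟨C₁, h₁⟩ := ga.2.1.exists_bound
  obtain ⟨C₂, h₂⟩ := gb.2.1.exists_bound
  obtain ⟨C₃, h₃⟩ := ga.2.2.exists_bound
  obtain ⟨C₄, h₄⟩ := gb.2.2.exists_bound
  refine ⟨fun x ξ => ρ * evenExt (coefA fplus) x ξ, fun x ξ => ρ * evenExt (coefB fplus) x ξ,
    ga.1, gb.1, fun x ξ hξ => ?_, fun x ξ hξ => ?_,
    fun k l => 2 * (C₁ k l + C₂ k l + C₃ k l + C₄ k l) + 1, fun k l => ?_, ?_⟩
  · simp only [evenExt_pos hξ]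
    rw [eBasis, mul_assoc, hf.coef_decomposition hξ x]
    ring
  · exact ⟨congrArg _ (evenExt_neg hξ), congrArg _ (evenExt_neg hξ)⟩
  · linarith [(h₁ k l).1, (h₂ k l).1, (h₃ k l).1, (h₄ k l).1]
  have bound {A B s t w v : ℝ} (k l : ℕ) (hw : w ≤ 2 * v) (hv : 0 ≤ v)
      (hA : s ≤ A * w) (hB : t ≤ B * w) (hA0 : 0 ≤ A) (hB0 : 0 ≤ B)
      (h : A + B ≤ C₁ k l + C₂ k l + C₃ k l + C₄ k l) :
      s + t ≤ (2 * (C₁ k l + C₂ k l + C₃ k l + C₄ k l) + 1) * v := by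
    have h5 := mul_le_mul_of_nonneg_left hw (add_nonneg hA0 hB0)
    have h6 := mul_le_mul_of_nonneg_right h hv
    nlinarith
  have boundX (k l : ℕ) {x ξ v : ℝ} (hξ : ξ ≠ 0) (hw : coefWeight x ξ / jap x ≤ 2 * v)
      (hv : 0 ≤ v) := bound k l hw hv ((h₁ k l).2 x ξ hξ) ((h₂ k l).2 x ξ hξ) (h₁ k l).1 (h₂ k l).1
    (by linarith [(h₃ k l).1, (h₄ k l).1])
  have boundXi (k l : ℕ) {x ξ v : ℝ} (hξ : ξ ≠ 0)
      (hw : (1 + ξ ^ 2)⁻¹ + coefWeight x ξ / |ξ| ≤ 2 * v)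
      (hv : 0 ≤ v) := bound k l hw hv ((h₃ k l).2 x ξ hξ) ((h₄ k l).2 x ξ hξ) (h₃ k l).1 (h₄ k l).1
    (by linarith [(h₁ k l).1, (h₂ k l).1])
  have ne {ξ : ℝ} (h : 1 ≤ |ξ|) : ξ ≠ 0 := abs_pos.1 (one_pos.trans_le h)
  refine ⟨fun k l x ξ hξ _ => ?_, fun k l x ξ hξ _ => ?_, fun k l x ξ hξ _ _ => ?_,
    fun k l x ξ hξ _ hx => ?_, fun k l x ξ hξ => ?_, fun k l x ξ hξ => ?_⟩
  · rw [mul_assoc]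
    have := jap_pos x
    have := jap_pos (x * ξ)
    exact boundX k l hξ (weight_x_le_bracket x ξ) (by positivity)
  · have := jap_pos (x * ξ)
    exact boundXi k l hξ (weight_xi_le_low x ξ) (by positivity)
  · rw [mul_assoc]
    have h : 0 ≤ ξ ^ 2 * jap x := mul_nonneg (sq_nonneg ξ) (jap_pos x).le
    exact boundX k l hξ (by linarith [weight_x_le_inner x ξ]) h
  · rw [mul_assoc]
    have h : 0 ≤ (x ^ 2)⁻¹ * |ξ|⁻¹ := by positivity
    exact boundX k l hξ (by linarith [weight_x_le_outer (left_ne_zero_of_mul (ne hx)) hξ]) h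
  · rw [mul_assoc]
    have h : 0 ≤ |ξ|⁻¹ * (jap x ^ 2)⁻¹ := by positivity
    exact boundX k l (ne hξ) (by linarith [weight_x_le_high x (ne hξ)]) h
  · exact boundXi k l (ne hξ) (weight_xi_le_high x (ne hξ)) (by positivity)
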